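/- arXiv:1810.08374 — 3 statements merged into one kernel-verified Lean document; each statement's English description precedes it below -/
import Mathlib

section
/- Let X be a Cantor space, K a divisible dynamical simplex on X, and X = A ∪ B a partition of X into two disjoint nonempty clopen sets. Then there exists a minimal homeomorphism φ of X such that K = {μ ∈ Prob(X) : φ_*μ = μ} and such that for all x ≠ y in X there exists k ∈ ℤ with φ^k(x) ∈ A and φ^k(y) ∈ B (that is, the {A,B}-itinerary map x ↦ (n ↦ indicator of φ^n(x) ∈ B) is injective, and gives an equivariant embedding of (X, φ) into ({0,1}^ℤ, shift)). -/
open MeasureTheory Set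
open scoped ENNReal NNReal

/-- `K` is a dynamical simplex: nonempty, compact, convex, all its elements are atomless
with full support, and it has the Glasner–Weiss property. -/
def IsDynSimplex {X : Type*} [TopologicalSpace X] [MeasurableSpace X] [OpensMeasurableSpace X]
    (K : Set (ProbabilityMeasure X)) : Prop :=
  K.Nonempty ∧ IsCompact K ∧
    (∀ μ ∈ K, ∀ ν ∈ K, ∀ t : ℝ≥0∞, t ≤ 1 →
      ∃ σ ∈ K, (σ : Measure X) = t • (μ : Measure X) + (1 - t) • (ν : Measure X)) ∧
    (∀ μ ∈ K, NoAtoms (μ : Measure X)) ∧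
    (∀ μ ∈ K, (μ : Measure X).IsOpenPosMeasure) ∧
    (∀ U V : Set X, IsClopen U → IsClopen V →
      (∀ μ ∈ K, (μ : Measure X) U < (μ : Measure X) V) →
      ∃ W : Set X, IsClopen W ∧ W ⊆ V ∧
        ∀ μ ∈ K, (μ : Measure X) W = (μ : Measure X) U)

/-- `K` is divisible: for every clopen `U` and every `n ≥ 1` there is a clopen `V ⊆ U`
of measure `μ(U)/n` for every `μ ∈ K`. -/
def Divisible {X : Type*} [TopologicalSpace X] [MeasurableSpace X]
    (K : Set (ProbabilityMeasure X)) : Prop :=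
  ∀ U : Set X, IsClopen U → ∀ n : ℕ, 1 ≤ n →
    ∃ V : Set X, IsClopen V ∧ V ⊆ U ∧
      ∀ μ ∈ K, (μ : Measure X) V = (μ : Measure X) U / n

/-- A homeomorphism is minimal if every one of its (two-sided) orbits is dense. -/
def IsMinimalHomeo {X : Type*} [TopologicalSpace X] (φ : X ≃ₜ X) : Prop :=
  ∀ x : X, Dense (Set.range fun k : ℤ => (φ.toEquiv ^ k) x)


structure GoodCone {ι : Type*} (C : AddSubmonoid (ι → ℝ)) : Prop where
  div : ∀ g ∈ C, ∀ n : ℕ, 0 < n → (n : ℝ)⁻¹ • g ∈ C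
  sub : ∀ g ∈ C, ∀ g' ∈ C, (∀ μ, g' μ < g μ) → g - g' ∈ C
  riesz : ∀ (I J : Type) [Fintype I] [Fintype J] (a : I → ι → ℝ) (b : J → ι → ℝ),
    (∀ i, a i ∈ C) → (∀ j, b j ∈ C) → ∑ i, a i = ∑ j, b j →
    ∃ d : I → J → ι → ℝ, (∀ i j, d i j ∈ C) ∧ (∀ i, ∑ j, d i j = a i) ∧ (∀ j, ∑ i, d i j = b j)
  pos : ∀ g ∈ C, g = 0 ∨ ∃ δ : ℝ, 0 < δ ∧ ∀ μ, δ ≤ g μ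
  bdd : ∀ g ∈ C, ∃ B : ℝ, ∀ μ, g μ ≤ B

/-- Shen-type lemma, one exact relation. -/
lemma shen_one {ι : Type*} {C : AddSubmonoid (ι → ℝ)} (hC : GoodCone C)
    {Q : Type} [Fintype Q] (c : Q → ι → ℝ) (hc : ∀ q, c q ∈ C) (f : Q → ℤ)
    (hf : ∑ q, (f q : ℝ) • c q = 0) :
    ∃ (S : Type) (_ : Fintype S) (g : S → ι → ℝ) (m : Q → S → ℕ),
      (∀ k, g k ∈ C) ∧ (∀ q, c q = ∑ k, (m q k : ℝ) • g k) ∧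
      ∀ k, ∑ q, f q * (m q k : ℤ) = 0 := by
  classical
  let P := {q : Q // 0 < f q}
  let N := {q : Q // f q < 0}
  let Z := {q : Q // f q = 0}
  have hnat : ∀ (n : ℕ) (g : ι → ℝ), g ∈ C → (n : ℝ) • g ∈ C := by
    intro n g hg
    have := C.nsmul_mem hg n
    rwa [← Nat.cast_smul_eq_nsmul ℝ] at this
  have split : ∀ {M : Type _} [AddCommGroup M] (F : Q → M),
      ∑ q, F q = ∑ p : P, F p.1 + ∑ p : N, F p.1 + ∑ p : Z, F p.1 := by
    intro M _ F
    have h1 : ∑ p : P, F p.1 = ∑ q, if 0 < f q then F q else 0 := by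
      rw [← Finset.sum_filter]; exact (Finset.sum_subtype _ (by simp) _).symm
    have h2 : ∑ p : N, F p.1 = ∑ q, if f q < 0 then F q else 0 := by
      rw [← Finset.sum_filter]; exact (Finset.sum_subtype _ (by simp) _).symm
    have h3 : ∑ p : Z, F p.1 = ∑ q, if f q = 0 then F q else 0 := by
      rw [← Finset.sum_filter]; exact (Finset.sum_subtype _ (by simp) _).symm
    rw [h1, h2, h3, ← Finset.sum_add_distrib, ← Finset.sum_add_distrib]
    refine Finset.sum_congr rfl fun q _ => ?_
    rcases lt_trichotomy (f q) 0 with h | h | h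
    · simp [h, h.ne, not_lt.2 h.le]
    · simp [h]
    · simp [h, h.ne', not_lt.2 h.le]
  have hPp : ∀ p : P, 0 < (f p.1).natAbs := fun p => Int.natAbs_pos.2 p.2.ne'
  have hNp : ∀ p : N, 0 < (f p.1).natAbs := fun p => Int.natAbs_pos.2 p.2.ne
  have hPe : ∀ p : P, (((f p.1).natAbs : ℕ) : ℤ) = f p.1 := fun p => Int.natAbs_of_nonneg p.2.le
  have hNe : ∀ p : N, (((f p.1).natAbs : ℕ) : ℤ) = - f p.1 := fun p => by
    have := p.2; omega
  have hPr : ∀ p : P, (((f p.1).natAbs : ℕ) : ℝ) = (f p.1 : ℝ) := fun p => by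
    rw [← hPe p]; simp
  have hNr : ∀ p : N, (((f p.1).natAbs : ℕ) : ℝ) = -(f p.1 : ℝ) := fun p => by
    rw [← Int.cast_neg, ← hNe p]; simp
  obtain ⟨d, hd, hd1, hd2⟩ := hC.riesz P N (fun p => ((f p.1).natAbs : ℝ) • c p.1)
    (fun p => ((f p.1).natAbs : ℝ) • c p.1) (fun p => hnat _ _ (hc _)) (fun p => hnat _ _ (hc _)) (by
      rw [split] at hf
      have hz : ∑ p : Z, (f p.1 : ℝ) • c p.1 = 0 :=
        Finset.sum_eq_zero fun p _ => by rw [p.2]; simp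
      rw [hz, add_zero] at hf
      simp only [hPr, hNr, neg_smul, Finset.sum_neg_distrib]
      exact eq_neg_of_add_eq_zero_left hf)
  refine ⟨(P × N) ⊕ Z, inferInstance,
    Sum.elim (fun x => ((((f x.1.1).natAbs * (f x.2.1).natAbs : ℕ)) : ℝ)⁻¹ • d x.1 x.2) (fun z => c z.1),
    fun q => Sum.elim (fun x => (if x.1.1 = q then (f x.2.1).natAbs else 0) +
      (if x.2.1 = q then (f x.1.1).natAbs else 0)) (fun z => if z.1 = q then 1 else 0), ?_, ?_, ?_⟩
  · rintro (x | z)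
    · exact hC.div _ (hd _ _) _ (Nat.mul_pos (hPp _) (hNp _))
    · exact hc _
  · intro q
    rw [Fintype.sum_sum_type, Fintype.sum_prod_type]
    simp only [Sum.elim_inl, Sum.elim_inr, Nat.cast_add, Nat.cast_ite, Nat.cast_zero, Nat.cast_one,
      add_smul, ite_smul, zero_smul, one_smul, Finset.sum_add_distrib]
    have e1 : ∀ p : P, ∑ n : N, ((f n.1).natAbs : ℝ) •
        ((((f p.1).natAbs * (f n.1).natAbs : ℕ)) : ℝ)⁻¹ • d p n = c p.1 := by
      intro p
      have h0 : ((f p.1).natAbs : ℝ) ≠ 0 := by exact_mod_cast (hPp p).ne'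
      have : ∀ n : N, ((f n.1).natAbs : ℝ) •
        ((((f p.1).natAbs * (f n.1).natAbs : ℕ)) : ℝ)⁻¹ • d p n = ((f p.1).natAbs : ℝ)⁻¹ • d p n := by
        intro n
        have h1 : ((f n.1).natAbs : ℝ) ≠ 0 := by exact_mod_cast (hNp n).ne'
        rw [smul_smul]; congr 1; push_cast; field_simp
      rw [Finset.sum_congr rfl fun n _ => this n, ← Finset.smul_sum, hd1, smul_smul,
        inv_mul_cancel₀ h0, one_smul]
    have e2 : ∀ n : N, ∑ p : P, ((f p.1).natAbs : ℝ) •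
        ((((f p.1).natAbs * (f n.1).natAbs : ℕ)) : ℝ)⁻¹ • d p n = c n.1 := by
      intro n
      have h0 : ((f n.1).natAbs : ℝ) ≠ 0 := by exact_mod_cast (hNp n).ne'
      have : ∀ p : P, ((f p.1).natAbs : ℝ) •
        ((((f p.1).natAbs * (f n.1).natAbs : ℕ)) : ℝ)⁻¹ • d p n = ((f n.1).natAbs : ℝ)⁻¹ • d p n := by
        intro p
        have h1 : ((f p.1).natAbs : ℝ) ≠ 0 := by exact_mod_cast (hPp p).ne'
        rw [smul_smul]; congr 1; push_cast; field_simp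
      rw [Finset.sum_congr rfl fun n _ => this n, ← Finset.smul_sum, hd2, smul_smul,
        inv_mul_cancel₀ h0, one_smul]
    have e3 : ∑ p : P, ∑ n : N, (if p.1 = q then ((f n.1).natAbs : ℝ) •
        ((((f p.1).natAbs * (f n.1).natAbs : ℕ)) : ℝ)⁻¹ • d p n else 0)
        = ∑ p : P, if p.1 = q then c p.1 else 0 := by
      refine Finset.sum_congr rfl fun p _ => ?_
      split_ifs
      · exact e1 p
      · simp
    have e4 : ∑ p : P, ∑ n : N, (if n.1 = q then ((f p.1).natAbs : ℝ) •
        ((((f p.1).natAbs * (f n.1).natAbs : ℕ)) : ℝ)⁻¹ • d p n else 0)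
        = ∑ p : N, if p.1 = q then c p.1 else 0 := by
      rw [Finset.sum_comm]
      refine Finset.sum_congr rfl fun p _ => ?_
      split_ifs
      · exact e2 p
      · simp
    rw [e3, e4, ← split (fun x => if x = q then c x else 0)]
    simp
  · rintro (⟨p, n⟩ | z)
    · simp only [Sum.elim_inl, Nat.cast_add, Nat.cast_ite, Nat.cast_zero, mul_add, mul_ite, mul_zero,
        Finset.sum_add_distrib, Finset.sum_ite_eq, Finset.mem_univ, if_true, hPe, hNe]
      ring
    · simp [z.2]

/-- Shen-type lemma, one inequality. -/
lemma shen_ineq {ι : Type*} {C : AddSubmonoid (ι → ℝ)} (hC : GoodCone C)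
    {Q : Type} [Fintype Q] (c : Q → ι → ℝ) (hc : ∀ q, c q ∈ C) (f : Q → ℤ)
    (hf : ∑ q, (f q : ℝ) • c q ∈ C) :
    ∃ (S : Type) (_ : Fintype S) (g : S → ι → ℝ) (m : Q → S → ℕ),
      (∀ k, g k ∈ C) ∧ (∀ q, c q = ∑ k, (m q k : ℝ) • g k) ∧
      ∀ k, 0 ≤ ∑ q, f q * (m q k : ℤ) := by
  obtain ⟨S, hS, g, m, h1, h2, h3⟩ := shen_one hC (Q := Option Q)
    (fun o => o.elim (∑ q, (f q : ℝ) • c q) c) (by rintro (_ | q); exacts [hf, hc q])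
    (fun o => o.elim (-1) f) (by simp [Fintype.sum_option])
  refine ⟨S, hS, g, fun q k => m (some q) k, h1, fun q => h2 (some q), fun k => ?_⟩
  have := h3 k
  simp [Fintype.sum_option] at this
  change 0 ≤ ∑ q, f q * (m (some q) k : ℤ)
  omega

lemma shen_list {ι : Type*} {C : AddSubmonoid (ι → ℝ)} (hC : GoodCone C)
    {Q : Type} [Fintype Q] (c : Q → ι → ℝ) (hc : ∀ q, c q ∈ C) (l : List (Q → ℤ))
    (hf : ∀ f ∈ l, ∑ q, (f q : ℝ) • c q ∈ C) :
    ∃ (S : Type) (_ : Fintype S) (g : S → ι → ℝ) (m : Q → S → ℕ),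
      (∀ k, g k ∈ C) ∧ (∀ q, c q = ∑ k, (m q k : ℝ) • g k) ∧
      ∀ f ∈ l, ∀ k, 0 ≤ ∑ q, f q * (m q k : ℤ) := by
  classical
  induction l with
  | nil =>
    refine ⟨Q, inferInstance, c, fun q k => if q = k then 1 else 0, hc, fun q => by simp, by simp⟩
  | cons f l ih =>
    obtain ⟨S, _, g, m, h1, h2, h3⟩ := ih (fun f hf' => hf f (List.mem_cons_of_mem _ hf'))
    obtain ⟨S', hS', g', m', h1', h2', h3'⟩ := shen_ineq hC g h1 (fun k => ∑ q, f q * (m q k : ℤ)) (by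
      have := hf f List.mem_cons_self
      convert this using 1
      simp only [h2, Finset.smul_sum, smul_smul]
      rw [Finset.sum_comm]
      refine Finset.sum_congr rfl fun k _ => ?_
      push_cast
      rw [Finset.sum_smul])
    have key : ∀ (f : Q → ℤ) k', ∑ q, f q * ((∑ k, m q k * m' k k' : ℕ) : ℤ)
        = ∑ k, (∑ q, f q * (m q k : ℤ)) * (m' k k' : ℤ) := by
      intro f k'
      push_cast
      simp only [Finset.mul_sum, Finset.sum_mul]
      rw [Finset.sum_comm]
      simp only [mul_assoc]
    refine ⟨S', hS', g', fun q k' => ∑ k, m q k * m' k k', h1', fun q => ?_, ?_⟩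
    · rw [h2]
      simp only [h2', Finset.smul_sum, smul_smul]
      rw [Finset.sum_comm]
      refine Finset.sum_congr rfl fun k _ => ?_
      push_cast
      rw [Finset.sum_smul]
    · intro f' hf' k'
      rw [key]
      rcases List.mem_cons.1 hf' with rfl | hf'
      · exact h3' k'
      · exact Finset.sum_nonneg fun k _ => mul_nonneg (h3 _ hf' k) (by positivity)


/-- Full, equal height columns. -/
lemma shen_full {ι : Type*} [Nonempty ι] {C : AddSubmonoid (ι → ℝ)} (hC : GoodCone C)
    {Q : Type} [Fintype Q] [Nonempty Q] (c : Q → ι → ℝ) (hc : ∀ q, c q ∈ C) (hc0 : ∀ q, c q ≠ 0)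
    (l : List (Q → ℤ))
    (hf : ∀ f ∈ l, ∑ q, (f q : ℝ) • c q ∈ C) :
    ∃ (S : Type) (_ : Fintype S) (_ : Nonempty S) (g : S → ι → ℝ) (m : Q → S → ℕ),
      (∀ k, g k ∈ C) ∧ (∀ k, g k ≠ 0) ∧ (∀ q k, 1 ≤ m q k) ∧
      (∀ q, c q = ∑ k, (m q k : ℝ) • g k) ∧
      ∀ f ∈ l, ∀ k, 0 ≤ ∑ q, f q * (m q k : ℤ) := by
  classical
  obtain ⟨S0, hS0, g0, m0, a1, a2, a3⟩ := shen_list hC c hc l hf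
  let S := {k : S0 // g0 k ≠ 0}
  let g : S → ι → ℝ := fun k => g0 k.1
  let m : Q → S → ℕ := fun q k => m0 q k.1
  have hg : ∀ k, g k ∈ C := fun k => a1 _
  have hgne : ∀ k, g k ≠ 0 := fun k => k.2
  have hcm : ∀ q, c q = ∑ k, (m q k : ℝ) • g k := by
    intro q
    rw [a2 q]
    have : ∑ k : S, (m0 q k.1 : ℝ) • g0 k.1 = ∑ k with g0 k ≠ 0, (m0 q k : ℝ) • g0 k :=
      (Finset.sum_subtype (Finset.univ.filter fun k => g0 k ≠ 0) (fun x => by simp)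
        (fun k => (m0 q k : ℝ) • g0 k)).symm
    change _ = ∑ k : S, (m0 q k.1 : ℝ) • g0 k.1
    rw [this, Finset.sum_filter]
    refine Finset.sum_congr rfl fun k _ => ?_
    by_cases h : g0 k = 0 <;> simp [h]
  have hfm : ∀ f ∈ l, ∀ k, 0 ≤ ∑ q, f q * (m q k : ℤ) := fun f hf k => a3 f hf k.1
  have hSne : Nonempty S := by
    by_contra h
    rw [not_nonempty_iff] at h
    obtain ⟨q⟩ := ‹Nonempty Q›
    exact hc0 q (by rw [hcm q]; simp)
  have hM : ∀ q, 1 ≤ ∑ k, m q k := by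
    intro q
    by_contra h
    have h0 : ∑ k, m q k = 0 := by omega
    have h1 : ∀ k, m q k = 0 := fun k => by simpa using (Finset.sum_eq_zero_iff.1 h0) k (Finset.mem_univ k)
    exact hc0 q (by rw [hcm q]; simp [h1])
  have hδ : ∀ k, ∃ δ : ℝ, 0 < δ ∧ ∀ μ, δ ≤ g k μ := fun k => (hC.pos _ (hg k)).resolve_left (hgne k)
  choose δ hδ0 hδ using hδ
  obtain ⟨k0, -, hk0⟩ := Finset.exists_min_image (Finset.univ : Finset S) δ Finset.univ_nonempty
  obtain ⟨B, hB⟩ := hC.bdd (∑ k, g k) (sum_mem fun k _ => hg k)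
  obtain ⟨N, hN⟩ := exists_nat_gt (B / δ k0 + 1)
  have hBpos : 0 < B := by
    obtain ⟨μ⟩ := ‹Nonempty ι›
    refine lt_of_lt_of_le ?_ (hB μ)
    rw [Finset.sum_apply]
    exact Finset.sum_pos (fun k _ => lt_of_lt_of_le (hδ0 k) (hδ k μ)) Finset.univ_nonempty
  have hNpos : 0 < N := by
    have : (0 : ℝ) < N := lt_trans (by have := div_pos hBpos (hδ0 k0); linarith) hN
    exact_mod_cast this
  have hNr : (0 : ℝ) < N := by exact_mod_cast hNpos
  let s := Fintype.card S
  let σ := ∑ k, g k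
  let g' : S → ι → ℝ := fun k => (N : ℝ)⁻¹ • (g k - ((N + s : ℕ) : ℝ)⁻¹ • σ)
  have hNs : (0 : ℝ) < ((N + s : ℕ) : ℝ) := by positivity
  have hlt : ∀ k μ, (((N + s : ℕ) : ℝ)⁻¹ • σ) μ < g k μ := by
    intro k μ
    have h1 : σ μ ≤ B := hB μ
    have h2 : δ k0 ≤ g k μ := (hk0 k (Finset.mem_univ k)).trans (hδ k μ)
    have h3 : B < (N : ℝ) * δ k0 := by
      have : B / δ k0 < N := by linarith
      rwa [div_lt_iff₀ (hδ0 k0)] at this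
    have h4 : (N : ℝ) ≤ ((N + s : ℕ) : ℝ) := by push_cast; linarith [(Nat.cast_nonneg s : (0 : ℝ) ≤ s)]
    rw [Pi.smul_apply, smul_eq_mul, inv_mul_lt_iff₀ hNs]
    nlinarith [hδ0 k0]
  have hs : ∑ k, g' k = ((N + s : ℕ) : ℝ)⁻¹ • σ := by
    simp only [g', ← Finset.smul_sum, Finset.sum_sub_distrib, Finset.sum_const, Finset.card_univ]
    change (N : ℝ)⁻¹ • (σ - ((N + s : ℕ) : ℝ)⁻¹ • s • σ) = _
    rw [← Nat.cast_smul_eq_nsmul ℝ, smul_smul]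
    nth_rewrite 1 [← one_smul ℝ σ]
    rw [← sub_smul, smul_smul]
    congr 1
    push_cast at hNs ⊢
    field_simp
    ring
  refine ⟨S, inferInstance, hSne, g', fun q k => N * m q k + ∑ k, m q k, ?_, ?_, ?_, ?_, ?_⟩
  · intro k
    exact hC.div _ (hC.sub _ (hg k) _ (hC.div _ (sum_mem fun k _ => hg k) _ (by omega)) (hlt k)) _ hNpos
  · intro k h
    obtain ⟨μ⟩ := ‹Nonempty ι›
    have := congrFun h μ
    simp only [g', Pi.smul_apply, Pi.sub_apply, smul_eq_mul, Pi.zero_apply, mul_eq_zero, inv_eq_zero] at this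
    have h2 := hlt k μ
    simp only [Pi.smul_apply, smul_eq_mul] at h2
    rcases this with h | h <;> linarith
  · intro q k
    exact (hM q).trans (Nat.le_add_left _ _)
  · intro q
    simp only [Nat.cast_add, Nat.cast_mul, Nat.cast_sum, add_smul, Finset.sum_add_distrib]
    rw [← Finset.smul_sum, hs]
    have : ∀ k, ((N : ℝ) * m q k) • g' k = (m q k : ℝ) • g k - (m q k : ℝ) • (((N + s : ℕ) : ℝ)⁻¹ • σ) := by
      intro k
      rw [← smul_sub, mul_comm, mul_smul]
      simp only [g']
      rw [smul_inv_smul₀ hNr.ne']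
    rw [Finset.sum_congr rfl fun k _ => this k, Finset.sum_sub_distrib, ← hcm, ← Finset.sum_smul]
    simp
  · intro f hf k
    have e : ∑ q, f q * ((N * m q k + ∑ k, m q k : ℕ) : ℤ)
        = N * (∑ q, f q * (m q k : ℤ)) + ∑ k, ∑ q, f q * (m q k : ℤ) := by
      rw [Finset.sum_comm (γ := S), Finset.mul_sum, ← Finset.sum_add_distrib]
      refine Finset.sum_congr rfl fun q _ => ?_
      push_cast
      rw [mul_add, Finset.mul_sum]
      ring
    rw [e]
    exact add_nonneg (mul_nonneg (by positivity) (hfm f hf k)) (Finset.sum_nonneg fun k _ => hfm f hf k)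

/-- Final column lemma: equal total heights, at least two columns, multiplicities at least two. -/
lemma shen_final {ι : Type*} [Nonempty ι] {C : AddSubmonoid (ι → ℝ)} (hC : GoodCone C)
    {Q : Type} [Fintype Q] [Nonempty Q] (c : Q → ι → ℝ) (hc : ∀ q, c q ∈ C) (hc0 : ∀ q, c q ≠ 0)
    (l : List (Q → ℤ))
    (hf : ∀ f ∈ l, ∑ q, (f q : ℝ) • c q ∈ C) :
    ∃ (R D : ℕ) (g : Fin R → ι → ℝ) (m : Q → Fin R → ℕ), 2 ≤ R ∧
      (∀ k, g k ∈ C) ∧ (∀ k, g k ≠ 0) ∧ (∀ q k, 2 ≤ m q k) ∧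
      (∀ q, c q = ∑ k, (m q k : ℝ) • g k) ∧ (∀ k, ∑ q, m q k = D) ∧
      ∀ f ∈ l, ∀ k, 0 ≤ ∑ q, f q * (m q k : ℤ) := by
  classical
  obtain ⟨S, _, hne, g, m, h1, h2, h3, h4, h5⟩ := shen_full hC c hc hc0 l hf
  let Hh : S → ℕ := fun k => ∑ q, m q k
  have hH : ∀ k, 1 ≤ Hh k := by
    intro k
    obtain ⟨q⟩ := ‹Nonempty Q›
    exact (h3 q k).trans (Finset.single_le_sum (f := fun q => m q k) (fun _ _ => Nat.zero_le _) (Finset.mem_univ q))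
  let e : S → ℕ := fun k => ∏ l ∈ Finset.univ.erase k, Hh l
  have he : ∀ k, 1 ≤ e k := fun k => Finset.one_le_prod' fun i _ => hH i
  have heH : ∀ k, e k * Hh k = ∏ l, Hh l := fun k => Finset.prod_erase_mul _ _ (Finset.mem_univ k)
  let E := Fintype.equivFin (S × Bool)
  refine ⟨Fintype.card (S × Bool), 2 * ∏ l, Hh l,
    fun k => ((4 * e (E.symm k).1 : ℕ) : ℝ)⁻¹ • g (E.symm k).1,
    fun q k => 2 * e (E.symm k).1 * m q (E.symm k).1, ?_, ?_, ?_, ?_, ?_, ?_, ?_⟩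
  · rw [Fintype.card_prod, Fintype.card_bool]
    have := Fintype.card_pos (α := S)
    omega
  · exact fun k => hC.div _ (h1 _) _ (by have := he (E.symm k).1; omega)
  · intro k h
    have := he (E.symm k).1
    rw [smul_eq_zero] at h
    rcases h with h | h
    · rw [inv_eq_zero, Nat.cast_eq_zero] at h; omega
    · exact h2 _ h
  · intro q k
    have := he (E.symm k).1
    have := h3 q (E.symm k).1
    nlinarith
  · intro q
    rw [Equiv.sum_comp E.symm (fun k => ((2 * e k.1 * m q k.1 : ℕ) : ℝ) • ((4 * e k.1 : ℕ) : ℝ)⁻¹ • g k.1),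
      Fintype.sum_prod_type, h4 q]
    refine Finset.sum_congr rfl fun k _ => ?_
    have : (e k : ℝ) ≠ 0 := by have := he k; positivity
    rw [Fintype.sum_bool, ← two_smul ℝ, smul_smul, smul_smul]
    congr 1
    push_cast
    field_simp
    ring
  · intro k
    rw [← heH (E.symm k).1, ← Finset.mul_sum]
    ring
  · intro f hf k
    have := h5 f hf (E.symm k).1
    have e : ∑ q, f q * ((2 * e (E.symm k).1 * m q (E.symm k).1 : ℕ) : ℤ)
        = (2 * e (E.symm k).1) * ∑ q, f q * (m q (E.symm k).1 : ℤ) := by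
      rw [Finset.mul_sum]
      refine Finset.sum_congr rfl fun q _ => ?_
      push_cast; ring
    rw [e]
    positivity


lemma exists_assign {α β : Type*} [DecidableEq β] [Nonempty β] (Qs : Finset β) (n : β → ℕ) :
    ∀ (s : Finset α), ∑ q ∈ Qs, n q = s.card →
    ∃ f : α → β, (∀ a ∈ s, f a ∈ Qs) ∧ ∀ q ∈ Qs, (s.filter fun a => f a = q).card = n q := by
  classical
  induction Qs using Finset.induction_on with
  | empty =>
    intro s hs
    simp only [Finset.sum_empty] at hs
    have : s = ∅ := Finset.card_eq_zero.1 hs.symm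
    subst this
    exact ⟨fun _ => Classical.arbitrary β, by simp, by simp⟩
  | insert q Qs hq ih =>
    intro s hs
    rw [Finset.sum_insert hq] at hs
    obtain ⟨t, hts, htc⟩ := Finset.exists_subset_card_eq (s := s) (n := n q) (by omega)
    obtain ⟨f, hf1, hf2⟩ := ih (s \ t) (by rw [Finset.card_sdiff_of_subset hts]; omega)
    refine ⟨fun a => if a ∈ t then q else f a, ?_, ?_⟩
    · intro a ha
      by_cases h : a ∈ t
      · simp [h]
      · simp only [h, if_false]
        exact Finset.mem_insert_of_mem (hf1 a (by simp [ha, h]))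
    · intro q' hq'
      rcases Finset.mem_insert.1 hq' with rfl | hq'
      · rw [← htc]
        congr 1
        ext a
        simp only [Finset.mem_filter]
        constructor
        · rintro ⟨h1, h2⟩
          by_contra h
          rw [if_neg h] at h2
          exact hq (h2 ▸ hf1 a (by simp [h1, h]))
        · intro h
          exact ⟨hts h, by simp [h]⟩
      · rw [← hf2 q' hq']
        have hne : q ≠ q' := fun h => hq (h ▸ hq')
        congr 1
        ext a
        simp only [Finset.mem_filter, Finset.mem_sdiff]
        constructor
        · rintro ⟨h1, h2⟩
          by_cases h : a ∈ t
          · rw [if_pos h] at h2; exact absurd h2 hne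
          · rw [if_neg h] at h2; exact ⟨⟨h1, h⟩, h2⟩
        · rintro ⟨⟨h1, h⟩, h2⟩
          exact ⟨h1, by rw [if_neg h]; exact h2⟩

lemma sum_range_mul_block {M : Type*} [AddCommMonoid M] (a b : ℕ) (F : ℕ → M) :
    ∑ j ∈ Finset.range (a * b), F j = ∑ q ∈ Finset.range a, ∑ s ∈ Finset.range b, F (q * b + s) := by
  induction a with
  | zero => simp
  | succ a ih =>
    rw [Nat.succ_mul, Finset.sum_range_add, ih, Finset.sum_range_succ]

lemma exists_words (r R D0 : ℕ) (hr : 2 ≤ r) (hR : 1 ≤ R) (M : ℕ → ℕ → ℕ)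
    (hM : ∀ k < R, ∀ i < r, 2 ≤ M k i) (hD : ∀ k < R, ∑ i ∈ Finset.range r, M k i = D0) :
    ∃ (N H : ℕ) (w : ℕ → ℕ → ℕ), 1 ≤ N ∧ 1 ≤ H ∧ (∀ k < R, ∀ t < H, w k t < r) ∧
      (∀ k < R, ∀ i < r, ((Finset.range H).filter fun t => w k t = i).card = N * M k i) ∧
      (∀ k < R, w k 0 = 0) ∧ (∀ k < R, w k (H - 1) = 1) ∧
      ∀ a < R, ∀ b < R, ∀ d < H, (d ≠ 0 ∨ a ≠ b) → ∃ s, d + s < H ∧ w a s = 0 ∧ w b (d + s) ≠ 0 := by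
  classical
  have hD4 : 4 ≤ D0 := by
    rw [← hD 0 (by omega)]
    have h2 : ({0, 1} : Finset ℕ) ⊆ Finset.range r := by
      intro x hx; simp at hx; rw [Finset.mem_range]; omega
    refine le_trans ?_ (Finset.sum_le_sum_of_subset h2)
    rw [Finset.sum_pair (by norm_num)]
    have := hM 0 (by omega) 0 (by omega)
    have := hM 0 (by omega) 1 (by omega)
    omega
  -- the filler
  have hu : ∀ k, ∃ u : ℕ → ℕ, k < R → (∀ a < D0 - 3, u a < r) ∧ ∀ i < r,
      ((Finset.range (D0 - 3)).filter fun a => u a = i).card + (if i = 0 then 1 else 0) +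
        (if i = 1 then 2 else 0) = M k i := by
    intro k
    by_cases hk : k < R
    · obtain ⟨f, hf1, hf2⟩ := exists_assign (Finset.range r)
        (fun i => M k i - ((if i = 0 then 1 else 0) + (if i = 1 then 2 else 0))) (Finset.range (D0 - 3)) (by
          rw [Finset.card_range]
          have e : ∑ i ∈ Finset.range r, (M k i - ((if i = 0 then 1 else 0) + (if i = 1 then 2 else 0)))
              + ∑ i ∈ Finset.range r, ((if i = 0 then 1 else 0) + (if i = 1 then 2 else 0)) = D0 := by
            rw [← Finset.sum_add_distrib, ← hD k hk]
            refine Finset.sum_congr rfl fun i hi => ?_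
            have := hM k hk i (Finset.mem_range.1 hi)
            split_ifs <;> omega
          have e2 : ∑ i ∈ Finset.range r, ((if i = 0 then 1 else 0) + (if i = 1 then 2 else 0)) = 3 := by
            rw [Finset.sum_add_distrib, Finset.sum_ite_eq', Finset.sum_ite_eq']
            simp [show 0 < r by omega, show 1 < r by omega]
          omega)
      refine ⟨f, fun _ => ⟨fun a ha => by simpa using hf1 a (by simpa using ha), fun i hi => ?_⟩⟩
      rw [hf2 i (by simpa using hi)]
      have := hM k hk i hi
      split_ifs <;> omega
    · exact ⟨fun _ => 0, fun h => absurd h hk⟩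
  choose u hu using hu
  let t : ℕ → ℕ → ℕ := fun k s => if s < D0 - 3 then u k s else 1
  let v : ℕ → ℕ → ℕ := fun k s => if s = 0 then 1 else t k (s - 1)
  let cd : ℕ → ℕ → ℕ → ℕ := fun k l s =>
    if s = 0 then (if l = k then 0 else 1) else if s = 1 then (if l = k then 1 else 0) else t k (s - 2)
  obtain ⟨p, hp⟩ : ∃ p, p = D0 + 1 := ⟨_, rfl⟩
  obtain ⟨D1, hD1⟩ : ∃ D1, D0 = D1 + 1 := ⟨D0 - 1, by omega⟩
  obtain ⟨w, hw⟩ : ∃ w : ℕ → ℕ → ℕ, w = fun k j => if j < p then 0 else if j < p * D0 then v k ((j - p) % D1)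
    else cd k ((j - p * D0) / D0) ((j - p * D0) % D0) := ⟨_, rfl⟩
  have hpD : p * D0 = p + p * D1 := by rw [hD1]; ring
  have W1 : ∀ k j, j < p → w k j = 0 := fun k j h => by rw [hw]; simp [h]
  have W2 : ∀ k q s, q < p → s < D1 → w k (p + (q * D1 + s)) = v k s := by
    intro k q s hq hs
    have h1 : q * D1 + s < p * D1 := by
      calc q * D1 + s < (q + 1) * D1 := by rw [Nat.succ_mul]; omega
        _ ≤ p * D1 := Nat.mul_le_mul_right _ hq
    rw [hw]
    simp only
    rw [if_neg (by omega), if_pos (by omega), Nat.add_sub_cancel_left, Nat.mul_comm q, Nat.mul_add_mod,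
      Nat.mod_eq_of_lt hs]
  have W3 : ∀ k q s, s < D0 → w k (p * D0 + (q * D0 + s)) = cd k q s := by
    intro k q s hs
    rw [hw]
    simp only
    rw [if_neg (by have := Nat.zero_le (p * D1); omega), if_neg (by omega), Nat.add_sub_cancel_left, Nat.mul_comm q, Nat.mul_add_mod,
      Nat.mod_eq_of_lt hs, Nat.mul_add_div (by omega), Nat.div_eq_of_lt hs, add_zero]
  obtain ⟨H, hH⟩ : ∃ H, H = p * D0 + R * D0 := ⟨_, rfl⟩
  have hRD : D0 ≤ R * D0 := Nat.le_mul_of_pos_left _ hR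
  have hcnt : ∀ k < R, ∀ i < r, ∑ s ∈ Finset.range (D0 - 2), (if t k s = i then 1 else 0)
      + (if i = 0 then 1 else 0) + (if i = 1 then 1 else 0) = M k i := by
    intro k hk i hi
    rw [← (hu k hk).2 i hi, show D0 - 2 = (D0 - 3) + 1 by omega, Finset.sum_range_succ, Finset.card_filter]
    have : ∑ x ∈ Finset.range (D0 - 3), (if t k x = i then 1 else 0) =
        ∑ x ∈ Finset.range (D0 - 3), (if u k x = i then 1 else 0) := by
      refine Finset.sum_congr rfl fun x hx => ?_
      simp only [t, if_pos (Finset.mem_range.1 hx)]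
    rw [this]
    have : t k (D0 - 3) = 1 := by simp [t]
    rw [this]
    split_ifs <;> omega
  have hlast : ∀ k, w k (H - 1) = 1 := by
    intro k
    have e : H - 1 = p * D0 + ((R - 1) * D0 + (D0 - 1)) := by
      obtain ⟨R', rfl⟩ : ∃ R', R = R' + 1 := ⟨R - 1, by omega⟩
      rw [hH, Nat.succ_mul, Nat.add_sub_cancel]; omega
    rw [e, W3 _ _ _ (by omega)]
    simp only [cd, t]
    rw [if_neg (by omega), if_neg (by omega), if_neg (by omega)]
  refine ⟨p + R, H, w, by omega, by omega, ?_, ?_, ?_, fun k _ => hlast k, ?_⟩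
  · intro k hk j hj
    have ht : ∀ s, t k s < r := by
      intro s
      simp only [t]
      split_ifs with h
      · exact (hu k hk).1 s h
      · omega
    rw [hw]
    simp only [v, cd]
    split_ifs <;> first | omega | exact ht _
  · intro k hk i hi
    rw [Finset.card_filter, hH, Finset.sum_range_add]
    nth_rewrite 1 [hpD]
    rw [Finset.sum_range_add, sum_range_mul_block, sum_range_mul_block]
    have s1 : ∑ x ∈ Finset.range p, (if w k x = i then 1 else 0) = p * (if i = 0 then 1 else 0) := by
      rw [Finset.sum_congr rfl (g := fun _ => if i = 0 then 1 else 0)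
        (fun x hx => by rw [W1 k x (Finset.mem_range.1 hx)]; simp [eq_comm])]
      simp
    have s2 : ∑ q ∈ Finset.range p, ∑ s ∈ Finset.range D1, (if w k (p + (q * D1 + s)) = i then 1 else 0)
        = p * (∑ s ∈ Finset.range (D0 - 2), (if t k s = i then 1 else 0) + (if i = 1 then 1 else 0)) := by
      rw [Finset.sum_congr rfl (g := fun _ => (∑ s ∈ Finset.range (D0 - 2), (if t k s = i then 1 else 0) + (if i = 1 then 1 else 0)))]
      · simp
      · intro q hq
        rw [Finset.sum_congr rfl (g := fun s => if v k s = i then 1 else 0) (fun s hs => by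
          rw [W2 k q s (Finset.mem_range.1 hq) (Finset.mem_range.1 hs)]), show D1 = (D0 - 2) + 1 by omega,
          Finset.sum_range_succ']
        simp [v, eq_comm]
    have s3 : ∑ q ∈ Finset.range R, ∑ s ∈ Finset.range D0, (if w k (p * D0 + (q * D0 + s)) = i then 1 else 0)
        = R * (∑ s ∈ Finset.range (D0 - 2), (if t k s = i then 1 else 0) + (if i = 0 then 1 else 0) + (if i = 1 then 1 else 0)) := by
      rw [Finset.sum_congr rfl (g := fun _ => (∑ s ∈ Finset.range (D0 - 2), (if t k s = i then 1 else 0) + (if i = 0 then 1 else 0) + (if i = 1 then 1 else 0)))]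
      · simp
      · intro q hq
        rw [Finset.sum_congr rfl (g := fun s => if cd k q s = i then 1 else 0) (fun s hs => by
          rw [W3 k q s (Finset.mem_range.1 hs)])]
        conv_lhs => rw [show D0 = (D0 - 2) + 1 + 1 by omega]
        rw [Finset.sum_range_succ', Finset.sum_range_succ']
        have : ∑ x ∈ Finset.range (D0 - 2), (if cd k q (x + 1 + 1) = i then 1 else 0) =
            ∑ s ∈ Finset.range (D0 - 2), (if t k s = i then 1 else 0) := by
          refine Finset.sum_congr rfl fun x hx => ?_
          simp [cd]
        rw [this]
        simp only [cd]
        by_cases h : q = k <;> simp [h, eq_comm] <;> split_ifs <;> omega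
    rw [s1, s2, s3, hcnt k hk i hi, ← hcnt k hk i hi]
    ring
  · intro k hk
    exact W1 k 0 (by omega)
  · intro a ha b hb d hd hda
    have C0 : ∀ q, w b (p * D0 + q * D0) ≠ 0 ∨ w b (p * D0 + q * D0 + 1) ≠ 0 := by
      intro q
      have e1 := W3 b q 0 (by omega)
      have e2 := W3 b q 1 (by omega)
      rw [add_zero] at e1
      rw [← add_assoc] at e2
      rw [e1, e2]
      simp only [cd]
      by_cases h : q = b <;> simp [h]
    by_cases hd0 : d = 0
    · subst hd0
      have hab : a ≠ b := by simpa using hda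
      refine ⟨p * D0 + (a * D0 + 0), ?_, ?_, ?_⟩
      · have : (a + 1) * D0 ≤ R * D0 := Nat.mul_le_mul_right _ ha
        rw [Nat.succ_mul] at this
        omega
      · rw [W3 _ _ _ (by omega)]; simp [cd]
      · rw [zero_add, W3 _ _ _ (by omega)]; simp [cd, hab]
    · -- find a target position
      suffices ∃ j, d ≤ j ∧ j < H ∧ j < d + p ∧ w b j ≠ 0 by
        obtain ⟨j, h1, h2, h3, h4⟩ := this
        refine ⟨j - d, by omega, W1 _ _ (by omega), ?_⟩
        rwa [Nat.add_sub_cancel' h1]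
      by_cases c1 : d ≤ p
      · have := W2 b 0 0 (by omega) (by omega)
        refine ⟨p, c1, ?_, by omega, ?_⟩
        · have : 0 ≤ p * D1 := Nat.zero_le _
          omega
        · simp only [Nat.zero_mul, add_zero] at this
          rw [this]; simp [v]
      · by_cases c2 : d ≤ p * D0
        · -- ceil
          obtain ⟨e, rfl⟩ : ∃ e, d = p + e := ⟨d - p, by omega⟩
          obtain ⟨q, hq⟩ : ∃ q, q = (e + (D1 - 1)) / D1 := ⟨_, rfl⟩
          have hD1p : 0 < D1 := by omega
          have q1 : q * D1 ≤ e + (D1 - 1) := hq ▸ Nat.div_mul_le_self _ _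
          have q2 : e + (D1 - 1) < (q + 1) * D1 := by
            rw [hq]; exact Nat.lt_mul_of_div_lt (Nat.lt_succ_self _) hD1p
          rw [Nat.succ_mul] at q2
          by_cases c3 : q < p
          · have h5 := W2 b q 0 c3 hD1p
            have : q * D1 < p * D1 := Nat.mul_lt_mul_of_pos_right c3 hD1p
            refine ⟨p + q * D1, by omega, by omega, by omega, ?_⟩
            rw [add_zero] at h5
            rw [h5]; simp [v]
          · have q3 : p * D1 ≤ q * D1 := Nat.mul_le_mul_right _ (by omega)
            rcases C0 0 with h | h
            · rw [Nat.zero_mul, add_zero] at h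
              exact ⟨p * D0, by omega, by omega, by omega, h⟩
            · rw [Nat.zero_mul, add_zero] at h
              exact ⟨p * D0 + 1, by omega, by omega, by omega, h⟩
        · obtain ⟨e, rfl⟩ : ∃ e, d = p * D0 + e := ⟨d - p * D0, by omega⟩
          obtain ⟨q, hq⟩ : ∃ q, q = (e + (D0 - 1)) / D0 := ⟨_, rfl⟩
          have hD1p : 0 < D0 := by omega
          have q1 : q * D0 ≤ e + (D0 - 1) := hq ▸ Nat.div_mul_le_self _ _
          have q2 : e + (D0 - 1) < (q + 1) * D0 := by
            rw [hq]; exact Nat.lt_mul_of_div_lt (Nat.lt_succ_self _) hD1p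
          rw [Nat.succ_mul] at q2
          by_cases c3 : q < R
          · have : (q + 1) * D0 ≤ R * D0 := Nat.mul_le_mul_right _ c3
            rw [Nat.succ_mul] at this
            rcases C0 q with h | h
            · exact ⟨p * D0 + q * D0, by omega, by omega, by omega, h⟩
            · exact ⟨p * D0 + q * D0 + 1, by omega, by omega, by omega, h⟩
          · have q3 : R * D0 ≤ q * D0 := Nat.mul_le_mul_right _ (by omega)
            exact ⟨H - 1, by omega, by omega, by omega, by rw [hlast]; norm_num⟩

set_option linter.unusedSectionVars false

/-- The affine function on `K` given by a set. -/
noncomputable def dsVal {X : Type*} [MeasurableSpace X] (K : Set (ProbabilityMeasure X)) (U : Set X) :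
    K → ℝ := fun μ => ((μ.1 : ProbabilityMeasure X) : Measure X).real U

section
variable {X : Type*} [TopologicalSpace X] [CompactSpace X] [TopologicalSpace.MetrizableSpace X]
    [TotallyDisconnectedSpace X] [MeasurableSpace X] [BorelSpace X]
    {K : Set (ProbabilityMeasure X)}

lemma dsVal_nonneg (U : Set X) (μ : K) : 0 ≤ dsVal K U μ := measureReal_nonneg

lemma dsVal_le_one (U : Set X) (μ : K) : dsVal K U μ ≤ 1 := measureReal_le_one

lemma dsVal_empty : dsVal K (∅ : Set X) = 0 := by
  funext μ; simp [dsVal]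

lemma dsVal_union {U V : Set X} (hV : IsClopen V) (h : Disjoint U V) :
    dsVal K (U ∪ V) = dsVal K U + dsVal K V := by
  funext μ
  exact measureReal_union h hV.isOpen.measurableSet

lemma dsVal_diff {U V : Set X} (hV : IsClopen V) (h : V ⊆ U) :
    dsVal K (U \ V) = dsVal K U - dsVal K V := by
  funext μ
  exact measureReal_sdiff h hV.isOpen.measurableSet

lemma dsVal_compl {V : Set X} (hV : IsClopen V) (μ : K) :
    dsVal K (Vᶜ) μ = 1 - dsVal K V μ := by
  exact probReal_compl_eq_one_sub hV.isOpen.measurableSet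

lemma dsVal_pos (hK : IsDynSimplex K) {U : Set X} (hU : IsClopen U) (hne : U.Nonempty) (μ : K) :
    0 < dsVal K U μ := by
  have := hK.2.2.2.2.1 μ.1 μ.2
  exact ENNReal.toReal_pos (hU.isOpen.measure_pos _ hne).ne' (measure_ne_top _ _)

lemma dsVal_gw (hK : IsDynSimplex K) {U V : Set X} (hU : IsClopen U) (hV : IsClopen V)
    (h : ∀ μ, dsVal K U μ < dsVal K V μ) :
    ∃ W, IsClopen W ∧ W ⊆ V ∧ dsVal K W = dsVal K U := by
  obtain ⟨W, h1, h2, h3⟩ := hK.2.2.2.2.2 U V hU hV (fun μ hμ => by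
    have := h ⟨μ, hμ⟩
    exact (ENNReal.toReal_lt_toReal (measure_ne_top _ _) (measure_ne_top _ _)).1 this)
  refine ⟨W, h1, h2, ?_⟩
  funext μ
  simp only [dsVal, measureReal_def, h3 μ.1 μ.2]

lemma dsVal_div (hdiv : Divisible K) {U : Set X} (hU : IsClopen U) (n : ℕ) (hn : 1 ≤ n) :
    ∃ V, IsClopen V ∧ V ⊆ U ∧ dsVal K V = (n : ℝ)⁻¹ • dsVal K U := by
  obtain ⟨V, h1, h2, h3⟩ := hdiv U hU n hn
  refine ⟨V, h1, h2, ?_⟩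
  funext μ
  simp only [dsVal, measureReal_def, h3 μ.1 μ.2, Pi.smul_apply, smul_eq_mul, ENNReal.toReal_div,
    ENNReal.toReal_natCast]
  rw [div_eq_inv_mul]

lemma dsVal_continuous {U : Set X} (hU : IsClopen U) :
    Continuous fun μ : ProbabilityMeasure X => (μ : Measure X).real U := by
  rw [continuous_iff_continuousAt]
  intro μ
  have := ProbabilityMeasure.tendsto_measure_of_null_frontier_of_tendsto' (μ := μ) (μs := id)
    (L := nhds μ) Filter.tendsto_id (E := U) (by simp [hU.frontier_eq])
  exact (ENNReal.tendsto_toReal (measure_ne_top _ _)).comp this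

/-- Predicate: multiple of a clopen value. -/
def IsConeVal (K : Set (ProbabilityMeasure X)) (g : K → ℝ) : Prop :=
  ∃ n : ℕ, 0 < n ∧ ∃ U : Set X, IsClopen U ∧ g = (n : ℝ) • dsVal K U

lemma IsConeVal.common (hdiv : Divisible K) {g g' : K → ℝ} (hg : IsConeVal K g) (hg' : IsConeVal K g') :
    ∃ n : ℕ, 0 < n ∧ ∃ U V : Set X, IsClopen U ∧ IsClopen V ∧ g = (n : ℝ) • dsVal K U ∧
      g' = (n : ℝ) • dsVal K V ∧ (∀ μ, dsVal K U μ ≤ 1 / 3) ∧ ∀ μ, dsVal K V μ ≤ 1 / 3 := by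
  obtain ⟨n, hn, U, hU, rfl⟩ := hg
  obtain ⟨n', hn', U', hU', rfl⟩ := hg'
  obtain ⟨V, hV, -, hV2⟩ := dsVal_div hdiv hU (3 * n') (by omega)
  obtain ⟨V', hV', -, hV2'⟩ := dsVal_div hdiv hU' (3 * n) (by omega)
  have h1 : (n : ℝ) ≠ 0 := by positivity
  have h2 : (n' : ℝ) ≠ 0 := by positivity
  have h1' : (1 : ℝ) ≤ n := by exact_mod_cast hn
  have h2' : (1 : ℝ) ≤ n' := by exact_mod_cast hn'
  refine ⟨3 * n * n', by positivity, V, V', hV, hV', ?_, ?_, ?_, ?_⟩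
  · rw [hV2, smul_smul]; congr 1; push_cast; field_simp
  · rw [hV2', smul_smul]; congr 1; push_cast; field_simp
  · intro μ
    have := dsVal_le_one U μ
    rw [hV2, Pi.smul_apply, smul_eq_mul, inv_mul_le_iff₀ (by positivity)]
    push_cast; linarith
  · intro μ
    have := dsVal_le_one U' μ
    rw [hV2', Pi.smul_apply, smul_eq_mul, inv_mul_le_iff₀ (by positivity)]
    push_cast; linarith

lemma IsConeVal.add (hK : IsDynSimplex K) (hdiv : Divisible K) {g g' : K → ℝ} (hg : IsConeVal K g)
    (hg' : IsConeVal K g') : IsConeVal K (g + g') := by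
  obtain ⟨n, hn, U, V, hU, hV, rfl, rfl, hU3, hV3⟩ := IsConeVal.common hdiv hg hg'
  obtain ⟨W, hW, hWU, hWV⟩ := dsVal_gw hK hV hU.compl (fun μ => by
    rw [dsVal_compl hU]; linarith [hU3 μ, hV3 μ])
  refine ⟨n, hn, U ∪ W, hU.union hW, ?_⟩
  rw [dsVal_union hW (disjoint_compl_right.mono_right hWU), hWV, smul_add]

lemma IsConeVal.sub (hK : IsDynSimplex K) (hdiv : Divisible K) {g g' : K → ℝ} (hg : IsConeVal K g)
    (hg' : IsConeVal K g') (h : ∀ μ, g' μ < g μ) : IsConeVal K (g - g') := by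
  obtain ⟨n, hn, U, V, hU, hV, rfl, rfl, hU3, hV3⟩ := IsConeVal.common hdiv hg hg'
  have hn' : (0 : ℝ) < n := by exact_mod_cast hn
  obtain ⟨W, hW, hWU, hWV⟩ := dsVal_gw hK hV hU (fun μ => by
    have := h μ
    simp only [Pi.smul_apply, smul_eq_mul] at this
    exact lt_of_mul_lt_mul_left this hn'.le)
  refine ⟨n, hn, U \ W, hU.diff hW, ?_⟩
  rw [dsVal_diff hW hWU, hWV, smul_sub]

lemma IsConeVal.div (hdiv : Divisible K) {g : K → ℝ} (hg : IsConeVal K g) (k : ℕ) (hk : 0 < k) :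
    IsConeVal K ((k : ℝ)⁻¹ • g) := by
  obtain ⟨n, hn, U, hU, rfl⟩ := hg
  obtain ⟨V, hV, -, hV2⟩ := dsVal_div hdiv hU k hk
  refine ⟨n, hn, V, hV, ?_⟩
  rw [hV2, smul_comm]

lemma IsConeVal.zero : IsConeVal K (0 : K → ℝ) :=
  ⟨1, one_pos, ∅, isClopen_empty, by rw [dsVal_empty]; simp⟩

lemma IsConeVal.pos (hK : IsDynSimplex K) {g : K → ℝ} (hg : IsConeVal K g) :
    g = 0 ∨ ∃ δ : ℝ, 0 < δ ∧ ∀ μ, δ ≤ g μ := by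
  obtain ⟨n, hn, U, hU, rfl⟩ := hg
  have hn' : (0 : ℝ) < n := by exact_mod_cast hn
  rcases U.eq_empty_or_nonempty with rfl | hne
  · left; rw [dsVal_empty]; simp
  · right
    obtain ⟨μ, hμ, hmin⟩ := hK.2.1.exists_isMinOn hK.1 (dsVal_continuous hU).continuousOn
    refine ⟨n * (μ : Measure X).real U, mul_pos hn' (dsVal_pos hK hU hne ⟨μ, hμ⟩), fun ν => ?_⟩
    exact mul_le_mul_of_nonneg_left (hmin ν.2) hn'.le

lemma IsConeVal.place (hK : IsDynSimplex K) {g : K → ℝ} (hg : IsConeVal K g) {D : Set X} (hD : IsClopen D)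
    (h : ∀ μ, g μ < dsVal K D μ) : ∃ W, IsClopen W ∧ W ⊆ D ∧ dsVal K W = g := by
  obtain ⟨n, hn, U, hU, rfl⟩ := hg
  have : ∀ k ≤ n, ∃ W, IsClopen W ∧ W ⊆ D ∧ dsVal K W = (k : ℝ) • dsVal K U := by
    intro k
    induction k with
    | zero => exact fun _ => ⟨∅, isClopen_empty, empty_subset _, by rw [dsVal_empty]; simp⟩
    | succ k ih =>
      intro hk
      obtain ⟨W, h1, h2, h3⟩ := ih (by omega)
      obtain ⟨V, h4, h5, h6⟩ := dsVal_gw hK hU (hD.diff h1) (fun μ => by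
        rw [dsVal_diff h1 h2, h3]
        have a1 := h μ
        simp only [Pi.smul_apply, smul_eq_mul, Pi.sub_apply] at a1 ⊢
        have a2 : ((k : ℝ) + 1) ≤ n := by exact_mod_cast hk
        have := dsVal_nonneg U μ
        nlinarith)
      refine ⟨W ∪ V, h1.union h4, union_subset h2 (h5.trans sdiff_subset), ?_⟩
      rw [dsVal_union h4 (disjoint_sdiff_right.mono_right h5), h3, h6]
      push_cast
      rw [add_smul, one_smul]
  exact this n le_rfl

lemma dsVal_eq_zero (hK : IsDynSimplex K) {U : Set X} (hU : IsClopen U) (h : dsVal K U = 0) : U = ∅ := by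
  by_contra hne
  obtain ⟨μ, hμ⟩ := hK.1
  exact (dsVal_pos hK hU (nonempty_iff_ne_empty.2 hne) ⟨μ, hμ⟩).ne' (congrFun h _)

lemma exists_label (hK : IsDynSimplex K) (hdiv : Divisible K) {ι : Type*} [Nonempty ι] (s : Finset ι)
    (g : ι → K → ℝ) (hg : ∀ i, IsConeVal K (g i)) :
    ∀ D : Set X, IsClopen D → ∑ i ∈ s, g i = dsVal K D →
    ∃ e : X → ι, (∀ x ∈ D, e x ∈ s) ∧ ∀ i ∈ s, IsClopen (D ∩ e ⁻¹' {i}) ∧ dsVal K (D ∩ e ⁻¹' {i}) = g i := by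
  classical
  induction s using Finset.induction_on with
  | empty =>
    intro D hD h
    have : D = ∅ := dsVal_eq_zero hK hD (by simpa using h.symm)
    subst this
    exact ⟨fun _ => Classical.arbitrary ι, by simp, by simp⟩
  | insert i s hi ih =>
    intro D hD h
    rw [Finset.sum_insert hi] at h
    have hrest : IsConeVal K (∑ j ∈ s, g j) := by
      clear h ih hi
      induction s using Finset.induction_on with
      | empty => simpa using IsConeVal.zero
      | insert j s hj ih => rw [Finset.sum_insert hj]; exact (hg j).add hK hdiv ih
    have hW : ∃ W, IsClopen W ∧ W ⊆ D ∧ dsVal K W = g i := by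
      rcases hrest.pos hK with h0 | ⟨δ, hδ, hδ'⟩
      · exact ⟨D, hD, Subset.rfl, by rw [← h, h0, add_zero]⟩
      · refine (hg i).place hK hD (fun μ => ?_)
        rw [← h, Pi.add_apply]
        linarith [hδ' μ]
    obtain ⟨W, hW, hWD, hWg⟩ := hW
    obtain ⟨e, he1, he2⟩ := ih (D \ W) (hD.diff hW) (by rw [dsVal_diff hW hWD, hWg, ← h]; simp)
    refine ⟨fun x => if x ∈ W then i else e x, ?_, ?_⟩
    · intro x hx
      by_cases hxW : x ∈ W
      · simp [hxW]
      · simp only [hxW, if_false]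
        exact Finset.mem_insert_of_mem (he1 x ⟨hx, hxW⟩)
    · intro j hj
      rcases Finset.mem_insert.1 hj with rfl | hj
      · have : D ∩ (fun x => if x ∈ W then j else e x) ⁻¹' {j} = W := by
          ext x
          simp only [mem_inter_iff, mem_preimage, mem_singleton_iff]
          constructor
          · rintro ⟨h1, h2⟩
            by_contra hxW
            rw [if_neg hxW] at h2
            exact hi (h2 ▸ he1 x ⟨h1, hxW⟩)
          · intro hx
            exact ⟨hWD hx, by simp [hx]⟩
        rw [this]
        exact ⟨hW, hWg⟩
      · have : D ∩ (fun x => if x ∈ W then i else e x) ⁻¹' {j} = (D \ W) ∩ e ⁻¹' {j} := by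
          have hij : i ≠ j := fun h => hi (h ▸ hj)
          ext x
          simp only [mem_inter_iff, mem_preimage, mem_singleton_iff, mem_sdiff]
          by_cases hxW : x ∈ W <;> simp [hxW, hij]
        rw [this]
        exact he2 j hj

lemma dsVal_sum_label {ι : Type*} (s : Finset ι) (e : X → ι) (D : Set X)
    (h1 : ∀ x ∈ D, e x ∈ s) (h2 : ∀ i ∈ s, IsClopen (D ∩ e ⁻¹' {i})) :
    dsVal K D = ∑ i ∈ s, dsVal K (D ∩ e ⁻¹' {i}) := by
  funext μ
  rw [Finset.sum_apply]
  have : D = ⋃ i ∈ s, D ∩ e ⁻¹' {i} := by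
    ext x
    simp only [mem_iUnion, mem_inter_iff, mem_preimage, mem_singleton_iff, exists_prop]
    constructor
    · intro hx; exact ⟨e x, h1 x hx, hx, rfl⟩
    · rintro ⟨i, -, hx, -⟩; exact hx
  conv_lhs => rw [this]
  refine measureReal_biUnion_finset ?_ (fun i hi => (h2 i hi).isOpen.measurableSet)
  intro i _ j _ hij
  refine Set.disjoint_left.2 fun x hx hx' => hij ?_
  exact hx.2.symm.trans hx'.2

def coneK (hK : IsDynSimplex K) (hdiv : Divisible K) : AddSubmonoid (K → ℝ) where
  carrier := {g | IsConeVal K g}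
  zero_mem' := IsConeVal.zero
  add_mem' := fun h h' => IsConeVal.add hK hdiv h h'

lemma coneK_val (hK : IsDynSimplex K) (hdiv : Divisible K) {U : Set X} (hU : IsClopen U) :
    dsVal K U ∈ coneK hK hdiv := ⟨1, one_pos, U, hU, by simp⟩

lemma coneK_good (hK : IsDynSimplex K) (hdiv : Divisible K) : GoodCone (coneK hK hdiv) where
  div := fun g hg n hn => IsConeVal.div hdiv hg n hn
  sub := fun g hg g' hg' h => IsConeVal.sub hK hdiv hg hg' h
  pos := fun g hg => IsConeVal.pos hK hg
  bdd := by
    rintro g ⟨n, hn, U, hU, rfl⟩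
    refine ⟨n, fun μ => ?_⟩
    have := dsVal_le_one U μ
    simp only [Pi.smul_apply, smul_eq_mul]
    nlinarith [(Nat.cast_nonneg n : (0 : ℝ) ≤ n)]
  riesz := by
    intro I J _ _ a b ha hb hab
    have hsum : ∑ i, a i ∈ coneK hK hdiv := sum_mem fun i _ => ha i
    obtain ⟨n, hn, U, hU, hU2⟩ := hsum
    have hn' : (n : ℝ) ≠ 0 := by positivity
    by_cases hI : Nonempty I
    · by_cases hJ : Nonempty J
      · obtain ⟨e1, h1, h2⟩ := exists_label hK hdiv Finset.univ (fun i => (n : ℝ)⁻¹ • a i)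
          (fun i => IsConeVal.div hdiv (ha i) n hn) U hU (by
            rw [← Finset.smul_sum, hU2, inv_smul_smul₀ hn'])
        obtain ⟨e2, h3, h4⟩ := exists_label hK hdiv Finset.univ (fun i => (n : ℝ)⁻¹ • b i)
          (fun i => IsConeVal.div hdiv (hb i) n hn) U hU (by
            rw [← Finset.smul_sum, ← hab, hU2, inv_smul_smul₀ hn'])
        have hcl : ∀ i j, IsClopen ((U ∩ e1 ⁻¹' {i}) ∩ e2 ⁻¹' {j}) := by
          intro i j
          have := (h2 i (Finset.mem_univ i)).1.inter (h4 j (Finset.mem_univ j)).1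
          convert this using 1
          ext x; simp; tauto
        have hcl' : ∀ i j, IsClopen ((U ∩ e2 ⁻¹' {j}) ∩ e1 ⁻¹' {i}) := by
          intro i j
          convert hcl i j using 1
          ext x; simp; tauto
        refine ⟨fun i j => (n : ℝ) • dsVal K ((U ∩ e1 ⁻¹' {i}) ∩ e2 ⁻¹' {j}), ?_, ?_, ?_⟩
        · intro i j
          exact ⟨n, hn, _, hcl i j, rfl⟩
        · intro i
          rw [← Finset.smul_sum, ← dsVal_sum_label _ e2 _ (fun x hx => Finset.mem_univ _) (fun j _ => hcl i j),
            (h2 i (Finset.mem_univ i)).2, smul_inv_smul₀ hn']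
        · intro j
          have : ∀ i, (U ∩ e1 ⁻¹' {i}) ∩ e2 ⁻¹' {j} = (U ∩ e2 ⁻¹' {j}) ∩ e1 ⁻¹' {i} := by
            intro i; ext x; simp; tauto
          simp only [this]
          rw [← Finset.smul_sum, ← dsVal_sum_label _ e1 _ (fun x hx => Finset.mem_univ _) (fun i _ => hcl' i j),
            (h4 j (Finset.mem_univ j)).2, smul_inv_smul₀ hn']
      · rw [not_nonempty_iff] at hJ
        refine ⟨fun _ j => hJ.elim j, fun _ j => hJ.elim j, fun i => ?_, fun j => hJ.elim j⟩
        simp only [Finset.univ_eq_empty, Finset.sum_empty] at hab ⊢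
        funext μ
        have hz := congrFun hab μ
        rw [Finset.sum_apply, Pi.zero_apply, Finset.sum_eq_zero_iff_of_nonneg] at hz
        · exact (hz i (Finset.mem_univ i)).symm
        · intro i _
          rcases IsConeVal.pos hK (ha i) with h | ⟨δ, h, h'⟩
          · rw [h]; rfl
          · exact h.le.trans (h' μ)
    · rw [not_nonempty_iff] at hI
      refine ⟨fun i => hI.elim i, fun i => hI.elim i, fun i => hI.elim i, fun j => ?_⟩
      simp only [Finset.univ_eq_empty, Finset.sum_empty] at hab ⊢
      funext μ
      have hz := congrFun hab.symm μ
      rw [Finset.sum_apply, Pi.zero_apply, Finset.sum_eq_zero_iff_of_nonneg] at hz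
      · exact (hz j (Finset.mem_univ j)).symm
      · intro i _
        rcases IsConeVal.pos hK (hb i) with h | ⟨δ, h, h'⟩
        · rw [h]; rfl
        · exact h.le.trans (h' μ)

end

set_option linter.unusedSectionVars false

/-- Kakutani–Rokhlin partition with all towers of the same height. -/
structure Stage {X : Type*} [TopologicalSpace X] [MeasurableSpace X] (K : Set (ProbabilityMeasure X)) where
  r : ℕ
  h : ℕ
  col : X → ℕ
  lev : X → ℕ
  hr : 2 ≤ r
  hh : 1 ≤ h
  col_lt : ∀ x, col x < r
  lev_lt : ∀ x, lev x < h
  clopen : ∀ i j, IsClopen {x | col x = i ∧ lev x = j}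
  surj : ∀ i < r, ∀ j < h, ∃ x, col x = i ∧ lev x = j
  meas : ∀ i < r, ∀ j < h, dsVal K {x | col x = i ∧ lev x = j} = dsVal K {x | col x = i ∧ lev x = 0}

/-- `T'` refines `T` by cutting and stacking with a recognizable family of words, and decides `f`. -/
def StepRel {X : Type*} [TopologicalSpace X] [MeasurableSpace X] {K : Set (ProbabilityMeasure X)}
    (T T' : Stage K) (f : X → ℤ) : Prop :=
  ∃ (H : ℕ) (w : ℕ → ℕ → ℕ), 1 ≤ H ∧ T'.h = H * T.h ∧
    (∀ x, T.col x = w (T'.col x) (T'.lev x / T.h)) ∧ (∀ x, T.lev x = T'.lev x % T.h) ∧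
    (∀ k < T'.r, w k 0 = 0) ∧ (∀ k < T'.r, w k (H - 1) = 1) ∧
    (∀ k < T'.r, ∀ i < T.r, ∃ t < H, w k t = i) ∧
    (∀ a < T'.r, ∀ b < T'.r, ∀ d < H, (d ≠ 0 ∨ a ≠ b) →
      ∃ s, d + s < H ∧ w a s = 0 ∧ w b (d + s) ≠ 0) ∧
    ∃ F : ℕ → ℕ → ℤ, (∀ x, f x = F (T'.col x) (T'.lev x)) ∧
      ((∀ μ ∈ K, 0 < ∫ x, (f x : ℝ) ∂(μ : Measure X)) →
        ∀ a < T'.r, 0 ≤ ∑ L ∈ Finset.range T'.h, F a L)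

section
variable {X : Type*} [TopologicalSpace X] [CompactSpace X] [TopologicalSpace.MetrizableSpace X]
    [TotallyDisconnectedSpace X] [MeasurableSpace X] [BorelSpace X]
    {K : Set (ProbabilityMeasure X)}

lemma integral_label {Q : Type*} [Fintype Q] (Φ : X → Q) (hΦ : ∀ q, IsClopen (Φ ⁻¹' {q})) (G : Q → ℝ)
    (μ : Measure X) [IsFiniteMeasure μ] :
    ∫ x, G (Φ x) ∂μ = ∑ q, G q * μ.real (Φ ⁻¹' {q}) := by
  classical
  have : ∀ x, G (Φ x) = ∑ q, (Φ ⁻¹' {q}).indicator (fun _ => G q) x := by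
    intro x
    simp [Set.indicator_apply]
  simp only [this]
  rw [integral_finset_sum]
  · refine Finset.sum_congr rfl fun q _ => ?_
    rw [integral_indicator_const _ (hΦ q).isOpen.measurableSet, smul_eq_mul, mul_comm]
  · intro q _
    exact (integrable_const _).indicator (hΦ q).isOpen.measurableSet

lemma dsVal_sum_filter {Q : Type*} [Fintype Q] (Φ : X → Q) (hΦ : ∀ q, IsClopen (Φ ⁻¹' {q}))
    (p : Q → Prop) [DecidablePred p] :
    ∑ q with p q, dsVal K (Φ ⁻¹' {q}) = dsVal K {x | p (Φ x)} := by
  rw [dsVal_sum_label (K := K) (Finset.univ.filter p) Φ {x | p (Φ x)} (by simp)]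
  · refine Finset.sum_congr rfl fun q hq => ?_
    congr 1
    ext x
    simp only [mem_preimage, mem_singleton_iff, mem_inter_iff, mem_setOf_eq]
    constructor
    · rintro rfl; exact ⟨by simpa using hq, rfl⟩
    · exact fun h => h.2
  · intro q hq
    convert hΦ q using 1
    ext x
    simp only [mem_preimage, mem_singleton_iff, mem_inter_iff, mem_setOf_eq]
    constructor
    · exact fun h => h.2
    · rintro rfl; exact ⟨by simpa using hq, rfl⟩

/-- The algebraic data needed for one refinement step. -/
lemma step_data [Nonempty X] (hK : IsDynSimplex K) (hdiv : Divisible K) (T : Stage K)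
    {Q : Type} [Fintype Q] [DecidableEq Q] (Φ : X → Q) (hΦ : ∀ q, IsClopen (Φ ⁻¹' {q}))
    (hΦs : Function.Surjective Φ)
    (cq lq : Q → ℕ) (fq : Q → ℤ) (hcq : ∀ x, cq (Φ x) = T.col x) (hlq : ∀ x, lq (Φ x) = T.lev x) :
    ∃ (R N H : ℕ) (w : ℕ → ℕ → ℕ) (g : Fin R → K → ℝ) (asg : Fin R → ℕ → ℕ → Q),
      2 ≤ R ∧ 1 ≤ N ∧ 1 ≤ H ∧ (∀ k, IsConeVal K (g k)) ∧ (∀ k, g k ≠ 0) ∧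
      (∀ k < R, w k 0 = 0) ∧ (∀ k < R, w k (H - 1) = 1) ∧
      (∀ k < R, ∀ i < T.r, ∃ t < H, w k t = i) ∧
      (∀ a < R, ∀ b < R, ∀ d < H, (d ≠ 0 ∨ a ≠ b) →
        ∃ s, d + s < H ∧ w a s = 0 ∧ w b (d + s) ≠ 0) ∧
      (∀ k, ∀ t < H, ∀ j < T.h, cq (asg k t j) = w k t ∧ lq (asg k t j) = j) ∧
      (∀ q, ∑ k, (((Finset.range H).filter fun t => asg k t (lq q) = q).card : ℝ) • g k
        = dsVal K (Φ ⁻¹' {q})) ∧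
      ((∀ μ ∈ K, 0 < ∫ x, (fq (Φ x) : ℝ) ∂(μ : Measure X)) →
        ∀ k, 0 ≤ ∑ t ∈ Finset.range H, ∑ j ∈ Finset.range T.h, fq (asg k t j)) := by
  classical
  have hKne : Nonempty K := hK.1.to_subtype
  have hQne : Nonempty Q := ⟨Φ (Classical.arbitrary X)⟩
  have hcq' : ∀ q, cq q < T.r := fun q => by obtain ⟨x, rfl⟩ := hΦs q; rw [hcq]; exact T.col_lt x
  have hlq' : ∀ q, lq q < T.h := fun q => by obtain ⟨x, rfl⟩ := hΦs q; rw [hlq]; exact T.lev_lt x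
  let c : Q → K → ℝ := fun q => dsVal K (Φ ⁻¹' {q})
  have hc : ∀ q, c q ∈ coneK hK hdiv := fun q => coneK_val hK hdiv (hΦ q)
  have hc0 : ∀ q, c q ≠ 0 := fun q h => by
    obtain ⟨x, hx⟩ := hΦs q
    have := dsVal_eq_zero hK (hΦ q) h
    exact (this ▸ (show x ∈ Φ ⁻¹' {q} from hx) : x ∈ (∅ : Set X))
  let rel : ℕ → ℕ → Q → ℤ := fun i j q =>
    (if cq q = i ∧ lq q = j then 1 else 0) - (if cq q = i ∧ lq q = 0 then 1 else 0)
  let pos : Prop := ∀ μ ∈ K, 0 < ∫ x, (fq (Φ x) : ℝ) ∂(μ : Measure X)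
  let l : List (Q → ℤ) := (if pos then [fq] else []) ++ (List.range T.r).flatMap fun i =>
    (List.range T.h).flatMap fun j => [rel i j, -rel i j]
  have hatom : ∀ i j, ∑ q with cq q = i ∧ lq q = j, c q = dsVal K {x | T.col x = i ∧ T.lev x = j} := by
    intro i j
    rw [dsVal_sum_filter Φ hΦ (fun q => cq q = i ∧ lq q = j)]
    simp only [hcq, hlq]
  have hrel : ∀ i < T.r, ∀ j < T.h, ∑ q, (rel i j q : ℝ) • c q = 0 := by
    intro i hi j hj
    have : ∀ q, (rel i j q : ℝ) • c q = (if cq q = i ∧ lq q = j then c q else 0) -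
        (if cq q = i ∧ lq q = 0 then c q else 0) := by
      intro q
      simp only [rel]
      push_cast
      rw [sub_smul, ite_smul, ite_smul, one_smul, zero_smul]
    rw [Finset.sum_congr rfl fun q _ => this q, Finset.sum_sub_distrib, ← Finset.sum_filter,
      ← Finset.sum_filter, hatom, hatom, T.meas i hi j hj, sub_self]
  have hpos : pos → ∑ q, (fq q : ℝ) • c q ∈ coneK hK hdiv := by
    intro hp
    have e : ∑ q, (fq q : ℝ) • c q = ∑ q, (fq q).toNat • c q - ∑ q, (-fq q).toNat • c q := by
      rw [← Finset.sum_sub_distrib]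
      refine Finset.sum_congr rfl fun q _ => ?_
      rw [← Nat.cast_smul_eq_nsmul ℝ, ← Nat.cast_smul_eq_nsmul ℝ, ← sub_smul]
      congr 1
      have := Int.toNat_sub_toNat_neg (fq q)
      exact_mod_cast this.symm
    rw [e]
    refine (coneK_good hK hdiv).sub _ (sum_mem fun q _ => AddSubmonoid.nsmul_mem _ (hc q) _) _
      (sum_mem fun q _ => AddSubmonoid.nsmul_mem _ (hc q) _) (fun μ => ?_)
    rw [← sub_pos, ← Pi.sub_apply, ← e, Finset.sum_apply]
    have := hp μ.1 μ.2
    rw [integral_label Φ hΦ (fun q => (fq q : ℝ))] at this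
    exact this
  obtain ⟨R, D, g, m, hR, hg, hg0, hm, hcm, hmD, hl⟩ := shen_final (coneK_good hK hdiv) c hc hc0 l (by
    intro f hf
    simp only [l, List.mem_append, List.mem_flatMap, List.mem_range, List.mem_cons, List.not_mem_nil,
      or_false] at hf
    rcases hf with hf | ⟨i, hi, j, hj, rfl | rfl⟩
    · split_ifs at hf with hp
      · simp only [List.mem_cons, List.not_mem_nil, or_false] at hf
        subst hf; exact hpos hp
      · simp at hf
    · rw [hrel i hi j hj]; exact zero_mem _
    · simp only [Pi.neg_apply, Int.cast_neg, neg_smul, Finset.sum_neg_distrib]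
      rw [hrel i hi j hj, neg_zero]; exact zero_mem _)
  let M : ℕ → ℕ → ℕ := fun k i => if hk : k < R then ∑ q with cq q = i ∧ lq q = 0, m q ⟨k, hk⟩ else 0
  have hMk : ∀ k : Fin R, ∀ i, M k i = ∑ q with cq q = i ∧ lq q = 0, m q k := fun k i => by
    simp [M]
  have hMj : ∀ k : Fin R, ∀ i < T.r, ∀ j < T.h, ∑ q with cq q = i ∧ lq q = j, m q k = M k i := by
    intro k i hi j hj
    rw [hMk]
    have e : ∑ q, rel i j q * (m q k : ℤ) = ((∑ q with cq q = i ∧ lq q = j, m q k : ℕ) : ℤ)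
        - ((∑ q with cq q = i ∧ lq q = 0, m q k : ℕ) : ℤ) := by
      push_cast
      rw [Finset.sum_filter, Finset.sum_filter, ← Finset.sum_sub_distrib]
      refine Finset.sum_congr rfl fun q _ => ?_
      simp only [rel, sub_mul, ite_mul, one_mul, zero_mul]
    have h1 := hl (rel i j) (by
      simp only [l, List.mem_append, List.mem_flatMap, List.mem_range, List.mem_cons, List.not_mem_nil,
      or_false]
      exact Or.inr ⟨i, hi, j, hj, Or.inl rfl⟩) k
    have h2 := hl (-rel i j) (by
      simp only [l, List.mem_append, List.mem_flatMap, List.mem_range, List.mem_cons, List.not_mem_nil,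
      or_false]
      exact Or.inr ⟨i, hi, j, hj, Or.inr rfl⟩) k
    simp only [Pi.neg_apply, neg_mul, Finset.sum_neg_distrib] at h2
    omega
  have hM2 : ∀ k < R, ∀ i < T.r, 2 ≤ M k i := by
    intro k hk i hi
    rw [hMk ⟨k, hk⟩]
    obtain ⟨x, hx1, hx2⟩ := T.surj i hi 0 (by have := T.hh; omega)
    refine (hm (Φ x) ⟨k, hk⟩).trans (Finset.single_le_sum (f := fun q => m q ⟨k, hk⟩)
      (fun _ _ => Nat.zero_le _) ?_)
    simp [hcq, hlq, hx1, hx2]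
  have hMD : ∀ k < R, ∑ i ∈ Finset.range T.r, M k i = D / T.h := by
    intro k hk
    have : T.h * ∑ i ∈ Finset.range T.r, M k i = D := by
      rw [← hmD ⟨k, hk⟩, ← Finset.sum_fiberwise_of_maps_to (s := Finset.univ)
        (t := Finset.range T.h ×ˢ Finset.range T.r)
        (g := fun q => (lq q, cq q)) (by intro q _; simp [hcq', hlq']), Finset.sum_product]
      have e : ∀ j ∈ Finset.range T.h, (∑ i ∈ Finset.range T.r,
          ∑ q with (lq q, cq q) = (j, i), m q ⟨k, hk⟩) = ∑ i ∈ Finset.range T.r, M k i := by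
        intro j hj
        refine Finset.sum_congr rfl fun i hi => ?_
        rw [← hMj ⟨k, hk⟩ i (Finset.mem_range.1 hi) j (Finset.mem_range.1 hj)]
        refine Finset.sum_congr ?_ fun _ _ => rfl
        ext q; simp [and_comm]
      refine Eq.trans ?_ (Finset.sum_congr rfl e).symm
      simp
    rw [← this, Nat.mul_div_cancel_left _ (by have := T.hh; omega)]
  obtain ⟨N, H, w, hN, hH, hw1, hw2, hw3, hw4, hw5⟩ := exists_words T.r R (D / T.h) T.hr (by omega) M hM2 hMD
  have hasg : ∀ (k : Fin R) (i j : ℕ), ∃ a : ℕ → Q, i < T.r → j < T.h →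
      (∀ t < H, w k t = i → cq (a t) = i ∧ lq (a t) = j) ∧
      ∀ q, cq q = i → lq q = j →
        (((Finset.range H).filter fun t => w k t = i).filter fun t => a t = q).card = N * m q k := by
    intro k i j
    by_cases hi : i < T.r
    · by_cases hj : j < T.h
      · obtain ⟨a, ha1, ha2⟩ := exists_assign (Finset.univ.filter fun q => cq q = i ∧ lq q = j)
          (fun q => N * m q k) ((Finset.range H).filter fun t => w k t = i) (by
            rw [hw2 k k.2 i hi, ← Finset.mul_sum, hMj k i hi j hj])
        refine ⟨a, fun _ _ => ⟨fun t ht hwt => ?_, fun q h1 h2 => ha2 q (by simp [h1, h2])⟩⟩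
        simpa using ha1 t (by simp [ht, hwt])
      · exact ⟨fun _ => Classical.arbitrary Q, fun _ h => absurd h hj⟩
    · exact ⟨fun _ => Classical.arbitrary Q, fun h => absurd h hi⟩
  choose a ha using hasg
  have hN' : (N : ℝ) ≠ 0 := by positivity
  have hasg : ∀ k : Fin R, ∀ t < H, ∀ j < T.h, cq (a k (w k t) j t) = w k t ∧ lq (a k (w k t) j t) = j :=
    fun k t ht j hj => (ha k (w k t) j (hw1 k k.2 t ht) hj).1 t ht rfl
  have hcnt : ∀ q k, ((Finset.range H).filter fun t => a k (w k t) (lq q) t = q).card = N * m q k := by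
    intro q k
    rw [← (ha k (cq q) (lq q) (hcq' q) (hlq' q)).2 q rfl rfl]
    congr 1
    ext t
    simp only [Finset.mem_filter, Finset.mem_range]
    constructor
    · rintro ⟨h1, h2⟩
      have := (hasg k t h1 (lq q) (hlq' q)).1
      rw [h2] at this
      exact ⟨⟨h1, this.symm⟩, by rw [this]; exact h2⟩
    · rintro ⟨⟨h1, h2⟩, h3⟩
      exact ⟨h1, by rw [h2]; exact h3⟩
  refine ⟨R, N, H, w, fun k => (N : ℝ)⁻¹ • g k, fun k t j => a k (w k t) j t, hR, hN, hH,
    fun k => IsConeVal.div hdiv (hg k) N hN, fun k => smul_ne_zero (inv_ne_zero hN') (hg0 k), hw3, hw4, ?_, hw5,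
    hasg, ?_, ?_⟩
  · intro k hk i hi
    have h1 := hw2 k hk i hi
    have h2 := hM2 k hk i hi
    have : 0 < ((Finset.range H).filter fun t => w k t = i).card := by rw [h1]; positivity
    obtain ⟨t, ht⟩ := Finset.card_pos.1 this
    simp only [Finset.mem_filter, Finset.mem_range] at ht
    exact ⟨t, ht⟩
  · intro q
    change _ = c q
    rw [hcm q]
    refine Finset.sum_congr rfl fun k _ => ?_
    rw [hcnt, smul_smul]
    congr 1
    push_cast
    field_simp
  · intro hp k
    have h1 := hl fq (by simp only [l, if_pos (show pos from hp)]; simp) k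
    have e : ∑ t ∈ Finset.range H, ∑ j ∈ Finset.range T.h, fq (a k (w k t) j t)
        = N * ∑ q, fq q * (m q k : ℤ) := by
      rw [← Finset.sum_product', ← Finset.sum_fiberwise_of_maps_to (t := Finset.univ)
        (g := fun p : ℕ × ℕ => a k (w k p.1) p.2 p.1) (by simp), Finset.mul_sum]
      refine Finset.sum_congr rfl fun q _ => ?_
      rw [Finset.sum_congr rfl (g := fun _ => fq q) (by
        intro p hp; simp only [Finset.mem_filter] at hp; rw [hp.2])]
      rw [Finset.sum_const, nsmul_eq_mul]
      have : ((Finset.range H ×ˢ Finset.range T.h).filter fun p : ℕ × ℕ => a k (w k p.1) p.2 p.1 = q).card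
          = N * m q k := by
        rw [← hcnt q k]
        refine Finset.card_bij (fun p _ => p.1) ?_ ?_ ?_
        · rintro ⟨t, j⟩ hp
          simp only [Finset.mem_filter, Finset.mem_product, Finset.mem_range] at hp ⊢
          have := (hasg k t hp.1.1 j hp.1.2).2
          rw [hp.2] at this
          exact ⟨hp.1.1, by rw [this]; exact hp.2⟩
        · rintro ⟨t, j⟩ hp ⟨t', j'⟩ hp' h
          simp only [Finset.mem_filter, Finset.mem_product, Finset.mem_range] at hp hp' h
          have h1 := (hasg k t hp.1.1 j hp.1.2).2
          have h2 := (hasg k t' hp'.1.1 j' hp'.1.2).2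
          rw [hp.2] at h1
          rw [hp'.2] at h2
          rw [h, ← h1, ← h2]
        · intro t ht
          simp only [Finset.mem_filter, Finset.mem_range] at ht
          exact ⟨(t, lq q), by simp [ht, hlq'], rfl⟩
      rw [this]
      push_cast
      ring
    rw [e]
    positivity

lemma exists_step [Nonempty X] (hK : IsDynSimplex K) (hdiv : Divisible K) (T : Stage K) (f : X → ℤ)
    (hf : Continuous f) : ∃ T' : Stage K, StepRel T T' f := by
  classical
  let Φ0 : X → ℕ × ℕ × ℤ := fun x => (T.col x, T.lev x, f x)
  have hfin : (range Φ0).Finite := by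
    have h1 : (range f).Finite := by
      have := isCompact_range hf
      exact isCompact_iff_finite.1 this
    refine ((Set.finite_Iio T.r).prod ((Set.finite_Iio T.h).prod h1)).subset ?_
    rintro _ ⟨x, rfl⟩
    exact ⟨T.col_lt x, T.lev_lt x, mem_range_self x⟩
  let Q := range Φ0
  have : Finite Q := hfin
  let _ : Fintype Q := Fintype.ofFinite Q
  let Φ : X → Q := fun x => ⟨Φ0 x, mem_range_self x⟩
  have hΦs : Function.Surjective Φ := by rintro ⟨_, x, rfl⟩; exact ⟨x, rfl⟩
  have hΦ : ∀ q, IsClopen (Φ ⁻¹' {q}) := by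
    intro q
    have := (T.clopen q.1.1 q.1.2.1).inter ((isClopen_discrete {q.1.2.2}).preimage hf)
    convert this using 1
    ext x
    simp only [mem_preimage, mem_singleton_iff, mem_inter_iff, mem_setOf_eq, Φ, Φ0, Subtype.ext_iff,
      Prod.ext_iff]
    tauto
  obtain ⟨R, N, H, w, g, asg, hR, hN, hH, hg, hg0, hw3, hw4, hw6, hw5, ha1, ha2, ha3⟩ :=
    step_data hK hdiv T Φ hΦ hΦs (fun q => q.1.1) (fun q => q.1.2.1) (fun q => q.1.2.2)
      (fun x => rfl) (fun x => rfl)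
  have hRne : Nonempty (Fin R) := ⟨⟨0, by omega⟩⟩
  have hT : 0 < T.h := T.hh
  have hlab : ∀ q : Q, ∃ e : X → Fin R × ℕ, (∀ x ∈ Φ ⁻¹' {q}, (e x).2 < H ∧ asg (e x).1 (e x).2 q.1.2.1 = q) ∧
      ∀ k t, t < H → asg k t q.1.2.1 = q → IsClopen (Φ ⁻¹' {q} ∩ e ⁻¹' {(k, t)}) ∧
        dsVal K (Φ ⁻¹' {q} ∩ e ⁻¹' {(k, t)}) = g k := by
    intro q
    obtain ⟨e, he1, he2⟩ := exists_label hK hdiv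
      ((Finset.univ ×ˢ Finset.range H).filter fun p : Fin R × ℕ => asg p.1 p.2 q.1.2.1 = q)
      (fun p => g p.1) (fun p => hg p.1) (Φ ⁻¹' {q}) (hΦ q) (by
        rw [← ha2 q, Finset.sum_filter, Finset.sum_product]
        refine Finset.sum_congr rfl fun k _ => ?_
        rw [← Finset.sum_filter]
        change ∑ a ∈ (Finset.range H).filter (fun t => asg k t q.1.2.1 = q), g k = _
        rw [Finset.sum_const, Nat.cast_smul_eq_nsmul])
    refine ⟨e, fun x hx => by simpa using he1 x hx, fun k t ht h => he2 (k, t) (by simp [ht, h])⟩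
  choose e he1 he2 using hlab
  let E : X → Fin R × ℕ := fun x => e (Φ x) x
  have hE : ∀ x, (E x).2 < H ∧ asg (E x).1 (E x).2 (T.lev x) = Φ x := fun x => he1 (Φ x) x rfl
  have hdivmod : ∀ x, ((E x).2 * T.h + T.lev x) / T.h = (E x).2 ∧ ((E x).2 * T.h + T.lev x) % T.h = T.lev x := by
    intro x
    have := T.lev_lt x
    constructor
    · rw [Nat.mul_comm, Nat.mul_add_div hT, Nat.div_eq_of_lt this, add_zero]
    · rw [Nat.mul_comm, Nat.mul_add_mod, Nat.mod_eq_of_lt this]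
  have hLdiv : ∀ L, L < H * T.h → L / T.h < H := fun L hL => Nat.div_lt_of_lt_mul (by rwa [Nat.mul_comm])
  have hatom : ∀ (k : Fin R) L, L < H * T.h →
      {x | ((E x).1 : ℕ) = k ∧ (E x).2 * T.h + T.lev x = L} =
        Φ ⁻¹' {asg k (L / T.h) (L % T.h)} ∩ e (asg k (L / T.h) (L % T.h)) ⁻¹' {(k, L / T.h)} := by
    intro k L hL
    ext x
    simp only [mem_setOf_eq, mem_inter_iff, mem_preimage, mem_singleton_iff]
    constructor
    · rintro ⟨h1, rfl⟩
      rw [(hdivmod x).1, (hdivmod x).2]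
      have hk : (E x).1 = k := Fin.ext h1
      have h2 := (hE x).2
      rw [hk] at h2
      rw [h2]
      exact ⟨rfl, Prod.ext hk rfl⟩
    · rintro ⟨h1, h2⟩
      rw [← h1] at h2
      have h3 : E x = (k, L / T.h) := h2
      have h4 : T.lev x = L % T.h := by
        have := (ha1 k (L / T.h) (hLdiv L hL) (L % T.h) (Nat.mod_lt _ hT)).2
        rw [← h1] at this
        exact this
      rw [h3, h4]
      exact ⟨rfl, Nat.div_add_mod' L T.h⟩
  have hprop : ∀ (k : Fin R) L, L < H * T.h →
      IsClopen {x | ((E x).1 : ℕ) = k ∧ (E x).2 * T.h + T.lev x = L} ∧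
      dsVal K {x | ((E x).1 : ℕ) = k ∧ (E x).2 * T.h + T.lev x = L} = g k := by
    intro k L hL
    rw [hatom k L hL]
    have := (ha1 k (L / T.h) (hLdiv L hL) (L % T.h) (Nat.mod_lt _ hT)).2
    exact he2 _ k (L / T.h) (hLdiv L hL) (by rw [this])
  have hlt : ∀ x, (E x).2 * T.h + T.lev x < H * T.h := by
    intro x
    calc (E x).2 * T.h + T.lev x < ((E x).2 + 1) * T.h := by
          rw [Nat.succ_mul]; have := T.lev_lt x; omega
      _ ≤ H * T.h := Nat.mul_le_mul_right _ (hE x).1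
  have hHT : 0 < H * T.h := Nat.mul_pos hH hT
  let T' : Stage K :=
    { r := R
      h := H * T.h
      col := fun x => (E x).1
      lev := fun x => (E x).2 * T.h + T.lev x
      hr := hR
      hh := hHT
      col_lt := fun x => (E x).1.2
      lev_lt := hlt
      clopen := by
        intro i j
        by_cases hi : i < R
        · by_cases hj : j < H * T.h
          · exact (hprop ⟨i, hi⟩ j hj).1
          · convert isClopen_empty (X := X)
            ext x
            simp only [mem_setOf_eq, mem_empty_iff_false, iff_false]
            rintro ⟨-, h⟩
            have := hlt x
            omega
        · convert isClopen_empty (X := X)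
          ext x
          simp only [mem_setOf_eq, mem_empty_iff_false, iff_false]
          rintro ⟨h, -⟩
          have := (E x).1.2
          omega
      surj := by
        intro i hi j hj
        by_contra hne
        have h1 := (hprop ⟨i, hi⟩ j hj).2
        have h2 : {x | ((E x).1 : ℕ) = i ∧ (E x).2 * T.h + T.lev x = j} = ∅ := by
          rw [eq_empty_iff_forall_notMem]
          exact fun x hx => hne ⟨x, hx⟩
        simp only [] at h1
        rw [h2, dsVal_empty] at h1
        exact hg0 _ h1.symm
      meas := by
        intro i hi j hj
        rw [(hprop ⟨i, hi⟩ j hj).2, (hprop ⟨i, hi⟩ 0 hHT).2] }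
  refine ⟨T', H, w, hH, rfl, ?_, ?_, hw3, hw4, hw6, hw5, ?_⟩
  · intro x
    change T.col x = w (E x).1 (((E x).2 * T.h + T.lev x) / T.h)
    rw [(hdivmod x).1]
    have := (ha1 (E x).1 (E x).2 (hE x).1 (T.lev x) (T.lev_lt x)).1
    rw [(hE x).2] at this
    exact this
  · intro x
    exact (hdivmod x).2.symm
  · refine ⟨fun k L => if hk : k < R then (asg ⟨k, hk⟩ (L / T.h) (L % T.h)).1.2.2 else 0, ?_, ?_⟩
    · intro x
      change f x = if hk : ((E x).1 : ℕ) < R then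
        (asg ⟨(E x).1, hk⟩ (((E x).2 * T.h + T.lev x) / T.h) (((E x).2 * T.h + T.lev x) % T.h)).1.2.2 else 0
      rw [dif_pos (E x).1.2, (hdivmod x).1, (hdivmod x).2, (hE x).2]
    · intro hp k hk
      have h1 := ha3 hp ⟨k, hk⟩
      change 0 ≤ ∑ L ∈ Finset.range (H * T.h), _
      rw [sum_range_mul_block]
      convert h1 using 1
      refine Finset.sum_congr rfl fun t _ => Finset.sum_congr rfl fun j hj => ?_
      have hj := Finset.mem_range.1 hj
      have hk' : k < R := hk
      beta_reduce
      rw [dif_pos hk', Nat.mul_comm t, Nat.mul_add_div hT, Nat.div_eq_of_lt hj, add_zero, Nat.mul_add_mod,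
        Nat.mod_eq_of_lt hj]

end

set_option linter.unusedSectionVars false

section
variable {X : Type*} [TopologicalSpace X] [CompactSpace X] [TopologicalSpace.MetrizableSpace X]
    [TotallyDisconnectedSpace X] [MeasurableSpace X] [BorelSpace X]
    {K : Set (ProbabilityMeasure X)}

/-- The atom label of a point at a stage. -/
def Stage.at (T : Stage K) (x : X) : ℕ × ℕ := (T.col x, T.lev x)

lemma Stage.at_eq (T : Stage K) {x y : X} : T.at x = T.at y ↔ T.col x = T.col y ∧ T.lev x = T.lev y := by
  simp [Stage.at, Prod.ext_iff]

lemma Stage.at_cont (T : Stage K) : Continuous T.at := by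
  rw [continuous_discrete_rng]
  rintro ⟨i, j⟩
  convert (T.clopen i j).isOpen using 1
  ext x
  simp [Stage.at]

lemma Stage.clopen_at (T : Stage K) (S : Set (ℕ × ℕ)) : IsClopen (T.at ⁻¹' S) :=
  ⟨(isClosed_discrete S).preimage T.at_cont, (isOpen_discrete S).preimage T.at_cont⟩

/-- Partial transition relation on labels. -/
def SRel (T : Stage K) (x y : X) : Prop :=
  (T.lev x + 1 < T.h ∧ T.col y = T.col x ∧ T.lev y = T.lev x + 1) ∨ (T.lev x + 1 = T.h ∧ T.lev y = 0)

lemma SRel.congr {T : Stage K} {x x' y y' : X} (hx : T.at x = T.at x') (hy : T.at y = T.at y')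
    (h : SRel T x y) : SRel T x' y' := by
  rw [Stage.at_eq] at hx hy
  unfold SRel at *
  rw [← hx.1, ← hx.2, ← hy.1, ← hy.2]
  exact h

lemma StepRel.at_eq {T T' : Stage K} {f : X → ℤ} (h : StepRel T T' f) {x y : X} (hxy : T'.at x = T'.at y) :
    T.at x = T.at y := by
  obtain ⟨H, w, -, -, h1, h2, -⟩ := h
  rw [Stage.at_eq] at *
  rw [h1, h2, h1 y, h2 y, hxy.1, hxy.2]
  exact ⟨rfl, rfl⟩

lemma mod_succ_aux (L h : ℕ) (hh : 1 ≤ h) :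
    (L % h + 1 < h ∧ (L + 1) / h = L / h ∧ (L + 1) % h = L % h + 1) ∨ (L % h + 1 = h ∧ (L + 1) % h = 0) := by
  have h1 : L % h < h := Nat.mod_lt _ hh
  have h2 := Nat.div_add_mod L h
  rcases Nat.lt_or_ge (L % h + 1) h with h3 | h3
  · left
    have : L + 1 = h * (L / h) + (L % h + 1) := by omega
    refine ⟨h3, ?_, ?_⟩
    · rw [this, Nat.mul_add_div hh, Nat.div_eq_of_lt h3, add_zero]
    · rw [this, Nat.mul_add_mod, Nat.mod_eq_of_lt h3]
  · right
    have h4 : L % h + 1 = h := by omega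
    have : L + 1 = h * (L / h + 1) := by rw [mul_add]; omega
    exact ⟨h4, by rw [this, Nat.mul_mod_right]⟩

lemma top_aux (L H h : ℕ) (hH : 1 ≤ H) (hh : 1 ≤ h) (hL : L + 1 = H * h) :
    L % h + 1 = h ∧ L / h = H - 1 := by
  obtain ⟨H, rfl⟩ : ∃ H', H = H' + 1 := ⟨H - 1, by omega⟩
  have : L = h * H + (h - 1) := by
    have : (H + 1) * h = h * H + h := by ring
    omega
  rw [this, Nat.mul_add_mod, Nat.mod_eq_of_lt (by omega), Nat.mul_add_div hh, Nat.div_eq_of_lt (by omega)]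
  omega

lemma StepRel.srel {T T' : Stage K} {f : X → ℤ} (h : StepRel T T' f) {x y : X} (hxy : SRel T' x y) :
    SRel T x y := by
  obtain ⟨H, w, hH, hh, h1, h2, -⟩ := h
  rcases hxy with ⟨a1, a2, a3⟩ | ⟨a1, a2⟩
  · unfold SRel
    rw [h1 x, h1 y, h2 x, h2 y, a2, a3]
    rcases mod_succ_aux (T'.lev x) T.h T.hh with ⟨b1, b2, b3⟩ | ⟨b1, b2⟩
    · left; exact ⟨b1, by rw [b2], b3⟩
    · right; exact ⟨b1, b2⟩
  · right
    rw [h2, h2 y, a2]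
    exact ⟨(top_aux _ _ _ hH T.hh (a1.trans hh)).1, Nat.zero_mod _⟩

lemma StepRel.fwd {T T' : Stage K} {f : X → ℤ} (h : StepRel T T' f) {x y z : X} (hxy : SRel T' x y)
    (hxz : SRel T' x z) : T.at y = T.at z := by
  rcases hxy with ⟨a1, a2, a3⟩ | ⟨a1, a2⟩
  · rcases hxz with ⟨b1, b2, b3⟩ | ⟨b1, b2⟩
    · exact h.at_eq (T'.at_eq.2 ⟨a2.trans b2.symm, a3.trans b3.symm⟩)
    · omega
  · rcases hxz with ⟨b1, b2, b3⟩ | ⟨b1, b2⟩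
    · omega
    · obtain ⟨H, w, hH, hh, h1, h2, h3, -⟩ := h
      rw [Stage.at_eq, h1 y, h1 z, h2 y, h2 z, a2, b2, Nat.zero_div, h3 _ (T'.col_lt y), h3 _ (T'.col_lt z)]
      exact ⟨rfl, rfl⟩

lemma StepRel.bwd {T T' : Stage K} {f : X → ℤ} (h : StepRel T T' f) {x y z : X} (hxz : SRel T' x z)
    (hyz : SRel T' y z) : T.at x = T.at y := by
  rcases hxz with ⟨a1, a2, a3⟩ | ⟨a1, a2⟩
  · rcases hyz with ⟨b1, b2, b3⟩ | ⟨b1, b2⟩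
    · exact h.at_eq (T'.at_eq.2 ⟨a2.symm.trans b2, by omega⟩)
    · omega
  · rcases hyz with ⟨b1, b2, b3⟩ | ⟨b1, b2⟩
    · omega
    · obtain ⟨H, w, hH, hh, h1, h2, -, h3, -⟩ := h
      have t1 := top_aux _ _ _ hH T.hh (a1.trans hh)
      have t2 := top_aux _ _ _ hH T.hh (b1.trans hh)
      rw [Stage.at_eq, h1 x, h1 y, h2 x, h2 y, t1.2, t2.2, h3 _ (T'.col_lt x), h3 _ (T'.col_lt y)]
      exact ⟨rfl, by omega⟩

lemma SRel.exists_right (T : Stage K) (x : X) : ∃ y, SRel T x y := by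
  have h1 := T.lev_lt x
  rcases Nat.lt_or_ge (T.lev x + 1) T.h with h | h
  · obtain ⟨y, hy⟩ := T.surj (T.col x) (T.col_lt x) _ h
    exact ⟨y, Or.inl ⟨h, hy⟩⟩
  · obtain ⟨y, hy⟩ := T.surj (T.col x) (T.col_lt x) 0 (by omega)
    exact ⟨y, Or.inr ⟨by omega, hy.2⟩⟩

lemma SRel.exists_left (T : Stage K) (y : X) : ∃ x, SRel T x y := by
  have h1 := T.lev_lt y
  rcases Nat.eq_zero_or_pos (T.lev y) with h | h
  · obtain ⟨x, hx⟩ := T.surj (T.col y) (T.col_lt y) (T.h - 1) (by omega)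
    exact ⟨x, Or.inr ⟨by omega, h⟩⟩
  · obtain ⟨x, hx⟩ := T.surj (T.col y) (T.col_lt y) (T.lev y - 1) (by omega)
    exact ⟨x, Or.inl ⟨by omega, hx.1.symm, by omega⟩⟩

lemma SRel.closed_right (T : Stage K) (x : X) : IsClosed {y | SRel T x y} := by
  convert (T.clopen_at {p | (T.lev x + 1 < T.h ∧ p.1 = T.col x ∧ p.2 = T.lev x + 1) ∨
    (T.lev x + 1 = T.h ∧ p.2 = 0)}).isClosed using 1
  rfl

lemma SRel.closed_left (T : Stage K) (y : X) : IsClosed {x | SRel T x y} := by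
  convert (T.clopen_at {p | (p.2 + 1 < T.h ∧ T.col y = p.1 ∧ T.lev y = p.2 + 1) ∨
    (p.2 + 1 = T.h ∧ T.lev y = 0)}).isClosed using 1
  rfl

lemma exists_all_of_closed (P : ℕ → X → Prop) (h1 : ∀ n x, P (n + 1) x → P n x) (h2 : ∀ n, ∃ x, P n x)
    (h3 : ∀ n, IsClosed {x | P n x}) : ∃ x, ∀ n, P n x := by
  obtain ⟨x, hx⟩ := IsCompact.nonempty_iInter_of_sequence_nonempty_isCompact_isClosed
    (fun n => {x | P n x}) (fun n x hx => h1 n x hx) (fun n => h2 n) (h3 0).isCompact h3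
  exact ⟨x, fun n => mem_iInter.1 hx n⟩

lemma exists_homeo (T : ℕ → Stage K) (f : ℕ → X → ℤ) (hT : ∀ n, StepRel (T n) (T (n + 1)) (f n))
    (hdec : ∀ U : Set X, IsClopen U → ∃ n, ∃ S : Set (ℕ × ℕ), U = (T n).at ⁻¹' S) :
    ∃ φ : X ≃ₜ X, ∀ n x, SRel (T n) x (φ x) := by
  have hsep : ∀ x y, (∀ n, (T n).at x = (T n).at y) → x = y := by
    intro x y h
    by_contra hne
    obtain ⟨U, hU, hxU, hyU⟩ := exists_isClopen_of_totally_separated hne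
    obtain ⟨n, S, rfl⟩ := hdec U hU
    exact hyU (by rw [mem_preimage, ← h n]; exact hxU)
  have hR : ∀ x, ∃ y, ∀ n, SRel (T n) x y := fun x =>
    exists_all_of_closed (fun n y => SRel (T n) x y) (fun n y h => (hT n).srel h)
      (fun n => SRel.exists_right _ _) (fun n => SRel.closed_right _ _)
  have hL : ∀ y, ∃ x, ∀ n, SRel (T n) x y := fun y =>
    exists_all_of_closed (fun n x => SRel (T n) x y) (fun n x h => (hT n).srel h)
      (fun n => SRel.exists_left _ _) (fun n => SRel.closed_left _ _)
  choose φ hφ using hR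
  have hinj : Function.Injective φ := by
    intro x y hxy
    refine hsep _ _ fun n => (hT n).bwd (hφ x (n + 1)) ?_
    rw [hxy]; exact hφ y (n + 1)
  have hsurj : Function.Surjective φ := by
    intro y
    obtain ⟨x, hx⟩ := hL y
    exact ⟨x, hsep _ _ fun n => (hT n).fwd (hφ x (n + 1)) (hx (n + 1))⟩
  have hcont : Continuous φ := by
    refine isTopologicalBasis_isClopen.continuous_iff.2 fun U hU => ?_
    obtain ⟨n, S, rfl⟩ := hdec U hU
    rw [isOpen_iff_forall_mem_open]
    intro x hx
    refine ⟨(T (n + 1)).at ⁻¹' {(T (n + 1)).at x}, fun y hy => ?_, ((T (n + 1)).clopen_at _).isOpen, rfl⟩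
    have : (T n).at (φ y) = (T n).at (φ x) :=
      (hT n).fwd (SRel.congr hy rfl (hφ y (n + 1))) (hφ x (n + 1))
    rw [mem_preimage, mem_preimage, this]
    exact hx
  exact ⟨Continuous.homeoOfEquivCompactToT2 (f := Equiv.ofBijective φ ⟨hinj, hsurj⟩) hcont, fun n x => hφ x n⟩

/-- moving up inside a tower -/
lemma srel_up {T : Stage K} {σ : Equiv.Perm X} (h : ∀ x, SRel T x (σ x)) (x : X) (e : ℕ)
    (he : T.lev x + e < T.h) : T.col ((σ ^ e) x) = T.col x ∧ T.lev ((σ ^ e) x) = T.lev x + e := by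
  induction e with
  | zero => simp
  | succ e ih =>
    obtain ⟨i1, i2⟩ := ih (by omega)
    rw [pow_succ', Equiv.Perm.mul_apply]
    rcases h ((σ ^ e) x) with ⟨a1, a2, a3⟩ | ⟨a1, a2⟩
    · exact ⟨a2.trans i1, by omega⟩
    · omega

/-- every point lies above a base point of its tower -/
lemma srel_down {T : Stage K} {σ : Equiv.Perm X} (h : ∀ x, SRel T x (σ x)) (x : X) :
    ∃ z, T.col z = T.col x ∧ T.lev z = 0 ∧ (σ ^ (T.lev x)) z = x := by
  generalize hL : T.lev x = L
  induction L generalizing x with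
  | zero => exact ⟨x, rfl, hL, by simp⟩
  | succ L ih =>
    obtain ⟨y, rfl⟩ := σ.surjective x
    rcases h y with ⟨a1, a2, a3⟩ | ⟨a1, a2⟩
    · obtain ⟨z, z1, z2, z3⟩ := ih y (by omega)
      exact ⟨z, z1.trans a2.symm, z2, by rw [pow_succ', Equiv.Perm.mul_apply, z3]⟩
    · omega

lemma stage_atom_decomp {T T' : Stage K} {f : X → ℤ} (hT : StepRel T T' f) {σ : Equiv.Perm X}
    (h : ∀ x, SRel T' x (σ x)) (x : X) (i j : ℕ) (hi : i < T.r) (hj : j < T.h) :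
    ∃ k : ℤ, T.col ((σ ^ k) x) = i ∧ T.lev ((σ ^ k) x) = j := by
  obtain ⟨H, w, hH, hh, h1, h2, -, -, h3, -⟩ := hT
  obtain ⟨z, z1, z2, z3⟩ := srel_down h x
  obtain ⟨t, ht, hw⟩ := h3 _ (T'.col_lt x) i hi
  have hlt : t * T.h + j < T'.h := by
    rw [hh]
    calc t * T.h + j < t * T.h + T.h := by omega
      _ = (t + 1) * T.h := by ring
      _ ≤ H * T.h := Nat.mul_le_mul_right _ ht
  obtain ⟨u1, u2⟩ := srel_up h z (t * T.h + j) (by omega)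
  refine ⟨((t * T.h + j : ℕ) : ℤ) - (T'.lev x : ℤ), ?_⟩
  have e : (σ ^ (((t * T.h + j : ℕ) : ℤ) - (T'.lev x : ℤ))) x = (σ ^ (t * T.h + j)) z := by
    have e' : ∀ L : ℕ, (σ ^ L) z = x → (σ ^ (((t * T.h + j : ℕ) : ℤ) - (L : ℤ))) x = (σ ^ (t * T.h + j)) z := by
      rintro L rfl
      rw [← zpow_natCast σ L, ← Equiv.Perm.mul_apply, ← zpow_add, sub_add_cancel, zpow_natCast]
    exact e' _ z3
  have hTh : 0 < T.h := T.hh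
  rw [e, h1, h2, u1, u2, z1, z2, zero_add, Nat.mul_comm t, Nat.mul_add_div hTh, Nat.div_eq_of_lt hj, add_zero, hw,
    Nat.mul_add_mod, Nat.mod_eq_of_lt hj]
  exact ⟨rfl, rfl⟩

lemma homeo_minimal (T : ℕ → Stage K) (f : ℕ → X → ℤ) (hT : ∀ n, StepRel (T n) (T (n + 1)) (f n))
    (hdec : ∀ U : Set X, IsClopen U → ∃ n, ∃ S : Set (ℕ × ℕ), U = (T n).at ⁻¹' S)
    (φ : X ≃ₜ X) (hφ : ∀ n x, SRel (T n) x (φ x)) : IsMinimalHomeo φ := by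
  intro x
  refine isTopologicalBasis_isClopen.dense_iff.2 ?_
  rintro U hU ⟨y, hy⟩
  obtain ⟨n, S, rfl⟩ := hdec U hU
  obtain ⟨k, k1, k2⟩ := stage_atom_decomp (hT n) (σ := φ.toEquiv) (hφ (n + 1)) x _ _ ((T n).col_lt y)
    ((T n).lev_lt y)
  refine ⟨_, ?_, k, rfl⟩
  have : (T n).at ((φ.toEquiv ^ k) x) = (T n).at y := (T n).at_eq.2 ⟨k1, k2⟩
  rw [mem_preimage, this]
  exact hy

/-- one step of the itinerary argument -/
lemma itin_step {T T' : Stage K} {f : X → ℤ} (hT : StepRel T T' f) {σ : Equiv.Perm X}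
    (h : ∀ x, SRel T' x (σ x)) (bad : X → X → Prop) (hbad : ∀ x y, bad x y → ∀ k : ℤ, bad ((σ ^ k) x) ((σ ^ k) y))
    (hJ : ∀ x y, bad x y → T.lev x = T.lev y ∧ (T.col x = 0 → T.col y = 0)) (x y : X) (hxy : bad x y) :
    T'.at x = T'.at y := by
  obtain ⟨H, w, hH, hh, h1, h2, -, -, -, h3, -⟩ := hT
  obtain ⟨z, z1, z2, z3⟩ := srel_down h x
  have hTh : 0 < T.h := T.hh
  obtain ⟨y', hy'⟩ := (σ ^ T'.lev x).surjective y
  have hb : bad z y' := by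
    have := hbad x y hxy (-(T'.lev x : ℤ))
    have e : ∀ (L : ℕ) (u v : X), (σ ^ L) u = v → (σ ^ (-(L : ℤ))) v = u := by
      rintro L u v rfl
      simp
    rwa [e _ _ _ z3, e _ _ _ hy'] at this
  have hl : T'.lev y' % T.h = 0 := by
    have := (hJ _ _ hb).1
    rw [h2, z2, Nat.zero_mod, h2] at this
    exact this.symm
  set d := T'.lev y' / T.h with hd
  have hdL : T'.lev y' = T.h * d := by
    have := Nat.div_add_mod (T'.lev y') T.h
    rw [hl, add_zero] at this
    exact this.symm
  have hy'lt := T'.lev_lt y'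
  have hdH : d < H := by
    refine Nat.div_lt_of_lt_mul ?_
    rw [Nat.mul_comm, ← hh]; exact hy'lt
  by_cases hc : d ≠ 0 ∨ T'.col z ≠ T'.col y'
  · exfalso
    obtain ⟨s, s1, s2, s3⟩ := h3 _ (T'.col_lt z) _ (T'.col_lt y') d hdH hc
    have hs : T.h * d + T.h * s < T'.h := by
      rw [hh, ← mul_add, mul_comm]
      exact Nat.mul_lt_mul_of_pos_right s1 hTh
    obtain ⟨u1, u2⟩ := srel_up h z (T.h * s) (by omega)
    obtain ⟨v1, v2⟩ := srel_up h y' (T.h * s) (by omega)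
    have hb' := hbad _ _ hb ((T.h * s : ℕ) : ℤ)
    rw [zpow_natCast] at hb'
    have := (hJ _ _ hb').2
    rw [h1, h1, u1, u2, v1, v2, z2, hdL, zero_add, ← mul_add, Nat.mul_div_cancel_left _ hTh,
      Nat.mul_div_cancel_left _ hTh] at this
    exact s3 (this s2)
  · push Not at hc
    have hy0 : T'.lev y' = 0 := by rw [hdL, hc.1, mul_zero]
    have hx := T'.lev_lt x
    obtain ⟨v1, v2⟩ := srel_up h y' (T'.lev x) (by omega)
    rw [hy'] at v1 v2
    exact T'.at_eq.2 ⟨by rw [v1, ← hc.2, z1], by omega⟩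

lemma itin (T : ℕ → Stage K) (f : ℕ → X → ℤ) (hT : ∀ n, StepRel (T n) (T (n + 1)) (f n))
    (hdec : ∀ U : Set X, IsClopen U → ∃ n, ∃ S : Set (ℕ × ℕ), U = (T n).at ⁻¹' S)
    (σ : Equiv.Perm X) (hφ : ∀ n x, SRel (T n) x (σ x)) (A B : Set X)
    (hA : ∀ x, x ∈ A ↔ (T 0).col x = 0) (hB : ∀ x, x ∈ B ↔ (T 0).col x ≠ 0) (h0 : ∀ x, (T 0).lev x = 0)
    (x y : X) (hne : x ≠ y) : ∃ k : ℤ, (σ ^ k) x ∈ A ∧ (σ ^ k) y ∈ B := by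
  by_contra hcon
  let bad : X → X → Prop := fun x y => ¬ ∃ k : ℤ, (σ ^ k) x ∈ A ∧ (σ ^ k) y ∈ B
  have hbad : ∀ x y, bad x y → ∀ k : ℤ, bad ((σ ^ k) x) ((σ ^ k) y) := by
    rintro x y h k ⟨l, hl⟩
    refine h ⟨l + k, ?_⟩
    rw [zpow_add]
    exact hl
  have hJ : ∀ n x y, bad x y → (T n).lev x = (T n).lev y ∧ ((T n).col x = 0 → (T n).col y = 0) := by
    intro n
    induction n with
    | zero =>
      intro x y h
      refine ⟨by rw [h0, h0], fun h1 => ?_⟩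
      by_contra h2
      exact h ⟨0, by simpa using (hA x).2 h1, by simpa using (hB y).2 h2⟩
    | succ n ih =>
      intro x y h
      have := (T (n + 1)).at_eq.1 (itin_step (hT n) (hφ (n + 1)) bad hbad ih x y h)
      exact ⟨this.2, fun h => this.1 ▸ h⟩
  obtain ⟨U, hU, hxU, hyU⟩ := exists_isClopen_of_totally_separated hne
  obtain ⟨n, S, rfl⟩ := hdec U hU
  have := (hT n).at_eq (itin_step (hT n) (hφ (n + 1)) bad hbad (hJ n) x y hcon)
  exact hyU (by rw [mem_preimage, ← this]; exact hxU)

end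

set_option linter.unusedSectionVars false

section
variable {X : Type*} [TopologicalSpace X] [CompactSpace X] [TopologicalSpace.MetrizableSpace X]
    [TotallyDisconnectedSpace X] [MeasurableSpace X] [BorelSpace X]
    {K : Set (ProbabilityMeasure X)}

lemma secondCountable_of_compact_metrizable : SecondCountableTopology X := by
  letI := TopologicalSpace.metrizableSpaceMetric X
  infer_instance

lemma measure_ext_clopen (μ ν : Measure X) [IsProbabilityMeasure μ] [IsProbabilityMeasure ν]
    (h : ∀ V, IsClopen V → μ V = ν V) : μ = ν := by
  have := secondCountable_of_compact_metrizable (X := X)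
  refine ext_of_generate_finite {s | IsClopen s} ?_ ?_ h (by simp)
  · rw [BorelSpace.measurable_eq (α := X), isTopologicalBasis_isClopen.borel_eq_generateFrom]
  · intro s hs t ht _
    exact IsClopen.inter hs ht

lemma countable_contZ : Countable C(X, ℤ) := by
  classical
  have := secondCountable_of_compact_metrizable (X := X)
  have : Countable (TopologicalSpace.Clopens X) :=
    TopologicalSpace.Clopens.countable_iff_secondCountable.2 this
  have hfin : ∀ f : C(X, ℤ), (range f).Finite := fun f =>
    (isCompact_range f.continuous).finite_of_discrete
  let fib : C(X, ℤ) → ℤ → TopologicalSpace.Clopens X := fun f n =>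
    ⟨f ⁻¹' {n}, (isClosed_discrete _).preimage f.continuous, (isOpen_discrete _).preimage f.continuous⟩
  let G : C(X, ℤ) → Finset (ℤ × TopologicalSpace.Clopens X) := fun f =>
    (hfin f).toFinset.image fun n => (n, fib f n)
  have hG : Function.Injective G := by
    intro f g hfg
    ext x
    have h1 : (f x, fib f (f x)) ∈ G f := by
      simp only [G, Finset.mem_image]
      exact ⟨f x, by simp, rfl⟩
    rw [hfg] at h1
    simp only [G, Finset.mem_image, Prod.mk.injEq] at h1
    obtain ⟨n, -, hn, h2⟩ := h1
    subst hn
    have h3 : x ∈ fib f (f x) := rfl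
    rw [← h2] at h3
    exact h3.symm
  exact hG.countable

lemma continuous_indicator_clopen {U : Set X} (hU : IsClopen U) :
    Continuous (U.indicator fun _ => (1 : ℤ)) := by
  rw [continuous_discrete_rng]
  intro n
  have : (U.indicator fun _ => (1 : ℤ)) ⁻¹' {n} = {x | (x ∈ U ∧ n = 1) ∨ (x ∈ Uᶜ ∧ n = 0)} := by
    ext x
    by_cases h : x ∈ U <;> simp [h, eq_comm]
  rw [this]
  have e : {x | (x ∈ U ∧ n = 1) ∨ (x ∈ Uᶜ ∧ n = 0)} = (U ∩ {_x | n = 1}) ∪ (Uᶜ ∩ {_x | n = 0}) := rfl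
  rw [e]
  exact (hU.isOpen.inter isOpen_const).union (hU.compl.isOpen.inter isOpen_const)

lemma integral_stage (T : Stage K) (ν : Measure X) [IsFiniteMeasure ν] (b : ℕ → ℝ)
    (hb : ∀ i < T.r, ∀ j < T.h, ν.real (T.at ⁻¹' {(i, j)}) = b i) (G : ℕ × ℕ → ℝ) :
    ∫ x, G (T.at x) ∂ν = ∑ i ∈ Finset.range T.r, b i * ∑ j ∈ Finset.range T.h, G (i, j) := by
  let Φ : X → Fin T.r × Fin T.h := fun x => (⟨T.col x, T.col_lt x⟩, ⟨T.lev x, T.lev_lt x⟩)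
  have hpre : ∀ q : Fin T.r × Fin T.h, Φ ⁻¹' {q} = T.at ⁻¹' {((q.1 : ℕ), (q.2 : ℕ))} := by
    rintro ⟨i, j⟩
    ext x
    simp [Φ, Stage.at, Fin.ext_iff]
  have h := integral_label Φ (fun q => by rw [hpre]; exact T.clopen_at _)
    (fun q => G ((q.1 : ℕ), (q.2 : ℕ))) ν
  have e : ∀ x, G (T.at x) = G (((Φ x).1 : ℕ), ((Φ x).2 : ℕ)) := fun x => rfl
  simp only [e]
  rw [h, Fintype.sum_prod_type, Finset.sum_range]
  refine Finset.sum_congr rfl fun i _ => ?_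
  rw [Finset.mul_sum, Finset.sum_range]
  refine Finset.sum_congr rfl fun j _ => ?_
  rw [hpre, hb i i.2 j j.2, mul_comm]

lemma measure_stage (T : Stage K) (ν : Measure X) [IsFiniteMeasure ν] (b : ℕ → ℝ)
    (hb : ∀ i < T.r, ∀ j < T.h, ν.real (T.at ⁻¹' {(i, j)}) = b i) (S : Set (ℕ × ℕ)) :
    ν.real (T.at ⁻¹' S) = ∑ i ∈ Finset.range T.r, b i * ∑ j ∈ Finset.range T.h,
      S.indicator (fun _ => (1 : ℝ)) (i, j) := by
  rw [← integral_stage T ν b hb]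
  have : ∀ x, S.indicator (fun _ => (1 : ℝ)) (T.at x) = (T.at ⁻¹' S).indicator (fun _ => (1 : ℝ)) x := fun x => rfl
  simp only [this]
  rw [integral_indicator_const _ (T.clopen_at S).isOpen.measurableSet]
  simp

lemma inv_of_mem {T T' : Stage K} {f : X → ℤ} (hT : StepRel T T' f) (φ : X → X)
    (hφ : ∀ x, SRel T' x (φ x)) (μ : ProbabilityMeasure X) (hμ : μ ∈ K) (S : Set (ℕ × ℕ)) :
    (μ : Measure X).real (φ ⁻¹' (T.at ⁻¹' S)) = (μ : Measure X).real (T.at ⁻¹' S) := by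
  obtain ⟨H, w, hH, hh, h1, h2, h3, -⟩ := hT
  have hpre : ∀ i j, T'.at ⁻¹' {(i, j)} = {x | T'.col x = i ∧ T'.lev x = j} := by
    intro i j; ext x; simp [Stage.at]
  have hb : ∀ i < T'.r, ∀ j < T'.h, (μ : Measure X).real (T'.at ⁻¹' {(i, j)}) =
      (μ : Measure X).real {x | T'.col x = i ∧ T'.lev x = 0} := by
    intro i hi j hj
    rw [hpre]
    exact congrFun (T'.meas i hi j hj) ⟨μ, hμ⟩
  let S' : Set (ℕ × ℕ) := {p | (w p.1 (p.2 / T.h), p.2 % T.h) ∈ S}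
  let S'' : Set (ℕ × ℕ) := {p | if p.2 + 1 < T'.h then (p.1, p.2 + 1) ∈ S' else (0, 0) ∈ S}
  have e1 : T.at ⁻¹' S = T'.at ⁻¹' S' := by
    ext x
    simp [Stage.at, S', ← h1, ← h2]
  have e2 : φ ⁻¹' (T.at ⁻¹' S) = T'.at ⁻¹' S'' := by
    ext x
    rw [e1]
    rcases hφ x with ⟨a1, a2, a3⟩ | ⟨a1, a2⟩
    · simp [Stage.at, S'', a1, a2, a3]
    · have : ¬ T'.lev x + 1 < T'.h := by omega
      simp [Stage.at, S'', this, a2, S', h3 _ (T'.col_lt _)]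
  rw [e2, e1, measure_stage T' _ _ hb, measure_stage T' _ _ hb]
  refine Finset.sum_congr rfl fun i hi => ?_
  congr 1
  have hi := Finset.mem_range.1 hi
  obtain ⟨m, hm⟩ : ∃ m, T'.h = m + 1 := ⟨T'.h - 1, by have := T'.hh; omega⟩
  rw [hm, Finset.sum_range_succ, Finset.sum_range_succ']
  congr 1
  · refine Finset.sum_congr rfl fun j hj => ?_
    have hj := Finset.mem_range.1 hj
    have : (i, j) ∈ S'' ↔ (i, j + 1) ∈ S' := by
      simp [S'', hm, hj]
    by_cases h : (i, j + 1) ∈ S'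
    · rw [indicator_of_mem h, indicator_of_mem (this.2 h)]
    · rw [indicator_of_notMem h, indicator_of_notMem (fun h' => h (this.1 h'))]
  · have : (i, m) ∈ S'' ↔ (i, 0) ∈ S' := by
      simp [S'', hm, S', h3 i hi]
    by_cases h : (i, 0) ∈ S'
    · rw [indicator_of_mem h, indicator_of_mem (this.2 h)]
    · rw [indicator_of_notMem h, indicator_of_notMem (fun h' => h (this.1 h'))]

lemma nonneg_of_inv {T T' : Stage K} {f : X → ℤ} (hT : StepRel T T' f) (φ : X ≃ₜ X)
    (hφ : ∀ x, SRel T' x (φ x)) (ν : ProbabilityMeasure X) (hν : (ν : Measure X).map φ = ν)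
    (hpos : ∀ μ ∈ K, 0 < ∫ x, (f x : ℝ) ∂(μ : Measure X)) : 0 ≤ ∫ x, (f x : ℝ) ∂(ν : Measure X) := by
  have hb : ∀ i < T'.r, ∀ j < T'.h, (ν : Measure X).real (T'.at ⁻¹' {(i, j)}) =
      (ν : Measure X).real (T'.at ⁻¹' {(i, 0)}) := by
    intro i hi j
    induction j with
    | zero => intro _; rfl
    | succ j ih =>
      intro hj
      rw [← ih (by omega)]
      have : φ ⁻¹' (T'.at ⁻¹' {(i, j + 1)}) = T'.at ⁻¹' {(i, j)} := by
        ext x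
        simp only [mem_preimage, mem_singleton_iff, Stage.at, Prod.mk.injEq]
        rcases hφ x with ⟨a1, a2, a3⟩ | ⟨a1, a2⟩
        · rw [a2, a3]; simp
        · rw [a2]; omega
      rw [← this, measureReal_def, measureReal_def]
      congr 1
      conv_lhs => rw [← hν]
      exact Measure.map_apply φ.continuous.measurable (T'.clopen_at _).isOpen.measurableSet
  obtain ⟨H, w, -, -, -, -, -, -, -, -, F, hF, hF'⟩ := hT
  have e : ∀ x, (f x : ℝ) = (fun p : ℕ × ℕ => (F p.1 p.2 : ℝ)) (T'.at x) := fun x => by rw [hF]; rfl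
  simp only [e]
  rw [integral_stage T' (ν : Measure X) _ hb (fun p : ℕ × ℕ => (F p.1 p.2 : ℝ))]
  refine Finset.sum_nonneg fun i hi => mul_nonneg measureReal_nonneg ?_
  have := hF' hpos i (Finset.mem_range.1 hi)
  exact_mod_cast this

lemma integral_comb (F : Finset (TopologicalSpace.Clopens X)) (a : F → ℤ) (m : ℤ)
    (μ : Measure X) [IsProbabilityMeasure μ] :
    ∫ x, (((∑ V : F, a V * (V.1 : Set X).indicator (fun _ => (1 : ℤ)) x) - m : ℤ) : ℝ) ∂μ =
      (∑ V : F, (a V : ℝ) * μ.real (V.1 : Set X)) - m := by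
  have e : ∀ (V : F) (x : X), (((V.1 : Set X).indicator (fun _ => (1 : ℤ)) x : ℤ) : ℝ) =
      (V.1 : Set X).indicator (fun _ => (1 : ℝ)) x := by
    intro V x
    by_cases h : x ∈ (V.1 : Set X)
    · rw [indicator_of_mem h, indicator_of_mem h]; simp
    · rw [indicator_of_notMem h, indicator_of_notMem h]; simp
  simp only [Int.cast_sub, Int.cast_sum, Int.cast_mul, e]
  have hi : ∀ V : F, Integrable (fun x => (a V : ℝ) * (V.1 : Set X).indicator (fun _ => (1 : ℝ)) x) μ :=
    fun V => ((integrable_const _).indicator V.1.isClopen.isOpen.measurableSet).const_mul _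
  rw [integral_sub (integrable_finset_sum _ fun V _ => hi V) (integrable_const _),
    integral_finset_sum _ fun V _ => hi V]
  congr 1
  · refine Finset.sum_congr rfl fun V _ => ?_
    rw [integral_const_mul, integral_indicator_const _ V.1.isClopen.isOpen.measurableSet]
    simp
  · simp

lemma mem_of_pos (hK : IsDynSimplex K) (ν : ProbabilityMeasure X)
    (hpos : ∀ f : X → ℤ, Continuous f → (∀ μ ∈ K, 0 < ∫ x, (f x : ℝ) ∂(μ : Measure X)) →
      0 ≤ ∫ x, (f x : ℝ) ∂(ν : Measure X)) : ν ∈ K := by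
  by_contra hνK
  obtain ⟨F, hF⟩ := hK.2.1.elim_finite_subfamily_closed
    (fun V : TopologicalSpace.Clopens X =>
      {μ : ProbabilityMeasure X | (μ : Measure X).real (V : Set X) = (ν : Measure X).real (V : Set X)})
    (fun V => isClosed_eq (dsVal_continuous V.isClopen) continuous_const) (by
      rw [eq_empty_iff_forall_notMem]
      rintro μ ⟨hμ, h⟩
      rw [mem_iInter] at h
      apply hνK
      have : (μ : Measure X) = ν := measure_ext_clopen _ _ fun V hV =>
        (measureReal_eq_measureReal_iff).1 (h ⟨V, hV⟩)
      rwa [← Subtype.ext this])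
  let e : ProbabilityMeasure X → (F → ℝ) := fun μ V => (μ : Measure X).real (V.1 : Set X)
  have he : Continuous e := continuous_pi fun V => dsVal_continuous V.1.isClopen
  have hconv : Convex ℝ (e '' K) := by
    rintro _ ⟨μ, hμ, rfl⟩ _ ⟨μ', hμ', rfl⟩ a b ha hb hab
    obtain ⟨σ, hσ, hσe⟩ := hK.2.2.1 μ hμ μ' hμ' (ENNReal.ofReal a)
      (by rw [← ENNReal.ofReal_one]; exact ENNReal.ofReal_le_ofReal (by linarith))
    refine ⟨σ, hσ, ?_⟩
    funext V
    have e1 : 1 - ENNReal.ofReal a = ENNReal.ofReal b := by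
      rw [← ENNReal.ofReal_one, ← ENNReal.ofReal_sub _ ha]; congr 1; linarith
    change (σ : Measure X).real _ = a * (μ : Measure X).real _ + b * (μ' : Measure X).real _
    rw [hσe, e1, measureReal_def, Measure.add_apply, Measure.smul_apply, Measure.smul_apply, smul_eq_mul,
      smul_eq_mul, ENNReal.toReal_add (ENNReal.mul_ne_top ENNReal.ofReal_ne_top (measure_ne_top _ _))
      (ENNReal.mul_ne_top ENNReal.ofReal_ne_top (measure_ne_top _ _)), ENNReal.toReal_mul, ENNReal.toReal_mul,
      ENNReal.toReal_ofReal ha, ENNReal.toReal_ofReal hb]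
    rfl
  have hnot : e ν ∉ e '' K := by
    rintro ⟨μ, hμ, h⟩
    rw [eq_empty_iff_forall_notMem] at hF
    refine hF μ ⟨hμ, ?_⟩
    simp only [mem_iInter]
    intro V hV
    exact congrFun h ⟨V, hV⟩
  obtain ⟨g, u, hg1, hg2⟩ := geometric_hahn_banach_point_closed hconv (hK.2.1.image he).isClosed hnot
  classical
  let c : F → ℝ := fun V => g (Pi.single V 1)
  have hg : ∀ v : F → ℝ, g v = ∑ V, c V * v V := by
    intro v
    have := LinearMap.pi_apply_eq_sum_univ (g : (F → ℝ) →ₗ[ℝ] ℝ) v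
    simp only [ContinuousLinearMap.coe_coe, smul_eq_mul] at this
    rw [this]
    refine Finset.sum_congr rfl fun V _ => ?_
    rw [mul_comm]
    congr 2
    funext j
    simp [Pi.single_apply, eq_comm]
  set δ : ℝ := (u - g (e ν)) / 2 with hδ
  have hδ0 : 0 < δ := by rw [hδ]; linarith
  set u' : ℝ := (u + g (e ν)) / 2 with hu'
  obtain ⟨N, hN⟩ := exists_nat_gt (((F.card : ℝ) + 1) / δ)
  rw [div_lt_iff₀ hδ0] at hN
  let a : F → ℤ := fun V => ⌊(N : ℝ) * c V⌋
  let m : ℤ := ⌊(N : ℝ) * u'⌋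
  have hest : ∀ μ : ProbabilityMeasure X,
      |((∑ V : F, (a V : ℝ) * (μ : Measure X).real (V.1 : Set X)) - m) - N * (g (e μ) - u')| ≤ F.card + 1 := by
    intro μ
    have e1 : ((∑ V : F, (a V : ℝ) * (μ : Measure X).real (V.1 : Set X)) - m) - N * (g (e μ) - u') =
        (∑ V : F, ((a V : ℝ) - N * c V) * (μ : Measure X).real (V.1 : Set X)) + (N * u' - m) := by
      rw [hg, mul_sub, Finset.mul_sum]
      have : ∑ V : F, ((a V : ℝ) - N * c V) * (μ : Measure X).real (V.1 : Set X) =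
          (∑ V : F, (a V : ℝ) * (μ : Measure X).real (V.1 : Set X)) - ∑ V : F, N * (c V * e μ V) := by
        rw [← Finset.sum_sub_distrib]
        refine Finset.sum_congr rfl fun V _ => ?_
        simp only [e]; ring
      rw [this]; ring
    rw [e1]
    refine (abs_add_le _ _).trans (add_le_add ?_ ?_)
    · refine (Finset.abs_sum_le_sum_abs _ _).trans ?_
      calc _ ≤ ∑ V : F, (1 : ℝ) := Finset.sum_le_sum fun V _ => ?_
        _ = F.card := by simp
      rw [abs_mul]
      have h1 : |(a V : ℝ) - N * c V| ≤ 1 := by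
        have := Int.floor_le ((N : ℝ) * c V)
        have := Int.lt_floor_add_one ((N : ℝ) * c V)
        rw [abs_le]; constructor <;> simp only [a] <;> linarith
      have h2 : |(μ : Measure X).real (V.1 : Set X)| ≤ 1 := by
        rw [abs_of_nonneg measureReal_nonneg]; exact measureReal_le_one
      exact mul_le_one₀ h1 (abs_nonneg _) h2
    · have := Int.floor_le ((N : ℝ) * u')
      have := Int.lt_floor_add_one ((N : ℝ) * u')
      rw [abs_le]; constructor <;> simp only [m] <;> linarith
  have hcont : Continuous fun x => (∑ V : F, a V * (V.1 : Set X).indicator (fun _ => (1 : ℤ)) x) - m :=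
    (continuous_finset_sum _ fun V _ => continuous_const.mul (continuous_indicator_clopen V.1.isClopen)).sub
      continuous_const
  have hfin := hpos _ hcont (fun μ hμ => by
    rw [integral_comb]
    have h1 := abs_le.1 (hest μ)
    have h2 := hg2 (e μ) ⟨μ, hμ, rfl⟩
    have h3 : (N : ℝ) * δ ≤ N * (g (e μ) - u') :=
      mul_le_mul_of_nonneg_left (by rw [hδ, hu']; linarith) (Nat.cast_nonneg _)
    linarith [h1.1])
  rw [integral_comb] at hfin
  have h1 := abs_le.1 (hest ν)
  have h3 : (N : ℝ) * (g (e ν) - u') = - (N * δ) := by rw [hδ, hu']; ring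
  linarith [h1.2]

end

set_option linter.unusedSectionVars false

section
variable {X : Type*} [TopologicalSpace X] [CompactSpace X] [TopologicalSpace.MetrizableSpace X]
    [TotallyDisconnectedSpace X] [MeasurableSpace X] [BorelSpace X]
    {K : Set (ProbabilityMeasure X)}

open Classical in
/-- the initial stage given by the partition `A`, `Aᶜ` -/
noncomputable def stageZero (K : Set (ProbabilityMeasure X)) (A : Set X) (hA : IsClopen A) (h1 : A.Nonempty)
    (h2 : Aᶜ.Nonempty) : Stage K where
  r := 2
  h := 1
  col x := if x ∈ A then 0 else 1
  lev _ := 0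
  hr := le_rfl
  hh := le_rfl
  col_lt x := by split_ifs <;> norm_num
  lev_lt x := by norm_num
  clopen i j := by
    have : {x | (if x ∈ A then 0 else 1) = i ∧ 0 = j} =
        (A ∩ {_x | 0 = i ∧ 0 = j}) ∪ (Aᶜ ∩ {_x | 1 = i ∧ 0 = j}) := by
      ext x
      by_cases h : x ∈ A <;> simp [h]
    rw [this]
    exact (hA.inter ⟨isClosed_const, isOpen_const⟩).union (hA.compl.inter ⟨isClosed_const, isOpen_const⟩)
  surj i hi j hj := by
    obtain ⟨x, hx⟩ := h1
    obtain ⟨y, hy⟩ := h2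
    have hj : 0 = j := by omega
    have hy : y ∉ A := hy
    have : i = 0 ∨ i = 1 := by omega
    rcases this with rfl | rfl
    · exact ⟨x, by simp [hx], hj⟩
    · exact ⟨y, by simp [hy], hj⟩
  meas i hi j hj := by
    have hj : j = 0 := by omega
    subst hj; rfl

lemma exists_seq [Nonempty X] (hK : IsDynSimplex K) (hdiv : Divisible K) (T0 : Stage K) (f : ℕ → C(X, ℤ)) :
    ∃ T : ℕ → Stage K, T 0 = T0 ∧ ∀ n, StepRel (T n) (T (n + 1)) (f n) := by
  choose s hs using fun (n : ℕ) (T : Stage K) => exists_step hK hdiv T (f n) (f n).continuous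
  exact ⟨fun n => Nat.rec T0 (fun n T => s n T) n, rfl, fun n => hs n _⟩

end

/-- given a divisible dynamical simplex `K` on a Cantor space `X` and a partition
`X = A ∪ B` into two disjoint nonempty clopen sets, there is a minimal homeomorphism `φ` of `X`
whose set of invariant measures is `K` and such that any two distinct points are separated by
the `{A,B}`-itinerary: for all `x ≠ y` there is `k ∈ ℤ` with `φ^k x ∈ A` and `φ^k y ∈ B`. -/
theorem divisible_dynSimplex_minimal_homeo_with_separating_partition
    {X : Type*} [TopologicalSpace X] [CompactSpace X] [TopologicalSpace.MetrizableSpace X]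
    [TotallyDisconnectedSpace X] [Nonempty X] [MeasurableSpace X] [BorelSpace X]
    (hX : Perfect (Set.univ : Set X))
    (K : Set (ProbabilityMeasure X)) (hK : IsDynSimplex K) (hdiv : Divisible K)
    (A B : Set X) (hA : IsClopen A) (hB : IsClopen B)
    (hAne : A.Nonempty) (hBne : B.Nonempty)
    (hdisj : Disjoint A B) (hcover : A ∪ B = Set.univ) :
    ∃ φ : X ≃ₜ X, IsMinimalHomeo φ ∧
      K = {μ : ProbabilityMeasure X | (μ : Measure X).map φ = (μ : Measure X)} ∧
      ∀ x y : X, x ≠ y →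
        ∃ k : ℤ, (φ.toEquiv ^ k) x ∈ A ∧ (φ.toEquiv ^ k) y ∈ B := by
  have hAc : Aᶜ = B := by
    ext x
    have h1 : x ∈ A ∨ x ∈ B := by rw [← mem_union, hcover]; trivial
    constructor
    · exact fun h => h1.resolve_left h
    · exact fun h h' => disjoint_left.1 hdisj h' h
  have := countable_contZ (X := X)
  obtain ⟨f, hf⟩ := exists_surjective_nat C(X, ℤ)
  obtain ⟨T, hT0, hT⟩ := exists_seq hK hdiv (stageZero K A hA hAne (by rw [hAc]; exact hBne)) f
  have hdec : ∀ U : Set X, IsClopen U → ∃ n, ∃ S : Set (ℕ × ℕ), U = (T n).at ⁻¹' S := by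
    intro U hU
    obtain ⟨n, hn⟩ := hf ⟨_, continuous_indicator_clopen hU⟩
    obtain ⟨H, w, -, -, -, -, -, -, -, -, F, hF, -⟩ := hT n
    refine ⟨n + 1, {p | F p.1 p.2 = 1}, ?_⟩
    ext x
    have h1 := hF x
    rw [hn] at h1
    simp only [ContinuousMap.coe_mk] at h1
    change x ∈ U ↔ F ((T (n + 1)).col x) ((T (n + 1)).lev x) = 1
    rw [← h1]
    by_cases h : x ∈ U <;> simp [h]
  obtain ⟨φ, hφ⟩ := exists_homeo T (fun n => f n) hT hdec
  refine ⟨φ, homeo_minimal T (fun n => f n) hT hdec φ hφ, ?_, ?_⟩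
  · ext μ
    constructor
    · intro hμ
      have : IsProbabilityMeasure ((μ : Measure X).map φ) :=
        Measure.isProbabilityMeasure_map φ.continuous.measurable.aemeasurable
      refine measure_ext_clopen _ _ fun V hV => ?_
      rw [Measure.map_apply φ.continuous.measurable hV.isOpen.measurableSet]
      obtain ⟨n, S, rfl⟩ := hdec V hV
      exact (measureReal_eq_measureReal_iff).1 (inv_of_mem (hT n) φ (hφ (n + 1)) μ hμ S)
    · intro hμ
      refine mem_of_pos hK μ fun g hg hpos => ?_
      obtain ⟨n, hn⟩ := hf ⟨g, hg⟩
      have h1 := nonneg_of_inv (hT n) φ (hφ (n + 1)) μ hμ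
      rw [hn] at h1
      exact h1 hpos
  · intro x y hxy
    refine itin T (fun n => f n) hT hdec φ.toEquiv hφ A B ?_ ?_ ?_ x y hxy
    · intro x
      rw [hT0]
      by_cases h : x ∈ A <;> simp [stageZero, h]
    · intro x
      have hx : x ∈ B ↔ x ∉ A := by rw [← hAc]; rfl
      rw [hT0, hx]
      by_cases h : x ∈ A <;> simp [stageZero, h]
    · intro x
      rw [hT0]; rfl
end

section
/- Let X be a Cantor space, K a divisible dynamical simplex on X, and 𝒮 a KR-partition of X associated to K. Then there exists a KR-partition 𝒮' of X associated to K which refines 𝒮 and all of whose columns have the same height. -/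
open MeasureTheory Set
open scoped ENNReal NNReal

/-- A KR-partition of `X` associated to `K`: a finite partition of `X` into nonempty clopen
sets `atom i j` (`i` a column index, `j` a level of that column) such that, within each
column, all levels have the same measure for every `μ ∈ K`. -/
structure KRPartition (X : Type*) [TopologicalSpace X] [MeasurableSpace X]
    (K : Set (ProbabilityMeasure X)) where
  n : ℕ
  npos : 0 < n
  height : Fin n → ℕ
  height_pos : ∀ i, 0 < height i
  atom : (i : Fin n) → Fin (height i) → Set X
  clopen : ∀ i j, IsClopen (atom i j)
  nonempty : ∀ i j, (atom i j).Nonempty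
  disj : ∀ p q : (i : Fin n) × Fin (height i), p ≠ q →
    Disjoint (atom p.1 p.2) (atom q.1 q.2)
  cover : ⋃ (i) (j), atom i j = Set.univ
  measure_eq : ∀ (i : Fin n) (j k : Fin (height i)), ∀ μ ∈ K,
    (μ : Measure X) (atom i j) = (μ : Measure X) (atom i k)

namespace KRPartition

variable {X : Type*} [TopologicalSpace X] [MeasurableSpace X] {K : Set (ProbabilityMeasure X)}

/-- The base of a KR-partition: the union of the bottom levels of its columns. -/
def base (T : KRPartition X K) : Set X :=
  ⋃ i, T.atom i ⟨0, T.height_pos i⟩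

/-- The top of a KR-partition: the union of the top levels of its columns. -/
def top (T : KRPartition X K) : Set X :=
  ⋃ i, T.atom i ⟨T.height i - 1, Nat.sub_lt (T.height_pos i) one_pos⟩

/-- `S` refines `T`: the base of `S` is contained in the base of `T`, every atom of `T`
is a union of atoms of `S`, and whenever an atom of `S` is contained in a non-top atom
of `T`, the next level of `S` is contained in the next level of `T`. -/
def Refines (S T : KRPartition X K) : Prop :=
  S.base ⊆ T.base ∧
  (∀ (i : Fin T.n) (j : Fin (T.height i)),
    ∃ A : Set ((c : Fin S.n) × Fin (S.height c)),
      T.atom i j = ⋃ p ∈ A, S.atom p.1 p.2) ∧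
  (∀ (c : Fin S.n) (j : Fin (S.height c)) (i : Fin T.n) (k : Fin (T.height i)),
    S.atom c j ⊆ T.atom i k → ∀ hk : (k : ℕ) + 1 < T.height i,
      ∃ hj : (j : ℕ) + 1 < S.height c,
        S.atom c ⟨(j : ℕ) + 1, hj⟩ ⊆ T.atom i ⟨(k : ℕ) + 1, hk⟩)

/-- Column `c` of `S` contains a copy of column `i` of `T` starting at level `j`:
the consecutive levels `j, j+1, …` of column `c` traverse column `i` of `T` from its
base level to its top level. -/
def IsCopyAt (S T : KRPartition X K) (c : Fin S.n) (i : Fin T.n) (j : ℕ) : Prop :=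
  ∀ l : ℕ, ∀ hl : l < T.height i, ∃ hjl : j + l < S.height c,
    S.atom c ⟨j + l, hjl⟩ ⊆ T.atom i ⟨l, hl⟩

/-- The number of copies of column `i` of `T` contained in column `c` of `S`. -/
noncomputable def numCopies (S T : KRPartition X K) (c : Fin S.n) (i : Fin T.n) : ℕ :=
  {j : ℕ | IsCopyAt S T c i j}.ncard

/-- Two columns `c, c'` of `S` are `T`-twins if they have the same repartition, i.e.
for every column `i` of `T` the proportions of copies of `i` (relative to the heights)
agree. -/
def Twins (S T : KRPartition X K) (c c' : Fin S.n) : Prop :=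
  ∀ i : Fin T.n,
    (numCopies S T c i : ℚ) / (S.height c : ℚ) = (numCopies S T c' i : ℚ) / (S.height c' : ℚ)

end KRPartition

theorem split_clopen_aux {X : Type*} [TopologicalSpace X] [MeasurableSpace X] [BorelSpace X]
    (K : Set (ProbabilityMeasure X)) (hdiv : Divisible K) (m : ℕ) :
    ∀ U : Set X, IsClopen U →
      ∃ P : ℕ → Set X, (∀ l < m + 1, IsClopen (P l)) ∧
        (∀ l < m + 1, ∀ l' < m + 1, l ≠ l' → Disjoint (P l) (P l')) ∧
        (∀ x, x ∈ U ↔ ∃ l < m + 1, x ∈ P l) ∧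
        (∀ l < m + 1, ∀ μ ∈ K, (μ : Measure X) (P l) = (μ : Measure X) U / ((m + 1 : ℕ) : ℝ≥0∞)) := by
  induction m with
  | zero =>
    intro U hU
    refine ⟨fun _ => U, fun _ _ => hU, fun l hl l' hl' h => by omega, fun x => ?_, ?_⟩
    · exact ⟨fun h => ⟨0, by omega, h⟩, fun ⟨_, _, h⟩ => h⟩
    · intro l _ μ _
      simp
  | succ m ih =>
    intro U hU
    obtain ⟨V, hV, hVU, hVm⟩ := hdiv U hU (m + 1 + 1) (by omega)
    obtain ⟨P, h1, h2, h3, h4⟩ := ih (U \ V) (hU.diff hV)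
    have hPV : ∀ l < m + 1, Disjoint (P l) V := fun l hl =>
      Set.disjoint_left.2 fun x hx hxV => ((h3 x).2 ⟨l, hl, hx⟩).2 hxV
    refine ⟨fun l => if l < m + 1 then P l else V, ?_, ?_, ?_, ?_⟩
    · intro l _
      dsimp only
      split_ifs with h
      · exact h1 l h
      · exact hV
    · intro l hl l' hl' hne
      dsimp only
      split_ifs with h h' h'
      · exact h2 l h l' h' hne
      · exact hPV l h
      · exact (hPV l' h').symm
      · omega
    · intro x
      constructor
      · intro hx
        by_cases hxV : x ∈ V
        · exact ⟨m + 1, by omega, by simpa using hxV⟩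
        · obtain ⟨l, hl, hxl⟩ := (h3 x).1 ⟨hx, hxV⟩
          exact ⟨l, by omega, by simpa [hl] using hxl⟩
      · rintro ⟨l, hl, hxl⟩
        dsimp only at hxl
        split_ifs at hxl with h
        · exact ((h3 x).2 ⟨l, h, hxl⟩).1
        · exact hVU hxl
    · intro l hl μ hμ
      dsimp only
      split_ifs with h
      · rw [h4 l h μ hμ, measure_sdiff hVU hV.isOpen.measurableSet.nullMeasurableSet (measure_ne_top _ _),
          hVm μ hμ]
        have hne : (μ : Measure X) U ≠ ∞ := measure_ne_top _ _
        generalize (μ : Measure X) U = a at hne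
        lift a to ℝ≥0 using hne
        have e1 : ((a : ℝ≥0∞) / ((m + 1 + 1 : ℕ) : ℝ≥0∞)) = ((a / ((m + 1 + 1 : ℕ) : ℝ≥0) : ℝ≥0) : ℝ≥0∞) := by
          rw [ENNReal.coe_div (by positivity)]; simp
        rw [e1, ← ENNReal.coe_sub]
        have e2 : (a - a / ((m + 1 + 1 : ℕ) : ℝ≥0)) = ((m + 1 : ℕ) : ℝ≥0) * (a / ((m + 1 + 1 : ℕ) : ℝ≥0)) := by
          apply tsub_eq_of_eq_add
          push_cast
          field_simp
        rw [e2, ENNReal.coe_mul, ENNReal.coe_natCast, mul_comm]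
        exact ENNReal.mul_div_cancel_right (by simp) (ENNReal.natCast_ne_top _)
      · exact hVm μ hμ

/-- if `K` is a divisible dynamical simplex on a Cantor space `X` and `𝒮` is a
KR-partition of `X` associated to `K`, then there is a KR-partition `𝒮'` refining `𝒮` all of
whose columns have the same height. -/
theorem divisible_KRPartition_refines_same_height
    {X : Type*} [TopologicalSpace X] [CompactSpace X] [TopologicalSpace.MetrizableSpace X]
    [TotallyDisconnectedSpace X] [Nonempty X] [MeasurableSpace X] [BorelSpace X]
    (hX : Perfect (Set.univ : Set X))
    (K : Set (ProbabilityMeasure X)) (hK : IsDynSimplex K) (hdiv : Divisible K)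
    (S : KRPartition X K) :
    ∃ S' : KRPartition X K, S'.Refines S ∧
      ∀ c c' : Fin S'.n, S'.height c = S'.height c' := by
  classical
  obtain ⟨⟨μ₀, hμ₀⟩, -, -, -, hsupp, -⟩ := hK
  set N := ∏ i, S.height i with hN
  have hNpos : 0 < N := Finset.prod_pos fun i _ => S.height_pos i
  have hm : ∀ i, ∃ m : ℕ, N = S.height i * (m + 1) := by
    intro i
    obtain ⟨k, hk⟩ := Finset.dvd_prod_of_mem S.height (Finset.mem_univ i)
    rcases k with _ | k
    · rw [← hN] at hk; omega
    · exact ⟨k, hk⟩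
  choose m hm using hm
  choose P h1 h2 h3 h4 using fun (i : Fin S.n) (j : Fin (S.height i)) =>
    split_clopen_aux K hdiv (m i) (S.atom i j) (S.clopen i j)
  have hlt : ∀ i, ∀ t < N, t / S.height i < m i + 1 := fun i t ht =>
    Nat.div_lt_of_lt_mul (by rw [← hm i]; exact ht)
  have hmod : ∀ i t, t % S.height i < S.height i := fun i t => Nat.mod_lt _ (S.height_pos i)
  let Q : (i : Fin S.n) → Fin N → Set X := fun i t =>
    P i ⟨t % S.height i, hmod i t⟩ (t / S.height i)
  have hQsub : ∀ i (t : Fin N), Q i t ⊆ S.atom i ⟨t % S.height i, hmod i t⟩ := fun i t x hx =>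
    (h3 i _ x).2 ⟨_, hlt i t t.2, hx⟩
  have hQmeas : ∀ i (t : Fin N), ∀ μ ∈ K, (μ : Measure X) (Q i t) =
      (μ : Measure X) (S.atom i ⟨0, S.height_pos i⟩) / ((m i + 1 : ℕ) : ℝ≥0∞) := by
    intro i t μ hμ
    rw [← S.measure_eq i ⟨t % S.height i, hmod i t⟩ ⟨0, S.height_pos i⟩ μ hμ]
    exact h4 i _ _ (hlt i t t.2) μ hμ
  have hQne : ∀ i t, (Q i t).Nonempty := by
    intro i t
    have := hsupp μ₀ hμ₀
    apply nonempty_of_measure_ne_zero (μ := (μ₀ : Measure X))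
    rw [hQmeas i t μ₀ hμ₀]
    refine (ENNReal.div_pos ?_ (ENNReal.natCast_ne_top _)).ne'
    exact ((S.clopen i _).isOpen.measure_pos _ (S.nonempty i _)).ne'
  have hatom : ∀ (p q : (i : Fin S.n) × Fin (S.height i)) (x : X),
      x ∈ S.atom p.1 p.2 → x ∈ S.atom q.1 q.2 → p = q := by
    intro p q x hp hq
    by_contra hne
    exact Set.disjoint_left.1 (S.disj p q hne) hp hq
  have hcov : ∀ i (j : Fin (S.height i)) x, x ∈ S.atom i j →
      ∃ t : Fin N, (t : ℕ) % S.height i = j ∧ x ∈ Q i t := by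
    intro i j x hx
    obtain ⟨l, hl, hxl⟩ := (h3 i j x).1 hx
    have hj := j.2
    have htN : S.height i * l + j < N := by
      rw [hm i]
      calc S.height i * l + j < S.height i * l + S.height i := by omega
        _ = S.height i * (l + 1) := by ring
        _ ≤ _ := Nat.mul_le_mul_left _ hl
    have e1 : (S.height i * l + j) % S.height i = j := by
      rw [Nat.mul_add_mod, Nat.mod_eq_of_lt hj]
    have e2 : (S.height i * l + j) / S.height i = l := by
      rw [Nat.mul_add_div (S.height_pos i), Nat.div_eq_of_lt hj, add_zero]
    refine ⟨⟨S.height i * l + j, htN⟩, e1, ?_⟩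
    have e3 : (⟨(S.height i * l + j) % S.height i, hmod i _⟩ : Fin (S.height i)) = j := Fin.ext e1
    simp only [Q, e3, e2]
    exact hxl
  refine ⟨{ n := S.n, npos := S.npos, height := fun _ => N, height_pos := fun _ => hNpos,
            atom := Q, clopen := fun i t => h1 i _ _ (hlt i t t.2), nonempty := hQne,
            disj := ?_, cover := ?_, measure_eq := ?_ }, ⟨?_, ?_, ?_⟩, fun _ _ => rfl⟩
  · rintro ⟨i, t⟩ ⟨i', t'⟩ hne
    refine Set.disjoint_left.2 fun x hx hx' => hne ?_
    have h := hatom ⟨i, _⟩ ⟨i', _⟩ x (hQsub i t hx) (hQsub i' t' hx')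
    obtain rfl : i = i' := congrArg Sigma.fst h
    have h' : (⟨t % S.height i, hmod i t⟩ : Fin (S.height i)) = ⟨t' % S.height i, hmod i t'⟩ := by
      simpa using h
    have h5 : (t : ℕ) % S.height i = t' % S.height i := congrArg Fin.val h'
    have h6 : (t : ℕ) / S.height i = t' / S.height i := by
      by_contra hd
      have hx2 : x ∈ P i ⟨t % S.height i, hmod i t⟩ (t' / S.height i) := by
        rw [h']; exact hx'
      exact Set.disjoint_left.1 (h2 i _ _ (hlt i t t.2) _ (hlt i t' t'.2) hd) hx hx2
    have : t = t' := Fin.ext (by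
      rw [← Nat.div_add_mod (t : ℕ) (S.height i), h5, h6, Nat.div_add_mod])
    rw [this]
  · refine Set.eq_univ_of_forall fun x => ?_
    have hx : x ∈ ⋃ (i) (j), S.atom i j := by rw [S.cover]; trivial
    simp only [Set.mem_iUnion] at hx ⊢
    obtain ⟨i, j, hx⟩ := hx
    obtain ⟨t, -, ht⟩ := hcov i j x hx
    exact ⟨i, t, ht⟩
  · intro i j k μ hμ
    exact (hQmeas i j μ hμ).trans (hQmeas i k μ hμ).symm
  · refine Set.iUnion_subset fun i x hx => Set.mem_iUnion.2 ⟨i, ?_⟩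
    have := hQsub i ⟨0, hNpos⟩ hx
    simpa using this
  · intro i j
    refine ⟨{p | Q p.1 p.2 ⊆ S.atom i j}, ?_⟩
    ext x
    simp only [Set.mem_iUnion]
    constructor
    · intro hx
      obtain ⟨t, ht, hxt⟩ := hcov i j x hx
      refine ⟨⟨i, t⟩, ?_, hxt⟩
      have e3 : (⟨t % S.height i, hmod i _⟩ : Fin (S.height i)) = j := Fin.ext ht
      have := hQsub i t
      rw [e3] at this
      exact this
    · rintro ⟨p, hp, hx⟩
      exact hp hx
  · intro c t i k hsub hk
    obtain ⟨x, hx⟩ := hQne c t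
    have h := hatom ⟨c, _⟩ ⟨i, k⟩ x (hQsub c t hx) (hsub hx)
    obtain rfl : c = i := congrArg Sigma.fst h
    have h' : (⟨t % S.height c, hmod c t⟩ : Fin (S.height c)) = k := by simpa using h
    have h5 : (t : ℕ) % S.height c = k := congrArg Fin.val h'
    have e : (t : ℕ) + 1 = S.height c * (t / S.height c) + (k + 1) := by
      have := Nat.div_add_mod (t : ℕ) (S.height c)
      omega
    have hj : (t : ℕ) + 1 < N := by
      have h7 := hlt c t t.2
      have h8 : S.height c * (t / S.height c + 1) ≤ N :=
        (Nat.mul_le_mul_left _ h7).trans (hm c).ge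
      rw [Nat.mul_add] at h8
      omega
    have e1 : ((t : ℕ) + 1) % S.height c = k + 1 := by
      rw [e, Nat.mul_add_mod, Nat.mod_eq_of_lt hk]
    refine ⟨hj, ?_⟩
    have := hQsub c ⟨t + 1, hj⟩
    simp only [e1] at this
    exact this
end

section
/- Let X be a Cantor space and K a divisible dynamical simplex on X. Let 𝒯 be a KR-partition of X associated to K with columns C_1,…,C_n, where n ≥ 2, and let 𝒮 be a KR-partition refining 𝒯 such that at least two columns of 𝒮 are not 𝒯-twins. Then there exists a KR-partition 𝒮' refining 𝒮 such that: (1) each column of 𝒮' contains at least one copy of each column of 𝒯; (2) no two columns of 𝒮' are 𝒯-twins; (3) all columns of 𝒮' have the same height. -/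
open MeasureTheory Set
open scoped ENNReal NNReal

section Helpers

variable {X : Type*} [TopologicalSpace X] [MeasurableSpace X] [BorelSpace X]
  {K : Set (ProbabilityMeasure X)}

/-- `f` is the measure function of a clopen set. -/
def ClopenValue (K : Set (ProbabilityMeasure X)) (f : ProbabilityMeasure X → ℝ) : Prop :=
  ∃ V : Set X, IsClopen V ∧ ∀ μ ∈ K, (μ : Measure X).real V = f μ

theorem glasnerWeiss_real (hK : IsDynSimplex K) {U V : Set X} (hU : IsClopen U) (hV : IsClopen V)
    (h : ∀ μ ∈ K, (μ : Measure X).real U < (μ : Measure X).real V) :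
    ∃ W : Set X, IsClopen W ∧ W ⊆ V ∧
      ∀ μ ∈ K, (μ : Measure X).real W = (μ : Measure X).real U := by
  obtain ⟨W, hW, hWV, hm⟩ := hK.2.2.2.2.2 U V hU hV (fun μ hμ => by
    have := h μ hμ
    simp only [measureReal_def] at this
    exact (ENNReal.toReal_lt_toReal (measure_ne_top _ _) (measure_ne_top _ _)).1 this)
  exact ⟨W, hW, hWV, fun μ hμ => by simp only [measureReal_def, hm μ hμ]⟩

theorem measureReal_pos' (hK : IsDynSimplex K) {U : Set X} (hU : IsClopen U) (hne : U.Nonempty)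
    {μ : ProbabilityMeasure X} (hμ : μ ∈ K) : 0 < (μ : Measure X).real U := by
  have := hK.2.2.2.2.1 μ hμ
  rw [measureReal_def]
  exact ENNReal.toReal_pos (hU.isOpen.measure_ne_zero _ hne) (measure_ne_top _ _)

theorem measureReal_lower (hK : IsDynSimplex K) {U : Set X} (hU : IsClopen U)
    (hne : U.Nonempty) : ∃ ε : ℝ, 0 < ε ∧ ∀ μ ∈ K, ε ≤ (μ : Measure X).real U := by
  have hc : Continuous fun μ : ProbabilityMeasure X => (μ : Measure X).real U := by
    have := ProbabilityMeasure.continuous_integral_boundedContinuousFunction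
      (BoundedContinuousFunction.indicator U hU)
    refine this.congr fun μ => ?_
    have h2 : (⇑(BoundedContinuousFunction.indicator U hU) : X → ℝ) = U.indicator 1 := rfl
    rw [h2]
    exact integral_indicator_one hU.isOpen.measurableSet
  obtain ⟨μ₀, h₀, hmin⟩ := hK.2.1.exists_isMinOn hK.1 hc.continuousOn
  exact ⟨_, measureReal_pos' hK hU hne h₀, fun μ hμ => hmin hμ⟩

theorem ClopenValue.sub (hK : IsDynSimplex K) {f g : ProbabilityMeasure X → ℝ}
    (hf : ClopenValue K f) (hg : ClopenValue K g) (h : ∀ μ ∈ K, f μ < g μ) :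
    ClopenValue K (fun μ => g μ - f μ) := by
  obtain ⟨U, hU, hUf⟩ := hf
  obtain ⟨V, hV, hVg⟩ := hg
  obtain ⟨W, hW, hWV, hm⟩ := glasnerWeiss_real hK hU hV (fun μ hμ => by
    rw [hUf μ hμ, hVg μ hμ]; exact h μ hμ)
  refine ⟨V \ W, hV.diff hW, fun μ hμ => ?_⟩
  rw [measureReal_sdiff hWV hW.isOpen.measurableSet, hm μ hμ, hUf μ hμ, hVg μ hμ]

theorem ClopenValue.div (hdiv : Divisible K) {f : ProbabilityMeasure X → ℝ}
    (hf : ClopenValue K f) {n : ℕ} (hn : 1 ≤ n) :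
    ClopenValue K (fun μ => f μ / n) := by
  obtain ⟨U, hU, hUf⟩ := hf
  obtain ⟨V, hV, -, hm⟩ := hdiv U hU n hn
  refine ⟨V, hV, fun μ hμ => ?_⟩
  change _ = f μ / n
  rw [measureReal_def, hm μ hμ, ENNReal.toReal_div, ← hUf μ hμ, measureReal_def,
    ENNReal.toReal_natCast]

theorem ClopenValue.sub_sum (hK : IsDynSimplex K) {ι : Type*} [DecidableEq ι] (s : Finset ι)
    {g : ProbabilityMeasure X → ℝ} {f : ι → ProbabilityMeasure X → ℝ}
    (hf : ∀ i ∈ s, ClopenValue K (f i)) (hg : ClopenValue K g)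
    (hf0 : ∀ i ∈ s, ∀ μ ∈ K, 0 ≤ f i μ)
    (h : ∀ μ ∈ K, ∑ i ∈ s, f i μ < g μ) :
    ClopenValue K (fun μ => g μ - ∑ i ∈ s, f i μ) := by
  induction s using Finset.induction_on with
  | empty => simpa using hg
  | insert a s ha ih =>
    have h1 : ∀ μ ∈ K, f a μ + ∑ i ∈ s, f i μ < g μ := fun μ hμ => by
      simpa [Finset.sum_insert ha] using h μ hμ
    have h0 := hf0 a (Finset.mem_insert_self _ _)
    have h2 := ih (fun i hi => hf i (Finset.mem_insert_of_mem hi))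
      (fun i hi => hf0 i (Finset.mem_insert_of_mem hi))
      (fun μ hμ => by linarith [h1 μ hμ, h0 μ hμ])
    have h3 := ClopenValue.sub hK (hf a (Finset.mem_insert_self _ _)) h2
      (fun μ hμ => by linarith [h1 μ hμ])
    obtain ⟨V, hV, hVm⟩ := h3
    exact ⟨V, hV, fun μ hμ => by
      rw [hVm μ hμ]
      simp only [Finset.sum_insert ha]
      ring⟩

theorem partition_clopen (hK : IsDynSimplex K) {ι : Type*} [DecidableEq ι] (s : Finset ι)
    (V : ι → Set X) (hV : ∀ i ∈ s, IsClopen (V i)) (hne : ∀ i ∈ s, (V i).Nonempty)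
    (U : Set X) (hU : IsClopen U)
    (hsum : ∀ μ ∈ K, ∑ i ∈ s, (μ : Measure X).real (V i) = (μ : Measure X).real U) :
    ∃ W : ι → Set X, (∀ i ∈ s, IsClopen (W i)) ∧
      (∀ i ∈ s, ∀ μ ∈ K, (μ : Measure X).real (W i) = (μ : Measure X).real (V i)) ∧
      (∀ i ∈ s, ∀ j ∈ s, i ≠ j → Disjoint (W i) (W j)) ∧
      (∀ x, x ∈ U ↔ ∃ i ∈ s, x ∈ W i) := by
  induction s using Finset.induction_on generalizing U with
  | empty =>
    obtain ⟨μ, hμ⟩ := hK.1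
    have hUe : U = ∅ := by
      by_contra hcon
      have := measureReal_pos' hK hU (Set.nonempty_iff_ne_empty.2 hcon) hμ
      have h2 := hsum μ hμ
      rw [Finset.sum_empty] at h2
      linarith
    exact ⟨fun _ => ∅, by simp [hUe]⟩
  | insert a s ha ih =>
    have hsum' : ∀ μ ∈ K, (μ : Measure X).real (V a) + ∑ i ∈ s, (μ : Measure X).real (V i)
        = (μ : Measure X).real U := fun μ hμ => by
      rw [← hsum μ hμ, Finset.sum_insert ha]
    have hVa := hV a (Finset.mem_insert_self _ _)
    have hV' : ∀ i ∈ s, IsClopen (V i) := fun i hi => hV i (Finset.mem_insert_of_mem hi)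
    have hne' : ∀ i ∈ s, (V i).Nonempty := fun i hi => hne i (Finset.mem_insert_of_mem hi)
    obtain ⟨A, hA, hAU, hAm⟩ : ∃ A : Set X, IsClopen A ∧ A ⊆ U ∧
        ∀ μ ∈ K, (μ : Measure X).real A = (μ : Measure X).real (V a) := by
      rcases s.eq_empty_or_nonempty with rfl | hs
      · exact ⟨U, hU, subset_rfl, fun μ hμ => by rw [← hsum' μ hμ]; simp⟩
      · refine glasnerWeiss_real hK hVa hU fun μ hμ => ?_
        rw [← hsum' μ hμ]
        have := Finset.sum_pos (fun i hi => measureReal_pos' hK (hV' i hi) (hne' i hi) hμ) hs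
        linarith
    obtain ⟨W, h1, h2, h3, h4⟩ := ih hV' hne' (U \ A) (hU.diff hA) (fun μ hμ => by
      rw [measureReal_sdiff hAU hA.isOpen.measurableSet, hAm μ hμ]
      linarith [hsum' μ hμ])
    have hsa : ∀ i ∈ s, i ≠ a := fun i hi h => ha (h ▸ hi)
    have hdis : ∀ i ∈ s, Disjoint A (W i) := fun i hi => by
      rw [Set.disjoint_left]
      intro x hx hx'
      exact ((h4 x).2 ⟨i, hi, hx'⟩).2 hx
    refine ⟨Function.update W a A, ?_, ?_, ?_, ?_⟩
    · intro i hi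
      rcases Finset.mem_insert.1 hi with rfl | hi
      · simpa using hA
      · rw [Function.update_of_ne (hsa i hi)]; exact h1 i hi
    · intro i hi
      rcases Finset.mem_insert.1 hi with rfl | hi
      · simpa using hAm
      · rw [Function.update_of_ne (hsa i hi)]; exact h2 i hi
    · intro i hi j hj hij
      rcases Finset.mem_insert.1 hi with hia | his <;>
        rcases Finset.mem_insert.1 hj with hja | hjs
      · exact absurd (hia.trans hja.symm) hij
      · subst hia
        rw [Function.update_self, Function.update_of_ne (hsa j hjs)]; exact hdis j hjs
      · subst hja
        rw [Function.update_self, Function.update_of_ne (hsa i his)]; exact (hdis i his).symm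
      · rw [Function.update_of_ne (hsa j hjs), Function.update_of_ne (hsa i his)]
        exact h3 i his j hjs hij
    · intro x
      constructor
      · intro hx
        by_cases hxA : x ∈ A
        · exact ⟨a, Finset.mem_insert_self _ _, by simpa using hxA⟩
        · obtain ⟨i, hi, hxi⟩ := (h4 x).1 ⟨hx, hxA⟩
          exact ⟨i, Finset.mem_insert_of_mem hi, by
            rw [Function.update_of_ne (hsa i hi)]; exact hxi⟩
      · rintro ⟨i, hi, hx⟩
        rcases Finset.mem_insert.1 hi with rfl | hi
        · exact hAU (by simpa using hx)
        · rw [Function.update_of_ne (hsa i hi)] at hx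
          exact ((h4 x).2 ⟨i, hi, hx⟩).1

end Helpers

theorem greedy_choice {ι V : Type*} [DecidableEq ι] (n0 : ℕ) (p : ι → ℕ → V)
    (F : Finset V) (s : Finset ι) (hp : ∀ i ∈ s, Function.Injective (p i)) :
    ∃ k : ι → ℕ, (∀ i ∈ s, n0 ≤ k i ∧ p i (k i) ∉ F) ∧
      ∀ i ∈ s, ∀ j ∈ s, p i (k i) = p j (k j) → i = j := by
  classical
  induction s using Finset.induction_on with
  | empty => exact ⟨fun _ => 0, by simp⟩
  | insert a s ha ih =>
    obtain ⟨k, h1, h2⟩ := ih (fun i hi => hp i (Finset.mem_insert_of_mem hi))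
    have hinj := hp a (Finset.mem_insert_self _ _)
    have hfin : ((p a) ⁻¹' (↑(F ∪ s.image fun i => p i (k i)) : Set V)).Finite :=
      Set.Finite.preimage hinj.injOn (Finset.finite_toSet _)
    obtain ⟨m, hm, hm2⟩ := (Set.Ici_infinite n0).exists_notMem_finite hfin
    have hm3 : p a m ∉ F ∧ ∀ i ∈ s, p i (k i) ≠ p a m := by
      simpa [not_or] using hm2
    have hsa : ∀ i ∈ s, i ≠ a := fun i hi h => ha (h ▸ hi)
    refine ⟨Function.update k a m, ?_, ?_⟩
    · intro i hi
      rcases Finset.mem_insert.1 hi with rfl | hi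
      · simpa using ⟨hm, hm3.1⟩
      · rw [Function.update_of_ne (hsa i hi)]; exact h1 i hi
    · intro i hi j hj hij
      rcases Finset.mem_insert.1 hi with hia | his <;>
        rcases Finset.mem_insert.1 hj with hja | hjs
      · exact hia.trans hja.symm
      · subst hia
        rw [Function.update_self, Function.update_of_ne (hsa j hjs)] at hij
        exact absurd hij.symm (hm3.2 j hjs)
      · subst hja
        rw [Function.update_self, Function.update_of_ne (hsa i his)] at hij
        exact absurd hij (hm3.2 i his)
      · rw [Function.update_of_ne (hsa j hjs), Function.update_of_ne (hsa i his)] at hij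
        exact h2 i his j hjs hij

namespace KRPartition

section Comb

variable {X : Type*} [TopologicalSpace X] [MeasurableSpace X] {K : Set (ProbabilityMeasure X)}

theorem atom_inj (S : KRPartition X K) {p q : (i : Fin S.n) × Fin (S.height i)} {x : X}
    (hp : x ∈ S.atom p.1 p.2) (hq : x ∈ S.atom q.1 q.2) : p = q := by
  by_contra h
  exact Set.disjoint_left.1 (S.disj p q h) hp hq

theorem exists_atom (S : KRPartition X K) (x : X) : ∃ i j, x ∈ S.atom i j := by
  have : x ∈ ⋃ (i) (j), S.atom i j := by rw [S.cover]; trivial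
  simpa using this

theorem Refines.subset_of_mem {S T : KRPartition X K} (h : S.Refines T) {c j i k} {x : X}
    (hx : x ∈ S.atom c j) (hx' : x ∈ T.atom i k) : S.atom c j ⊆ T.atom i k := by
  obtain ⟨A, hA⟩ := h.2.1 i k
  have hx2 := hx'
  rw [hA] at hx2
  simp only [Set.mem_iUnion] at hx2
  obtain ⟨p, hp, hxp⟩ := hx2
  have : p = ⟨c, j⟩ := S.atom_inj hxp hx
  subst this
  rw [hA]
  exact Set.subset_biUnion_of_mem (u := fun p : (c : Fin S.n) × Fin (S.height c) =>
    S.atom p.1 p.2) hp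

theorem Refines.exists_subset {S T : KRPartition X K} (h : S.Refines T) (c j) :
    ∃ i k, S.atom c j ⊆ T.atom i k := by
  obtain ⟨x, hx⟩ := S.nonempty c j
  obtain ⟨i, k, hik⟩ := T.exists_atom x
  exact ⟨i, k, h.subset_of_mem hx hik⟩

theorem Refines.trans {R S T : KRPartition X K} (h : R.Refines S) (h' : S.Refines T) :
    R.Refines T := by
  refine ⟨h.1.trans h'.1, ?_, ?_⟩
  · intro i j
    refine ⟨{p | R.atom p.1 p.2 ⊆ T.atom i j}, Set.Subset.antisymm ?_ ?_⟩
    · intro x hx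
      obtain ⟨c, l, hcl⟩ := R.exists_atom x
      obtain ⟨d, m, hdm⟩ := h.exists_subset c l
      simp only [Set.mem_iUnion]
      exact ⟨⟨c, l⟩, hdm.trans (h'.subset_of_mem (hdm hcl) hx), hcl⟩
    · exact Set.iUnion₂_subset fun p hp => hp
  · intro c j i k hsub hk
    obtain ⟨x, hx⟩ := R.nonempty c j
    obtain ⟨d, m, hdm⟩ := h.exists_subset c j
    obtain ⟨hm, hm2⟩ := h'.2.2 d m i k (h'.subset_of_mem (hdm hx) (hsub hx)) hk
    obtain ⟨hj, hj2⟩ := h.2.2 c j d m hdm hm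
    exact ⟨hj, hj2.trans hm2⟩

theorem Refines.isCopyAt_iff {S T : KRPartition X K} (h : S.Refines T) (c i) (j : ℕ) :
    IsCopyAt S T c i j ↔
      ∃ hj : j < S.height c, S.atom c ⟨j, hj⟩ ⊆ T.atom i ⟨0, T.height_pos i⟩ := by
  constructor
  · intro hc
    exact hc 0 (T.height_pos i)
  · rintro ⟨hj, hsub⟩ l
    induction l with
    | zero => intro hl; exact ⟨hj, hsub⟩
    | succ l ih =>
      intro hl
      obtain ⟨h1, h2⟩ := ih (by omega)
      exact h.2.2 c ⟨j + l, h1⟩ i ⟨l, by omega⟩ h2 hl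

open Classical in
theorem Refines.numCopies_eq {S T : KRPartition X K} (h : S.Refines T) (c i) :
    numCopies S T c i = Fintype.card
      {j : Fin (S.height c) // S.atom c j ⊆ T.atom i ⟨0, T.height_pos i⟩} := by
  have : {j : ℕ | IsCopyAt S T c i j} =
      Fin.val '' {j : Fin (S.height c) | S.atom c j ⊆ T.atom i ⟨0, T.height_pos i⟩} := by
    ext j
    simp only [Set.mem_ofPred_eq, h.isCopyAt_iff, Set.mem_image]
    constructor
    · rintro ⟨hj, hs⟩; exact ⟨⟨j, hj⟩, hs, rfl⟩
    · rintro ⟨j, hs, rfl⟩; exact ⟨j.2, hs⟩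
  rw [numCopies, this, Set.ncard_image_of_injective _ Fin.val_injective,
    ← Nat.card_coe_set_eq, Nat.card_eq_fintype_card]
  rfl

/-- Levels of a concatenation of `a d` copies of columns of height `h d`. -/
def levelEquiv {n : ℕ} (a h : Fin n → ℕ) :
    (Σ d : Fin n, Fin (a d) × Fin (h d)) ≃ Fin (∑ d, a d * h d) :=
  (Equiv.sigmaCongrRight fun _ => finProdFinEquiv).trans finSigmaFinEquiv

theorem levelEquiv_succ {n : ℕ} (a h : Fin n → ℕ) (d : Fin n) (k : Fin (a d)) (j : ℕ)
    (hj : j + 1 < h d) :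
    (levelEquiv a h ⟨d, k, ⟨j + 1, hj⟩⟩ : ℕ) =
      (levelEquiv a h ⟨d, k, ⟨j, by omega⟩⟩ : ℕ) + 1 := by
  simp only [levelEquiv, Equiv.trans_apply, finSigmaFinEquiv_apply,
    Equiv.sigmaCongrRight_apply, finProdFinEquiv_apply_val]
  omega

end Comb

section Construct

variable {X : Type*} [TopologicalSpace X] [MeasurableSpace X] [BorelSpace X]
  {K : Set (ProbabilityMeasure X)}

theorem construct (hK : IsDynSimplex K) (S : KRPartition X K)
    (a : Fin S.n → Fin S.n → ℕ) (ha : ∀ c, ∃ d, 0 < a c d)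
    (V : Fin S.n → Set X) (hV : ∀ c, IsClopen (V c)) (hne : ∀ c, (V c).Nonempty)
    (hsum : ∀ μ ∈ K, ∀ d, ∑ c, (a c d : ℝ) * (μ : Measure X).real (V c) =
      (μ : Measure X).real (S.atom d ⟨0, S.height_pos d⟩)) :
    ∃ S' : KRPartition X K, ∃ e : Fin S'.n ≃ Fin S.n, S'.Refines S ∧
      (∀ c, S'.height c = ∑ d, a (e c) d * S.height d) ∧
      ∀ T : KRPartition X K, S.Refines T → ∀ c i,
        numCopies S' T c i = ∑ d, a (e c) d * numCopies S T d i := by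
  classical
  have hpart : ∀ (d : Fin S.n) (j : Fin (S.height d)),
      ∃ W : (Σ c : Fin S.n, Fin (a c d)) → Set X, (∀ p, IsClopen (W p)) ∧
      (∀ p, ∀ μ ∈ K, (μ : Measure X).real (W p) = (μ : Measure X).real (V p.1)) ∧
      (∀ p q, p ≠ q → Disjoint (W p) (W q)) ∧
      (∀ x, x ∈ S.atom d j ↔ ∃ p, x ∈ W p) := by
    intro d j
    have := partition_clopen hK (Finset.univ : Finset (Σ c : Fin S.n, Fin (a c d)))
      (fun p => V p.1) (fun p _ => hV _) (fun p _ => hne _) (S.atom d j) (S.clopen d j)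
      (fun μ hμ => by
        rw [Fintype.sum_sigma]
        simp only [Finset.sum_const, Finset.card_univ, Fintype.card_fin, nsmul_eq_mul]
        rw [hsum μ hμ d, measureReal_def, measureReal_def,
          S.measure_eq d ⟨0, S.height_pos d⟩ j μ hμ])
    simpa using this
  choose W hWc hWm hWd hWU using hpart
  have hWsub : ∀ d j p, W d j p ⊆ S.atom d j := fun d j p x hx => (hWU d j x).2 ⟨p, hx⟩
  have hWne : ∀ d j p, (W d j p).Nonempty := fun d j p => by
    obtain ⟨μ, hμ⟩ := hK.1
    have h1 := hWm d j p μ hμ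
    have h2 := measureReal_pos' hK (hV p.1) (hne p.1) hμ
    by_contra hcon
    rw [Set.not_nonempty_iff_eq_empty] at hcon
    rw [hcon, measureReal_empty] at h1
    linarith
  let E := fun c : Fin S.n => levelEquiv (a c) S.height
  let at' : (c : Fin S.n) → (Σ d : Fin S.n, Fin (a c d) × Fin (S.height d)) → Set X :=
    fun c x => W x.1 x.2.2 ⟨c, x.2.1⟩
  have hat : ∀ c l, at' c ((E c).symm l) ⊆
      S.atom ((E c).symm l).1 ((E c).symm l).2.2 := fun c l => hWsub _ _ _
  have hatinj : ∀ c x c' x' (y : X), y ∈ at' c x → y ∈ at' c' x' →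
      (⟨c, x⟩ : Σ c, Σ d : Fin S.n, Fin (a c d) × Fin (S.height d)) = ⟨c', x'⟩ := by
    rintro c ⟨d, k, j⟩ c' ⟨d', k', j'⟩ y hy hy'
    have h1 : (⟨d, j⟩ : (i : Fin S.n) × Fin (S.height i)) = ⟨d', j'⟩ :=
      S.atom_inj (hWsub _ _ _ hy) (hWsub _ _ _ hy')
    cases h1
    have h2 : (⟨c, k⟩ : Σ c : Fin S.n, Fin (a c d)) = ⟨c', k'⟩ := by
      by_contra hcon
      exact Set.disjoint_left.1 (hWd d j _ _ hcon) hy hy'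
    cases h2
    rfl
  let S' : KRPartition X K :=
    { n := S.n
      npos := S.npos
      height := fun c => ∑ d, a c d * S.height d
      height_pos := fun c => by
        obtain ⟨d, hd⟩ := ha c
        exact Finset.sum_pos' (fun _ _ => Nat.zero_le _)
          ⟨d, Finset.mem_univ _, Nat.mul_pos hd (S.height_pos d)⟩
      atom := fun c l => at' c ((E c).symm l)
      clopen := fun c l => hWc _ _ _
      nonempty := fun c l => hWne _ _ _
      disj := by
        rintro ⟨c, l⟩ ⟨c', l'⟩ hne
        rw [Set.disjoint_left]
        intro y hy hy'
        have h1 := hatinj _ _ _ _ y hy hy'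
        apply hne
        simp only [Sigma.mk.injEq] at h1
        obtain ⟨rfl, h2⟩ := h1
        have := (E c).symm.injective (eq_of_heq h2)
        rw [this]
      cover := by
        refine Set.eq_univ_of_forall fun x => ?_
        obtain ⟨d, j, hx⟩ := S.exists_atom x
        obtain ⟨⟨c, k⟩, hck⟩ := (hWU d j x).1 hx
        simp only [Set.mem_iUnion]
        refine ⟨c, E c ⟨d, k, j⟩, ?_⟩
        rw [Equiv.symm_apply_apply]
        exact hck
      measure_eq := by
        intro c j k μ hμ
        have h1 : (μ : Measure X).real (at' c ((E c).symm j)) =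
          (μ : Measure X).real (at' c ((E c).symm k)) := by
            simp only [at']
            rw [hWm _ _ _ μ hμ, hWm _ _ _ μ hμ]
        simp only [measureReal_def] at h1
        exact (ENNReal.toReal_eq_toReal_iff' (measure_ne_top _ _) (measure_ne_top _ _)).1 h1 }
  have hS'atom : ∀ (c : Fin S.n) x, S'.atom c (E c x) = at' c x := fun c x => by
    change at' c ((E c).symm (E c x)) = _
    rw [Equiv.symm_apply_apply]
  have hRef : S'.Refines S := by
    refine ⟨?_, ?_, ?_⟩
    · intro y hy
      simp only [base, Set.mem_iUnion] at hy ⊢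
      obtain ⟨c, hc⟩ := hy
      obtain ⟨x, hx⟩ := (E c).surjective ⟨0, S'.height_pos c⟩
      have hc' : y ∈ at' c x := by rw [← hS'atom, hx]; exact hc
      obtain ⟨d, k, ⟨j, hj⟩⟩ := x
      cases j with
      | zero => exact ⟨d, hWsub _ _ _ hc'⟩
      | succ j =>
        have h1 := levelEquiv_succ (a c) S.height d k j hj
        have h2 := congrArg Fin.val hx
        change (levelEquiv (a c) S.height ⟨d, k, ⟨j + 1, hj⟩⟩ : ℕ) = 0 at h2
        omega
    · intro d j
      refine ⟨{p | S'.atom p.1 p.2 ⊆ S.atom d j}, Set.Subset.antisymm ?_ ?_⟩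
      · intro x hx
        obtain ⟨⟨c, k⟩, hck⟩ := (hWU d j x).1 hx
        simp only [Set.mem_iUnion]
        refine ⟨⟨c, E c ⟨d, k, j⟩⟩, ?_, ?_⟩
        · change S'.atom c (E c ⟨d, k, j⟩) ⊆ _
          rw [hS'atom]
          exact hWsub _ _ _
        · change x ∈ S'.atom c (E c ⟨d, k, j⟩)
          rw [hS'atom]
          exact hck
      · exact Set.iUnion₂_subset fun p hp => hp
    · intro c l d j hsub hj
      obtain ⟨x, rfl⟩ := (E c).surjective l
      rw [hS'atom] at hsub
      obtain ⟨d', k, j'⟩ := x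
      obtain ⟨y, hy⟩ := hWne d' j' ⟨c, k⟩
      have h1 : (⟨d', j'⟩ : (i : Fin S.n) × Fin (S.height i)) = ⟨d, j⟩ :=
        S.atom_inj (hWsub _ _ _ hy) (hsub hy)
      cases h1
      have h2 := levelEquiv_succ (a c) S.height d k j hj
      have h3 : ((E c ⟨d, k, j⟩ : Fin _) : ℕ) + 1 < S'.height c := by
        rw [← h2]
        exact (levelEquiv (a c) S.height ⟨d, k, ⟨j + 1, hj⟩⟩).2
      refine ⟨h3, ?_⟩
      have h4 : (⟨((E c ⟨d, k, j⟩ : Fin _) : ℕ) + 1, h3⟩ : Fin (S'.height c)) =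
          E c ⟨d, k, ⟨j + 1, hj⟩⟩ := Fin.ext h2.symm
      rw [h4, hS'atom]
      exact hWsub _ _ _
  refine ⟨S', Equiv.refl _, hRef, fun c => rfl, ?_⟩
  intro T hT c i
  rw [(hRef.trans hT).numCopies_eq]
  have hiff : ∀ x : Σ d : Fin S.n, Fin (a c d) × Fin (S.height d),
      S.atom x.1 x.2.2 ⊆ T.atom i ⟨0, T.height_pos i⟩ ↔
      S'.atom c (E c x) ⊆ T.atom i ⟨0, T.height_pos i⟩ := by
    intro x
    rw [hS'atom]
    constructor
    · intro h; exact (hWsub _ _ _).trans h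
    · intro h
      obtain ⟨y, hy⟩ := hWne x.1 x.2.2 ⟨c, x.2.1⟩
      exact hT.subset_of_mem (hWsub _ _ _ hy) (h hy)
  rw [← Fintype.card_congr ((E c).subtypeEquiv hiff), Fintype.card_subtype, Finset.card_filter,
    Fintype.sum_sigma]
  refine Finset.sum_congr rfl fun d _ => ?_
  rw [Fintype.sum_prod_type, hT.numCopies_eq, Fintype.card_subtype, Finset.card_filter]
  simp

end Construct

end KRPartition

theorem mix_injective {A B α β : ℚ} (hα : 0 < α) (hβ : 0 < β) (h : A / α ≠ B / β) :
    ∀ k l : ℕ, (k * A + B) / (k * α + β) = (l * A + B) / (l * α + β) → k = l := by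
  intro k l hkl
  have h1 : (0 : ℚ) < k * α + β := by positivity
  have h2 : (0 : ℚ) < l * α + β := by positivity
  rw [div_eq_div_iff h1.ne' h2.ne'] at hkl
  rw [Ne, div_eq_div_iff hα.ne' hβ.ne'] at h
  have h3 : ((k : ℚ) - l) * (A * β - B * α) = 0 := by linear_combination hkl
  rcases mul_eq_zero.1 h3 with h4 | h4
  · exact_mod_cast sub_eq_zero.1 h4
  · exact absurd (sub_eq_zero.1 h4) h

namespace KRPartition

section Steps

variable {X : Type*} [TopologicalSpace X] [MeasurableSpace X] [BorelSpace X]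
  {K : Set (ProbabilityMeasure X)}

theorem sum_base (S : KRPartition X K) {μ : ProbabilityMeasure X} (hμ : μ ∈ K) :
    ∑ c, (S.height c : ℝ) * (μ : Measure X).real (S.atom c ⟨0, S.height_pos c⟩) = 1 := by
  have h1 : (μ : Measure X).real (⋃ p : (i : Fin S.n) × Fin (S.height i), S.atom p.1 p.2) =
      ∑ p : (i : Fin S.n) × Fin (S.height i), (μ : Measure X).real (S.atom p.1 p.2) :=
    measureReal_iUnion_fintype (fun p q hpq => S.disj p q hpq)
      (fun p => (S.clopen p.1 p.2).isOpen.measurableSet)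
  rw [Set.iUnion_sigma, S.cover, probReal_univ, Fintype.sum_sigma] at h1
  rw [h1]
  refine Finset.sum_congr rfl fun c _ => ?_
  rw [Finset.sum_congr rfl (fun j _ => by
    rw [measureReal_def, S.measure_eq c j ⟨0, S.height_pos c⟩ μ hμ] :
    ∀ j ∈ Finset.univ, (μ : Measure X).real (S.atom c j) =
      ((μ : Measure X) (S.atom c ⟨0, S.height_pos c⟩)).toReal)]
  simp [measureReal_def]

theorem exists_lower (hK : IsDynSimplex K) (S : KRPartition X K) (M : ℝ) (hM : 0 ≤ M) :
    ∃ n0 : ℕ, 1 ≤ n0 ∧ ∀ c, ∀ μ ∈ K,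
      M / n0 < (μ : Measure X).real (S.atom c ⟨0, S.height_pos c⟩) := by
  choose ε hε hb using fun c => measureReal_lower hK (S.clopen c ⟨0, S.height_pos c⟩)
    (S.nonempty c ⟨0, S.height_pos c⟩)
  choose nd hnd using fun c => exists_nat_gt (M / ε c)
  refine ⟨1 + ∑ c, nd c, by omega, fun c μ hμ => lt_of_lt_of_le ?_ (hb c μ hμ)⟩
  have h1 : nd c ≤ 1 + ∑ c, nd c :=
    (Finset.single_le_sum (fun _ _ => Nat.zero_le _) (Finset.mem_univ c)).trans (by omega)
  have h2 : (nd c : ℝ) ≤ ((1 + ∑ c, nd c : ℕ) : ℝ) := by exact_mod_cast h1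
  have h3 := (div_lt_iff₀ (hε c)).1 ((hnd c).trans_le h2)
  have h4 : (0 : ℝ) < ((1 + ∑ c, nd c : ℕ) : ℝ) := by exact_mod_cast (by omega)
  rw [div_lt_iff₀ h4]
  linarith

theorem nonempty_of_pos {V : Set X} {μ : ProbabilityMeasure X}
    (h : 0 < (μ : Measure X).real V) : V.Nonempty := by
  by_contra hcon
  rw [Set.not_nonempty_iff_eq_empty] at hcon
  rw [hcon, measureReal_empty] at h
  exact lt_irrefl _ h

theorem step_one (hK : IsDynSimplex K) (hdiv : Divisible K)
    (T S : KRPartition X K) (hST : S.Refines T)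
    (c0 c1 : Fin S.n) (h01 : ¬ Twins S T c0 c1) :
    ∃ S' : KRPartition X K, S'.Refines S ∧ ∀ c c', c ≠ c' → ¬ Twins S' T c c' := by
  classical
  let r : Fin S.n → Fin T.n → ℚ := fun c i => (numCopies S T c i : ℚ) / (S.height c : ℚ)
  have htw : ∀ c c', Twins S T c c' ↔ r c = r c' := fun c c' => by
    rw [funext_iff]; rfl
  rw [htw] at h01
  obtain ⟨D, hD, hD'⟩ : ∃ D : Fin S.n → Fin S.n, (∀ c, r c ≠ r (D c)) ∧
      ∀ c, D c = c0 ∨ D c = c1 := by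
    refine ⟨fun c => if r c = r c0 then c1 else c0, fun c => ?_, fun c => ?_⟩
    · by_cases h : r c = r c0
      · simp only [h, if_true]; exact h01
      · simp only [h, if_false]; exact h
    · by_cases h : r c = r c0 <;> simp [h]
  let s : Finset (Fin S.n) := Finset.univ.filter fun c => c ≠ c0 ∧ c ≠ c1
  have hDs : ∀ c, D c ∉ s := fun c => by
    rcases hD' c with h | h <;> simp [s, h]
  have hs : ∀ c, c ∉ s → c = c0 ∨ c = c1 := fun c hc => by
    simp only [s, Finset.mem_filter, Finset.mem_univ, true_and] at hc
    tauto
  let p : Fin S.n → ℕ → Fin T.n → ℚ := fun c k i =>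
    (k * (numCopies S T c i : ℚ) + (numCopies S T (D c) i : ℚ)) /
      (k * (S.height c : ℚ) + (S.height (D c) : ℚ))
  have hpos : ∀ c, (0 : ℚ) < S.height c := fun c => by exact_mod_cast S.height_pos c
  have hp : ∀ c ∈ s, Function.Injective (p c) := by
    intro c _ k l hkl
    obtain ⟨i, hi⟩ := Function.ne_iff.1 (hD c)
    exact mix_injective (hpos c) (hpos (D c)) hi k l (congrFun hkl i)
  obtain ⟨n0, hn0, hlow⟩ := exists_lower hK S S.n (Nat.cast_nonneg _)
  obtain ⟨k, hk1, hk2⟩ := greedy_choice n0 p {r c0, r c1} s hp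
  let kk : Fin S.n → ℕ := fun c => if c ∈ s then k c else 1
  have hkk : ∀ c, 1 ≤ kk c := fun c => by
    by_cases hc : c ∈ s
    · simp only [kk, hc, if_true]; exact hn0.trans (hk1 c hc).1
    · simp [kk, hc]
  let a : Fin S.n → Fin S.n → ℕ := fun c d =>
    (if d = c then kk c else 0) + (if c ∈ s ∧ d = D c then 1 else 0)
  let b : Fin S.n → ProbabilityMeasure X → ℝ := fun c μ =>
    (μ : Measure X).real (S.atom c ⟨0, S.height_pos c⟩)
  have hb : ∀ c, ClopenValue K (b c) := fun c => ⟨_, S.clopen c _, fun μ _ => rfl⟩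
  have hb0 : ∀ c μ, 0 ≤ b c μ := fun c μ => measureReal_nonneg
  have hb1 : ∀ c μ, b c μ ≤ 1 := fun c μ => measureReal_le_one
  let z : Fin S.n → ProbabilityMeasure X → ℝ := fun c μ => b c μ / kk c
  have hz : ∀ c, ClopenValue K (z c) := fun c => (hb c).div hdiv (hkk c)
  have hz0 : ∀ c μ, 0 ≤ z c μ := fun c μ => div_nonneg (hb0 c μ) (Nat.cast_nonneg _)
  have hn0' : (0 : ℝ) < n0 := by exact_mod_cast hn0
  have hlt : ∀ d, ∀ μ ∈ K, ∑ c ∈ s.filter (fun c => D c = d), z c μ < b d μ := by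
    intro d μ hμ
    refine lt_of_le_of_lt ?_ (hlow d μ hμ)
    have h1 : ∀ c ∈ s.filter (fun c => D c = d), z c μ ≤ 1 / n0 := by
      intro c hc
      have hcs := (Finset.mem_filter.1 hc).1
      have h2 : (n0 : ℝ) ≤ kk c := by
        simp only [kk, hcs, if_true]; exact_mod_cast (hk1 c hcs).1
      exact div_le_div₀ zero_le_one (hb1 c μ) hn0' h2
    refine (Finset.sum_le_sum h1).trans ?_
    rw [Finset.sum_const, nsmul_eq_mul, mul_one_div]
    gcongr
    simpa using Finset.card_le_univ (s.filter (fun c => D c = d))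
  have hv : ∀ d, ClopenValue K
      (fun μ => (b d μ - ∑ c ∈ s.filter (fun c => D c = d), z c μ) / kk d) := fun d =>
    (ClopenValue.sub_sum hK _ (fun c _ => hz c) (hb d) (fun c _ μ _ => hz0 c μ) (hlt d)).div
      hdiv (hkk d)
  choose V hVc hVm using hv
  have hkk' : ∀ c, (0 : ℝ) < kk c := fun c => by exact_mod_cast hkk c
  have hVs : ∀ c ∈ s, ∀ μ ∈ K, (μ : Measure X).real (V c) = z c μ := by
    intro c hc μ hμ
    rw [hVm c μ hμ]
    have : s.filter (fun c' => D c' = c) = ∅ := by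
      rw [Finset.filter_eq_empty_iff]
      intro c' _ h
      exact hDs c' (h ▸ hc)
    simp [this, z]
  obtain ⟨S', e, hRef, hh, hcop⟩ := construct hK S a
    (fun c => ⟨c, by
      have := hkk c
      simp only [a, if_true]
      omega⟩) V hVc
    (fun c => by
      obtain ⟨μ, hμ⟩ := hK.1
      refine nonempty_of_pos (μ := μ) ?_
      rw [hVm c μ hμ]
      exact div_pos (sub_pos.2 (hlt c μ hμ)) (hkk' c))
    (fun μ hμ d => by
      have h1 : ∑ c, (a c d : ℝ) * (μ : Measure X).real (V c) =
          kk d * (μ : Measure X).real (V d) +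
            ∑ c ∈ s.filter (fun c => D c = d), (μ : Measure X).real (V c) := by
        simp only [a, Nat.cast_add, add_mul, Finset.sum_add_distrib]
        congr 1
        · rw [Finset.sum_eq_single d]
          · simp
          · intro c _ hc
            simp [hc.symm]
          · simp
        · have h5 : s.filter (fun c => D c = d) =
              Finset.univ.filter (fun c => c ∈ s ∧ d = D c) := by
            ext c
            simp [eq_comm]
          rw [h5, Finset.sum_filter]
          refine Finset.sum_congr rfl fun c _ => ?_
          by_cases hc : c ∈ s ∧ d = D c
          · rw [if_pos hc, if_pos hc]; simp
          · rw [if_neg hc, if_neg hc]; simp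
      rw [h1, Finset.sum_congr rfl (fun c hc => hVs c (Finset.mem_filter.1 hc).1 μ hμ),
        hVm d μ hμ, mul_div_cancel₀ _ (hkk' d).ne']
      simp [b])
  have hasum : ∀ c (g : Fin S.n → ℕ), ∑ d, a c d * g d =
      kk c * g c + if c ∈ s then g (D c) else 0 := by
    intro c g
    by_cases hc : c ∈ s <;> simp [a, hc, add_mul, Finset.sum_add_distrib]
  let Q : Fin S.n → Fin T.n → ℚ := fun c => if c ∈ s then p c (k c) else r c
  have hQ : ∀ c i, (numCopies S' T c i : ℚ) / (S'.height c : ℚ) = Q (e c) i := by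
    intro c i
    rw [hcop T hST, hh, hasum, hasum]
    by_cases hc : e c ∈ s
    · simp [Q, hc, p, kk]
    · simp [Q, hc, r, kk]
  have hr : ∀ c, c ∉ s → r c ∈ ({r c0, r c1} : Finset _) := fun c hc => by
    rcases hs c hc with rfl | rfl <;> simp
  have hQinj : Function.Injective Q := by
    intro c c' hcc
    by_cases hc : c ∈ s <;> by_cases hc' : c' ∈ s <;> simp only [Q, hc, hc', if_true, if_false] at hcc
    · exact hk2 c hc c' hc' hcc
    · exact absurd (hcc ▸ hr c' hc') (hk1 c hc).2
    · exact absurd (hcc ▸ hr c hc) (hk1 c' hc').2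
    · rcases hs c hc with rfl | rfl <;> rcases hs c' hc' with rfl | rfl
      · rfl
      · exact absurd hcc h01
      · exact absurd hcc.symm h01
      · rfl
  refine ⟨S', hRef, fun c c' hne htwin => hne (e.injective (hQinj (funext fun i => ?_)))⟩
  rw [← hQ, ← hQ]
  exact htwin i

theorem step_two (hK : IsDynSimplex K) (hdiv : Divisible K)
    (T S : KRPartition X K) (hST : S.Refines T)
    (hS : ∀ c c', c ≠ c' → ¬ Twins S T c c') :
    ∃ S' : KRPartition X K, S'.Refines S ∧
      (∀ (c : Fin S'.n) (i : Fin T.n), ∃ j : ℕ, IsCopyAt S' T c i j) ∧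
      (∀ c c' : Fin S'.n, c ≠ c' → ¬ Twins S' T c c') ∧
      (∀ c c' : Fin S'.n, S'.height c = S'.height c') := by
  classical
  obtain ⟨t, ht, hlow⟩ := exists_lower hK S 1 zero_le_one
  let L : ℕ := ∏ c, S.height c
  let Y : ℕ := ∑ c, S.height c
  let x : Fin S.n → ℕ := fun c => t * ∏ d ∈ Finset.univ.erase c, S.height d
  have hL : 0 < L := Finset.prod_pos fun c _ => S.height_pos c
  have hx : ∀ c, x c * S.height c = t * L := fun c => by
    simp only [x, L, mul_assoc]
    rw [Finset.prod_erase_mul _ _ (Finset.mem_univ c)]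
  have hxpos : ∀ c, 1 ≤ x c := fun c =>
    Nat.mul_pos ht (Finset.prod_pos fun c _ => S.height_pos c)
  let H : ℕ := t * L + Y
  have htH : t ≤ H := (Nat.le_mul_of_pos_right t hL).trans (Nat.le_add_right _ _)
  have hH : 1 ≤ H := ht.trans htH
  let b : Fin S.n → ProbabilityMeasure X → ℝ := fun c μ =>
    (μ : Measure X).real (S.atom c ⟨0, S.height_pos c⟩)
  have hb : ∀ c, ClopenValue K (b c) := fun c => ⟨_, S.clopen c _, fun μ _ => rfl⟩
  have hone : ClopenValue K (fun _ => (1 : ℝ)) := ⟨Set.univ, isClopen_univ, fun μ _ => by simp⟩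
  have htR : (0 : ℝ) < t := by exact_mod_cast ht
  have hlt : ∀ c, ∀ μ ∈ K, 1 / (H : ℝ) < b c μ := fun c μ hμ => by
    refine lt_of_le_of_lt ?_ (hlow c μ hμ)
    have : (t : ℝ) ≤ H := by exact_mod_cast htH
    exact one_div_le_one_div_of_le htR this
  have hv : ∀ c, ClopenValue K (fun μ => (b c μ - 1 / H) / x c) := fun c =>
    (ClopenValue.sub hK (hone.div hdiv hH) (hb c) (hlt c)).div hdiv (hxpos c)
  choose V hVc hVm using hv
  have hxR : ∀ c, (0 : ℝ) < x c := fun c => by exact_mod_cast hxpos c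
  let a : Fin S.n → Fin S.n → ℕ := fun c d => (if d = c then x c else 0) + 1
  obtain ⟨S', e, hRef, hh, hcop⟩ := construct hK S a
    (fun c => ⟨c, by simp only [a]; omega⟩) V hVc
    (fun c => by
      obtain ⟨μ, hμ⟩ := hK.1
      refine nonempty_of_pos (μ := μ) ?_
      rw [hVm c μ hμ]
      exact div_pos (sub_pos.2 (hlt c μ hμ)) (hxR c))
    (fun μ hμ d => by
      have h1 : ∑ c, (a c d : ℝ) * (μ : Measure X).real (V c) =
          x d * (μ : Measure X).real (V d) + ∑ c, (μ : Measure X).real (V c) := by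
        simp only [a, Nat.cast_add, add_mul, Finset.sum_add_distrib]
        congr 1
        · rw [Finset.sum_eq_single d]
          · simp
          · intro c _ hc
            simp [hc.symm]
          · simp
        · simp
      have htL : (0 : ℝ) < t * L := by
        have : (0 : ℝ) < L := by exact_mod_cast hL
        positivity
      have hHR : (0 : ℝ) < H := by exact_mod_cast hH
      have h2 : ∀ c, (μ : Measure X).real (V c) =
          (S.height c * b c μ - S.height c * (1 / H)) / (t * L) := fun c => by
        rw [hVm c μ hμ, div_eq_div_iff (hxR c).ne' htL.ne']
        have : (x c : ℝ) * S.height c = t * L := by exact_mod_cast hx c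
        rw [← this]
        ring
      have h3 : ∑ c, (μ : Measure X).real (V c) = 1 / H := by
        rw [Finset.sum_congr rfl fun c _ => h2 c, ← Finset.sum_div, Finset.sum_sub_distrib,
          ← Finset.sum_mul]
        have h4 := S.sum_base hμ
        change ∑ c, (S.height c : ℝ) * b c μ = 1 at h4
        have h5 : (∑ c, (S.height c : ℝ)) = H - t * L := by
          simp only [H, Y]
          push_cast
          ring
        rw [h4, h5]
        field_simp
        ring
      rw [h1, h3, hVm d μ hμ, mul_div_cancel₀ _ (hxR d).ne']
      simp [b])
  have hasum : ∀ c (g : Fin S.n → ℕ), ∑ d, a c d * g d = x c * g c + ∑ d, g d := by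
    intro c g
    simp [a, add_mul, Finset.sum_add_distrib]
  have hheight : ∀ c, S'.height c = H := fun c => by
    rw [hh, hasum, hx]
  have hR2 := hRef.trans hST
  have hN : ∀ i, 0 < ∑ d, numCopies S T d i := by
    intro i
    obtain ⟨y, hy⟩ := T.nonempty i ⟨0, T.height_pos i⟩
    obtain ⟨d, j, hdj⟩ := S.exists_atom y
    refine Finset.sum_pos' (fun _ _ => Nat.zero_le _) ⟨d, Finset.mem_univ _, ?_⟩
    rw [hST.numCopies_eq, Fintype.card_pos_iff]
    exact ⟨⟨j, hST.subset_of_mem hdj hy⟩⟩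
  refine ⟨S', hRef, ?_, ?_, fun c c' => by rw [hheight, hheight]⟩
  · intro c i
    have h1 : numCopies S' T c i ≠ 0 := by
      rw [hcop T hST, hasum]
      have := hN i
      omega
    exact Set.nonempty_of_ncard_ne_zero h1
  · intro c c' hne htw
    refine hS (e c) (e c') (fun h => hne (e.injective h)) fun i => ?_
    have h1 := htw i
    rw [hheight, hheight, hcop T hST, hcop T hST, hasum, hasum] at h1
    have hHQ : (H : ℚ) ≠ 0 := by
      have : (0 : ℚ) < H := by exact_mod_cast hH
      exact this.ne'
    rw [div_left_inj' hHQ] at h1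
    push_cast at h1
    have h2 := add_right_cancel h1
    have hpos : ∀ c, (0 : ℚ) < S.height c := fun c => by exact_mod_cast S.height_pos c
    have hxc : ∀ c, (x c : ℚ) * S.height c = t * L := fun c => by exact_mod_cast hx c
    have htL : (t : ℚ) * L ≠ 0 := by
      rw [← hxc (e c)]
      have : (0 : ℚ) < x (e c) := by exact_mod_cast hxpos (e c)
      exact (mul_pos this (hpos _)).ne'
    rw [div_eq_div_iff (hpos _).ne' (hpos _).ne']
    apply mul_left_cancel₀ htL
    linear_combination (S.height (e c) * S.height (e c') : ℚ) * h2 -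
      (numCopies S T (e c) i * S.height (e c') : ℚ) * hxc (e c) +
      (numCopies S T (e c') i * S.height (e c) : ℚ) * hxc (e c')

end Steps

end KRPartition

/-- refinement lemma. If `𝒯` is a KR-partition with at least two columns and `𝒮`
refines `𝒯` with at least two columns that are not `𝒯`-twins, then one may further refine `𝒮`
to `𝒮'` so that every column of `𝒮'` contains a copy of every column of `𝒯`, no two columns of
`𝒮'` are `𝒯`-twins, and all columns of `𝒮'` have the same height. -/
theorem refinement_lemma
    {X : Type*} [TopologicalSpace X] [CompactSpace X] [TopologicalSpace.MetrizableSpace X]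
    [TotallyDisconnectedSpace X] [Nonempty X] [MeasurableSpace X] [BorelSpace X]
    (hX : Perfect (Set.univ : Set X))
    (K : Set (ProbabilityMeasure X)) (hK : IsDynSimplex K) (hdiv : Divisible K)
    (T : KRPartition X K) (hT : 2 ≤ T.n)
    (S : KRPartition X K) (hST : S.Refines T)
    (htwins : ∃ c c' : Fin S.n, c ≠ c' ∧ ¬ KRPartition.Twins S T c c') :
    ∃ S' : KRPartition X K, S'.Refines S ∧
      (∀ (c : Fin S'.n) (i : Fin T.n), ∃ j : ℕ, KRPartition.IsCopyAt S' T c i j) ∧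
      (∀ c c' : Fin S'.n, c ≠ c' → ¬ KRPartition.Twins S' T c c') ∧
      (∀ c c' : Fin S'.n, S'.height c = S'.height c') := by
  obtain ⟨c0, c1, -, h01⟩ := htwins
  obtain ⟨S1, hS1, hS1t⟩ := KRPartition.step_one hK hdiv T S hST c0 c1 h01
  obtain ⟨S2, hS2, h1, h2, h3⟩ := KRPartition.step_two hK hdiv T S1 (hS1.trans hST) hS1t
  exact ⟨S2, hS2.trans hS1, h1, h2, h3⟩
end
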